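/- Let f ∈ L log L(𝕋²). Then for almost every (x,y) ∈ 𝕋², ‖Σ_{k=0}^{n} (S_{kk}(x,y,f) − f(x,y))·𝟙_{δ_k^n}‖_(Ψ) → 0 as n → ∞, where the Luxemburg Ψ-norm is taken on [0,1] with Ψ(t) = eᵗ − 1. -/

import Mathlib

open MeasureTheory Filter Set

noncomputable section

/-- `[-π, π)`, a fundamental domain for the circle `𝕋 = ℝ/2πℤ`. -/
def T1 : Set ℝ := Set.Ico (-Real.pi) Real.pi

/-- `[-π, π)²`, a fundamental domain for the torus `𝕋²`. -/
def T2 : Set (ℝ × ℝ) := T1 ×ˢ T1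

/-- `log⁺ u = log u` for `u > 1`, and `0` otherwise. -/
def logPlus (u : ℝ) : ℝ := if 1 < u then Real.log u else 0

/-- `f` is `2π`-periodic in each variable. -/
def Biperiodic (f : ℝ × ℝ → ℝ) : Prop :=
  ∀ x y : ℝ, f (x + 2 * Real.pi, y) = f (x, y) ∧ f (x, y + 2 * Real.pi) = f (x, y)

/-- Fourier coefficients `f̂(m,n)` of a function on `𝕋²`. -/
def fourierCoef2 (f : ℝ × ℝ → ℝ) (m n : ℤ) : ℂ :=
  (1 / (4 * (Real.pi : ℂ) ^ 2)) *
    ∫ p in T2, (f p : ℂ) * Complex.exp (-Complex.I * ((m : ℂ) * (p.1 : ℂ) + (n : ℂ) * (p.2 : ℂ)))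

/-- Quadratic partial sums `S_{nn}(x, y, f)` of the double Fourier series.
(For real `f` the symmetric sum is real, so we take the real part.) -/
def Snn (f : ℝ × ℝ → ℝ) (n : ℕ) (x y : ℝ) : ℝ :=
  (∑ m ∈ Finset.Icc (-(n : ℤ)) (n : ℤ), ∑ k ∈ Finset.Icc (-(n : ℤ)) (n : ℤ),
    fourierCoef2 f m k * Complex.exp (Complex.I * ((m : ℂ) * (x : ℂ) + (k : ℂ) * (y : ℂ)))).re

/-- The `BMO[0,1]` norm:
`‖g‖_BMO = sup_{I ⊂ [0,1]} (1/|I|) ∫_I |g - g_I| + |∫_0^1 g|`. -/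
def bmoNorm (g : ℝ → ℝ) : ℝ :=
  (⨆ I : {p : ℝ × ℝ // 0 ≤ p.1 ∧ p.1 < p.2 ∧ p.2 ≤ 1},
      (I.1.2 - I.1.1)⁻¹ *
        ∫ t in Set.Icc I.1.1 I.1.2,
          |g t - (I.1.2 - I.1.1)⁻¹ * ∫ s in Set.Icc I.1.1 I.1.2, g s|) +
    |∫ t in Set.Icc (0 : ℝ) 1, g t|

/-- The step function `Σ_{k=0}^n ξ_k 𝟙_{δ_k^n}` with `δ_k^n = [k/(n+1), (k+1)/(n+1)]`. -/
def stepFun (ξ : ℕ → ℝ) (n : ℕ) (t : ℝ) : ℝ :=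
  ∑ k ∈ Finset.range (n + 1),
    Set.indicator (Set.Icc ((k : ℝ) / ((n : ℝ) + 1)) (((k : ℝ) + 1) / ((n : ℝ) + 1)))
      (fun _ => ξ k) t

/-- `bmo[ξ_n] = sup_{n ≥ 0} ‖Σ_{k=0}^n ξ_k 𝟙_{δ_k^n}‖_BMO`. -/
def bmoSeq (ξ : ℕ → ℝ) : ℝ := ⨆ n : ℕ, bmoNorm (stepFun ξ n)

/-- `L` is the principal value `p.v. ∫_𝕋 g`, i.e. the limit as `ε → 0⁺` of the
integrals over `{ε < |t| < π}`. -/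
def pvT1 (g : ℝ → ℝ) (L : ℝ) : Prop :=
  Filter.Tendsto (fun ε : ℝ => ∫ t in {t : ℝ | ε < |t| ∧ |t| < Real.pi}, g t)
    (nhdsWithin 0 (Set.Ioi 0)) (nhds L)

/-- `L` is the two-dimensional principal value `p.v. ∬_{𝕋²} g`, the limit as `ε → 0⁺`
of the integrals over `{ε < |t| < π, ε < |s| < π}`. -/
def pvT2 (g : ℝ × ℝ → ℝ) (L : ℝ) : Prop :=
  Filter.Tendsto
    (fun ε : ℝ =>
      ∫ q in {q : ℝ × ℝ | (ε < |q.1| ∧ |q.1| < Real.pi) ∧ ε < |q.2| ∧ |q.2| < Real.pi}, g q)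
    (nhdsWithin 0 (Set.Ioi 0)) (nhds L)

/-- Luxemburg norm with respect to a Young function `M`. -/
def luxNorm {α : Type*} [MeasurableSpace α] (μ : Measure α) (M : ℝ → ℝ) (g : α → ℝ) : ℝ :=
  sInf {lam : ℝ | 0 < lam ∧ ∫⁻ x, ENNReal.ofReal (M (|g x| / lam)) ∂μ ≤ 1}

/-- The Young function `Φ(t) = t log⁺ t`. -/
def PhiY (t : ℝ) : ℝ := t * logPlus t

/-- The Young function `Ψ(t) = eᵗ - 1`. -/
def PsiY (t : ℝ) : ℝ := Real.exp t - 1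

/-- Bellman function inequality behind the dyadic John-Nirenberg inequality. -/
lemma bell_ineq (V1 V2 d : ℝ) (h1 : 0 ≤ V1) (h2 : 0 ≤ V2)
    (hV : (V1 + V2) / 2 + d ^ 2 ≤ 1 / 16) :
    ((1 + 2 * V1 - V1 ^ 2) * Real.exp d + (1 + 2 * V2 - V2 ^ 2) * Real.exp (-d)) / 2 ≤
      1 + 2 * ((V1 + V2) / 2 + d ^ 2) - ((V1 + V2) / 2 + d ^ 2) ^ 2 := by
  have hd : d ^ 2 ≤ 1 / 16 := by linarith
  have hd' : |d| ≤ 1 / 4 := by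
    apply abs_le_of_sq_le_sq _ (by norm_num)
    linarith
  have hb := abs_le.mp hd'
  have e1 : |Real.exp d - 1 - d - d^2/2| ≤ |d| ^ 3 * (4 / 18) := by
    have := Real.exp_bound (x := d) (by linarith) (n := 3) (by norm_num)
    simp [Finset.sum_range_succ, Nat.factorial] at this
    convert this using 2 <;> ring_nf
  have e2 : |Real.exp (-d) - 1 + d - d^2/2| ≤ |d| ^ 3 * (4 / 18) := by
    have := Real.exp_bound (x := -d) (by rw [abs_neg]; linarith) (n := 3) (by norm_num)
    simp [Finset.sum_range_succ, Nat.factorial] at this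
    convert this using 2 <;> ring_nf
  have hc3 : |d| ^ 3 ≤ d ^ 2 * (1/4) := by
    have : |d| ^ 3 = d ^ 2 * |d| := by rw [pow_succ, sq_abs]
    rw [this]; gcongr
  have hc3' : |d| ^ 3 ≤ |d| * (1/16) := by
    have : |d| ^ 3 = |d| * d ^ 2 := by rw [pow_succ, sq_abs]; ring
    rw [this]; gcongr
  set s := (V1 + V2) / 2 with hs
  set w := (V1 - V2) / 2 with hw
  have hV1 : V1 = s + w := by rw [hs, hw]; ring
  have hV2 : V2 = s - w := by rw [hs, hw]; ring
  set ch := (Real.exp d + Real.exp (-d)) / 2 with hch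
  set sh := (Real.exp d - Real.exp (-d)) / 2 with hsh
  have E1 := abs_le.mp e1
  have E2 := abs_le.mp e2
  have ch1 : ch ≤ 1 + 0.56 * d ^ 2 := by rw [hch]; nlinarith [E1.2, E2.2]
  have ch0 : 1 ≤ ch := by
    have h := Real.one_le_cosh d
    rwa [Real.cosh_eq] at h
  have sh1 : |sh| ≤ 1.05 * |d| := by
    have : sh = d + ((Real.exp d - 1 - d - d^2/2) - (Real.exp (-d) - 1 + d - d^2/2)) / 2 := by
      rw [hsh]; ring
    rw [this]
    calc _ ≤ |d| + |((Real.exp d - 1 - d - d^2/2) - (Real.exp (-d) - 1 + d - d^2/2)) / 2| := abs_add_le _ _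
      _ ≤ |d| + (|d| ^ 3 * (4 / 18) + |d| ^ 3 * (4 / 18)) / 2 := by
        gcongr
        rw [abs_div, abs_two]
        gcongr
        exact (abs_sub _ _).trans (add_le_add e1 e2)
      _ ≤ _ := by nlinarith [abs_nonneg d]
  have hs0 : 0 ≤ s := by rw [hs]; linarith
  have hws : |w| ≤ s := by rw [hw, hs]; apply abs_le.mpr; constructor <;> linarith
  have hs1 : s ≤ 1/16 := by nlinarith
  have key : ((1 + 2 * V1 - V1 ^ 2) * Real.exp d + (1 + 2 * V2 - V2 ^ 2) * Real.exp (-d)) / 2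
      = ch * (1 + 2 * s - s^2 - w^2) + sh * w * (2 - 2 * s) := by
    rw [hV1, hV2, hch, hsh]; ring
  rw [key]
  have hw2 : w ^ 2 ≤ s ^ 2 := by
    rw [← sq_abs w]; gcongr
  have t1 : ch * (1 + 2 * s - s^2 - w^2) ≤ (1 + 0.56 * d ^ 2) * (1 + 2 * s - s^2 - w^2) := by
    apply mul_le_mul_of_nonneg_right ch1; nlinarith
  have t2 : sh * w * (2 - 2 * s) ≤ 1.05 * |d| * |w| * 2 := by
    have : sh * w ≤ 1.05 * |d| * |w| := by
      calc sh * w ≤ |sh * w| := le_abs_self _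
        _ = |sh| * |w| := abs_mul _ _
        _ ≤ _ := by gcongr
    have h0 : (0:ℝ) ≤ 1.05 * |d| * |w| := by positivity
    calc sh * w * (2 - 2 * s) ≤ 1.05 * |d| * |w| * (2 - 2 * s) :=
          mul_le_mul_of_nonneg_right this (by linarith)
      _ ≤ _ := mul_le_mul_of_nonneg_left (by linarith) h0
  have t3 : 1.05 * |d| * |w| * 2 ≤ w ^ 2 + 1.1025 * d ^ 2 := by
    have := sq_nonneg (1.05 * |d| - |w|)
    have h3 := sq_abs d
    have h4 := sq_abs w
    linarith
  have q1 : 0 ≤ d ^ 2 * (0.3375 - 3.12 * s - d ^ 2) := by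
    apply mul_nonneg (sq_nonneg d); linarith
  have q2 : 0 ≤ d ^ 2 * s ^ 2 := by positivity
  have q3 : 0 ≤ d ^ 2 * w ^ 2 := by positivity
  linarith

/-- Dyadic John-Nirenberg inequality. -/
lemma dyadic_JN (φ : ℕ → ℝ) (N : ℕ)
    (h : ∀ j ≤ N, ∀ a : ℕ, (a + 1) * 2 ^ j ≤ 2 ^ N → ∃ α : ℝ,
      ∑ l ∈ Finset.range (2 ^ j), (φ (a * 2 ^ j + l) - α) ^ 2 ≤ 2 ^ j * (1 / 16)) :
    ∑ n ∈ Finset.range (2 ^ N), Real.exp (φ n) ≤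
      2 ^ N * (2 * Real.exp ((∑ n ∈ Finset.range (2 ^ N), φ n) / 2 ^ N)) := by
  let M : ℕ → ℕ → ℝ := fun j a => (∑ l ∈ Finset.range (2 ^ j), φ (a * 2 ^ j + l)) / 2 ^ j
  let X : ℕ → ℕ → ℝ := fun j a => (∑ l ∈ Finset.range (2 ^ j), φ (a * 2 ^ j + l) ^ 2) / 2 ^ j
  let Y : ℕ → ℕ → ℝ := fun j a => (∑ l ∈ Finset.range (2 ^ j), Real.exp (φ (a * 2 ^ j + l))) / 2 ^ j
  have split : ∀ (F : ℕ → ℝ) (j a : ℕ),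
      (∑ l ∈ Finset.range (2 ^ (j+1)), F (a * 2 ^ (j+1) + l)) / 2 ^ (j+1) =
      ((∑ l ∈ Finset.range (2 ^ j), F ((2 * a) * 2 ^ j + l)) / 2 ^ j +
        (∑ l ∈ Finset.range (2 ^ j), F ((2 * a + 1) * 2 ^ j + l)) / 2 ^ j) / 2 := by
    intro F j a
    have h2 : (2:ℕ) ^ (j+1) = 2 ^ j + 2 ^ j := by ring
    rw [h2, Finset.sum_range_add]
    have e1 : ∀ l, F (a * (2 ^ j + 2 ^ j) + l) = F (2 * a * 2 ^ j + l) := by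
      intro l; congr 1; ring
    have e2 : ∀ l, F (a * (2 ^ j + 2 ^ j) + (2 ^ j + l)) = F ((2 * a + 1) * 2 ^ j + l) := by
      intro l; congr 1; ring
    rw [Finset.sum_congr rfl (fun l _ => e1 l), Finset.sum_congr rfl (fun l _ => e2 l)]
    rw [pow_succ]; field_simp
  have var : ∀ j a (α : ℝ), X j a - M j a ^ 2 =
      (∑ l ∈ Finset.range (2 ^ j), (φ (a * 2 ^ j + l) - α) ^ 2) / 2 ^ j - (M j a - α) ^ 2 := by
    intro j a α
    have : ∑ l ∈ Finset.range (2 ^ j), (φ (a * 2 ^ j + l) - α) ^ 2 =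
      ∑ l ∈ Finset.range (2 ^ j), φ (a * 2 ^ j + l) ^ 2 - 2 * α * ∑ l ∈ Finset.range (2 ^ j), φ (a * 2 ^ j + l) + 2 ^ j * α ^ 2 := by
      have : ∀ l, (φ (a * 2 ^ j + l) - α) ^ 2 = φ (a * 2 ^ j + l) ^ 2 - 2 * α * φ (a * 2 ^ j + l) + α ^ 2 := by
        intro l; ring
      simp only [this, Finset.sum_add_distrib, Finset.sum_sub_distrib, ← Finset.mul_sum]
      simp
    rw [this]
    simp only [X, M]
    have : (2:ℝ)^j ≠ 0 := by positivity
    field_simp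
    ring
  have Vnn : ∀ j a, 0 ≤ X j a - M j a ^ 2 := by
    intro j a
    rw [var j a (M j a)]
    simp only [sub_self, ne_eq, OfNat.ofNat_ne_zero, not_false_eq_true, zero_pow, sub_zero]
    positivity
  have main : ∀ j ≤ N, ∀ a : ℕ, (a + 1) * 2 ^ j ≤ 2 ^ N →
      Y j a ≤ (1 + 2 * (X j a - M j a ^ 2) - (X j a - M j a ^ 2) ^ 2) * Real.exp (M j a) := by
    intro j
    induction j with
    | zero => intro _ a _; simp [X, M, Y]
    | succ j ih =>
      intro hj a ha
      have hY : Y (j+1) a = (Y j (2*a) + Y j (2*a+1)) / 2 := split (fun n => Real.exp (φ n)) j a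
      have hX : X (j+1) a = (X j (2*a) + X j (2*a+1)) / 2 := split (fun n => φ n ^ 2) j a
      have hM : M (j+1) a = (M j (2*a) + M j (2*a+1)) / 2 := split φ j a
      have hb1 : (2 * a + 1 + 1) * 2 ^ j ≤ 2 ^ N := by
        calc _ = (a + 1) * 2 ^ (j+1) := by ring
          _ ≤ _ := ha
      have hb0 : (2 * a + 1) * 2 ^ j ≤ 2 ^ N := le_trans (by gcongr; omega) hb1
      have i0 := ih (by omega) (2*a) hb0
      have i1 := ih (by omega) (2*a+1) hb1
      have v0 := Vnn j (2*a)
      have v1 := Vnn j (2*a+1)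
      obtain ⟨α, hα⟩ := h (j+1) hj a ha
      have hv : X (j+1) a - M (j+1) a ^ 2 ≤ 1/16 := by
        rw [var (j+1) a α]
        have : (∑ l ∈ Finset.range (2 ^ (j+1)), (φ (a * 2 ^ (j+1) + l) - α) ^ 2) / 2 ^ (j+1) ≤ 1/16 := by
          rw [div_le_iff₀ (by positivity)]; linarith
        nlinarith [sq_nonneg (M (j+1) a - α)]
      set d := (M j (2*a) - M j (2*a+1)) / 2 with hd
      have hVd : X (j+1) a - M (j+1) a ^ 2 =
        ((X j (2*a) - M j (2*a) ^ 2) + (X j (2*a+1) - M j (2*a+1) ^ 2)) / 2 + d ^ 2 := by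
        rw [hX, hM, hd]; ring
      rw [hVd] at hv ⊢
      have B := bell_ineq _ _ d v0 v1 hv
      rw [hY]
      have ex0 : Real.exp (M j (2*a)) = Real.exp (M (j+1) a) * Real.exp d := by
        rw [← Real.exp_add]; congr 1; rw [hM, hd]; ring
      have ex1 : Real.exp (M j (2*a+1)) = Real.exp (M (j+1) a) * Real.exp (-d) := by
        rw [← Real.exp_add]; congr 1; rw [hM, hd]; ring
      rw [ex0] at i0
      rw [ex1] at i1
      calc _ ≤ _ := div_le_div_of_nonneg_right (add_le_add i0 i1) (by norm_num : (0:ℝ) ≤ 2)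
        _ = _ * Real.exp (M (j+1) a) := by
          rw [show ∀ A B E e f : ℝ, (A * (E * e) + B * (E * f)) / 2 = ((A * e + B * f) / 2) * E from by intros; ring]
        _ ≤ _ := mul_le_mul_of_nonneg_right B (Real.exp_pos _).le
  have fin := main N le_rfl 0 (by simp)
  have hv : X N 0 - M N 0 ^ 2 ≤ 1/16 := by
    obtain ⟨α, hα⟩ := h N le_rfl 0 (by simp)
    rw [var N 0 α]
    have : (∑ l ∈ Finset.range (2 ^ N), (φ (0 * 2 ^ N + l) - α) ^ 2) / 2 ^ N ≤ 1/16 := by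
      rw [div_le_iff₀ (by positivity)]; linarith
    nlinarith [sq_nonneg (M N 0 - α)]
  have h2 : Y N 0 ≤ 2 * Real.exp (M N 0) := by
    refine fin.trans (mul_le_mul_of_nonneg_right ?_ (Real.exp_pos _).le)
    nlinarith [Vnn N 0]
  simp only [Y, M, zero_mul, zero_add] at h2
  rwa [div_le_iff₀ (by positivity), mul_comm] at h2

/-- The Poisson-like kernel `w / (w² + sin²(θ/2))`. -/
def kp (w θ : ℝ) : ℝ := w / (w ^ 2 + Real.sin (θ / 2) ^ 2)

lemma kp_den_pos {w : ℝ} (hw : 0 < w) (θ : ℝ) : 0 < w ^ 2 + Real.sin (θ / 2) ^ 2 := by positivity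

lemma kp_nonneg {w : ℝ} (hw : 0 < w) (θ : ℝ) : 0 ≤ kp w θ := by unfold kp; positivity

lemma kp_continuous {w : ℝ} (hw : 0 < w) : Continuous (kp w) := by
  unfold kp
  apply Continuous.div (by fun_prop) (by fun_prop)
  intro x; exact (kp_den_pos hw x).ne'

lemma sin_half_sub (θ θ' : ℝ) : |Real.sin (θ / 2) - Real.sin (θ' / 2)| ≤ |θ - θ'| / 2 := by
  have h : ∀ a b : ℝ, |Real.sin a - Real.sin b| ≤ |a - b| := by
    intro a b
    rw [Real.sin_sub_sin, abs_mul, abs_mul, abs_two]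
    have h1 := Real.abs_sin_le_abs (x := (a - b) / 2)
    have h2 := Real.abs_cos_le_one ((a + b) / 2)
    rw [abs_div, abs_two] at h1
    nlinarith [abs_nonneg (Real.sin ((a - b) / 2)), abs_nonneg (a - b)]
  calc _ ≤ |θ / 2 - θ' / 2| := h _ _
    _ = _ := by rw [← sub_div, abs_div, abs_two]

lemma kp_pert {w θ θ' : ℝ} (h : |θ - θ'| ≤ 2 * w) :
    w ^ 2 + Real.sin (θ' / 2) ^ 2 ≤ 3 * (w ^ 2 + Real.sin (θ / 2) ^ 2) := by
  have h1 := sin_half_sub θ θ'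
  have h2 : |Real.sin (θ / 2) - Real.sin (θ' / 2)| ≤ w := by linarith
  set a := Real.sin (θ / 2)
  set b := Real.sin (θ' / 2)
  have h3 : (a - b) ^ 2 ≤ w ^ 2 := by
    rw [← sq_abs (a - b)]; gcongr
  nlinarith [sq_nonneg (2 * a - b), sq_nonneg (a + (a - b))]

lemma kp_periodic (w : ℝ) : Function.Periodic (kp w) (2 * Real.pi) := by
  intro θ
  unfold kp
  rw [show (θ + 2 * Real.pi) / 2 = θ / 2 + Real.pi by ring, Real.sin_add_pi, neg_sq]

lemma kp_neg (w θ : ℝ) : kp w (-θ) = kp w θ := by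
  unfold kp; rw [neg_div, Real.sin_neg, neg_sq]

lemma setT1_eq (F : ℝ → ℝ) : ∫ x in T1, F x = ∫ x in (-Real.pi)..Real.pi, F x := by
  rw [T1, intervalIntegral.integral_of_le (by linarith [Real.pi_pos]), integral_Ico_eq_integral_Ioc]

lemma kp_int0 {w : ℝ} (hw : 0 < w) : ∫ x in (-Real.pi)..Real.pi, kp w x ≤ 10 := by
  have hpi := Real.pi_pos
  have hle : ∀ x ∈ Icc (-Real.pi) Real.pi, kp w x ≤ w⁻¹ * (1 + ((Real.pi * w)⁻¹ * x) ^ 2)⁻¹ := by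
    intro x hx
    have hs : (x / Real.pi) ^ 2 ≤ Real.sin (x / 2) ^ 2 := by
      rw [← sq_abs (x / Real.pi), ← sq_abs (Real.sin (x/2))]
      have h := Real.mul_abs_le_abs_sin (x := x / 2)
        (by rw [abs_div, abs_two]; have := abs_le.mpr hx; linarith)
      have : 2 / Real.pi * |x / 2| = |x / Real.pi| := by
        rw [abs_div, abs_div, abs_two, abs_of_pos hpi]; field_simp
      rw [this] at h
      gcongr
    unfold kp
    have : w⁻¹ * (1 + ((Real.pi * w)⁻¹ * x) ^ 2)⁻¹ = w / (w ^ 2 + (x / Real.pi) ^ 2) := by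
      have : 0 < w ^ 2 + (x / Real.pi) ^ 2 := by positivity
      field_simp
    rw [this]
    gcongr
  have hi : Integrable (fun x : ℝ => w⁻¹ * (1 + ((Real.pi * w)⁻¹ * x) ^ 2)⁻¹) := by
    apply Integrable.const_mul
    exact integrable_inv_one_add_sq.comp_mul_left' (by positivity)
  have hle2 : -Real.pi ≤ Real.pi := by linarith
  calc ∫ x in (-Real.pi)..Real.pi, kp w x
      ≤ ∫ x in (-Real.pi)..Real.pi, w⁻¹ * (1 + ((Real.pi * w)⁻¹ * x) ^ 2)⁻¹ := by
        apply intervalIntegral.integral_mono_on hle2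
          ((kp_continuous hw).intervalIntegrable _ _) hi.intervalIntegrable hle
    _ ≤ ∫ x, w⁻¹ * (1 + ((Real.pi * w)⁻¹ * x) ^ 2)⁻¹ := by
        rw [intervalIntegral.integral_of_le hle2]
        apply setIntegral_le_integral hi
        filter_upwards with x
        positivity
    _ = Real.pi ^ 2 := by
        rw [integral_const_mul,
          Measure.integral_comp_mul_left (fun y : ℝ => (1 + y ^ 2)⁻¹) ((Real.pi * w)⁻¹), integral_univ_inv_one_add_sq]
        rw [inv_inv, abs_of_pos (by positivity), smul_eq_mul]
        field_simp
    _ ≤ 10 := by nlinarith [Real.pi_lt_d2, Real.pi_pos]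

lemma kp_int {w : ℝ} (hw : 0 < w) (c : ℝ) : ∫ x in T1, kp w (x - c) ≤ 10 := by
  rw [setT1_eq, intervalIntegral.integral_comp_sub_right (fun x => kp w x) c]
  have h := (kp_periodic w).intervalIntegral_add_eq (-Real.pi - c) (-Real.pi)
  have e1 : -Real.pi - c + 2 * Real.pi = Real.pi - c := by ring
  have e2 : -Real.pi + 2 * Real.pi = Real.pi := by ring
  rw [e1, e2] at h
  rw [h]; exact kp_int0 hw

lemma kp_int' {w : ℝ} (hw : 0 < w) (c : ℝ) : ∫ x in T1, kp w (c - x) ≤ 10 := by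
  have : ∀ x, kp w (c - x) = kp w (x - c) := by intro x; rw [← kp_neg, neg_sub]
  simp only [this]; exact kp_int hw c

/-- `k`-th cell of length `w`. -/
def cell (w : ℝ) (k : ℕ) : Set ℝ := Ico (-Real.pi + k * w) (-Real.pi + (k + 1) * w)

/-- centre of the `k`-th cell. -/
def cen (w : ℝ) (k : ℕ) : ℝ := -Real.pi + (k + 1 / 2) * w

lemma cell_cen {w u : ℝ} {k : ℕ} (hw : 0 < w) (hu : u ∈ cell w k) : |u - cen w k| ≤ w := by
  obtain ⟨h1, h2⟩ := hu
  unfold cen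
  rw [abs_le]; constructor <;> nlinarith

lemma cell_meas (w : ℝ) (k : ℕ) : MeasurableSet (cell w k) := measurableSet_Ico

lemma cell_subset {w : ℝ} {N k : ℕ} (hw : 0 < w) (hN : N * w = 2 * Real.pi) (hk : k < N) :
    cell w k ⊆ T1 := by
  intro u hu
  obtain ⟨h1, h2⟩ := hu
  have : ((k:ℝ) + 1) ≤ N := by exact_mod_cast hk
  constructor
  · nlinarith [(Nat.cast_nonneg k : (0:ℝ) ≤ k)]
  · nlinarith

lemma cell_sum_aux {E : Type*} [NormedAddCommGroup E] [NormedSpace ℝ E] {w : ℝ} (hw : 0 < w)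
    (F : ℝ → E) (N : ℕ)
    (hF : IntegrableOn F (Ico (-Real.pi) (-Real.pi + N * w))) :
    ∫ u in Ico (-Real.pi) (-Real.pi + N * w), F u = ∑ k ∈ Finset.range N, ∫ u in cell w k, F u := by
  induction N with
  | zero => simp
  | succ N ih =>
    have e : Ico (-Real.pi) (-Real.pi + (N+1:ℕ) * w) = Ico (-Real.pi) (-Real.pi + N * w) ∪ cell w N := by
      unfold cell
      rw [Ico_union_Ico_eq_Ico]
      · push_cast; rfl
      · nlinarith [(Nat.cast_nonneg N : (0:ℝ) ≤ N)]
      · linarith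
    rw [e] at hF ⊢
    rw [setIntegral_union _ (cell_meas _ _) hF.left_of_union hF.right_of_union, ih hF.left_of_union,
      Finset.sum_range_succ]
    rw [Set.disjoint_left]
    intro u hu hu'
    exact absurd hu.2 (not_lt.mpr hu'.1)

lemma cell_sum {E : Type*} [NormedAddCommGroup E] [NormedSpace ℝ E] {w : ℝ} (hw : 0 < w)
    (F : ℝ → E) (N : ℕ) (hN : N * w = 2 * Real.pi)
    (hF : IntegrableOn F T1) :
    ∫ u in T1, F u = ∑ k ∈ Finset.range N, ∫ u in cell w k, F u := by
  have e : T1 = Ico (-Real.pi) (-Real.pi + N * w) := by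
    rw [hN, T1]; congr 1; ring
  rw [e] at hF ⊢
  exact cell_sum_aux hw F N hF

lemma cell_vol {w : ℝ} (hw : 0 < w) (k : ℕ) : volume.real (cell w k) = w := by
  unfold cell
  rw [Real.volume_real_Ico_of_le (by nlinarith)]; ring

lemma continuous_integrableOn_T1 {E : Type*} [NormedAddCommGroup E] {F : ℝ → E}
    (hF : Continuous F) : IntegrableOn F T1 :=
  (hF.integrableOn_Icc (a := -Real.pi) (b := Real.pi)).mono_set Ico_subset_Icc_self

lemma kp_sum {w : ℝ} (hw : 0 < w) (N : ℕ) (hN : N * w = 2 * Real.pi) (x : ℝ) :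
    ∑ k ∈ Finset.range N, w ^ 2 / (w ^ 2 + Real.sin ((x - cen w k) / 2) ^ 2) ≤ 30 := by
  have hint : IntegrableOn (fun u => kp w (x - u)) T1 :=
    continuous_integrableOn_T1 ((kp_continuous hw).comp (by fun_prop))
  have h1 : ∀ k ∈ Finset.range N, w ^ 2 / (w ^ 2 + Real.sin ((x - cen w k) / 2) ^ 2)
      ≤ 3 * ∫ u in cell w k, kp w (x - u) := by
    intro k hk
    have hk := Finset.mem_range.mp hk
    have : ∫ u in cell w k, (w / (w ^ 2 + Real.sin ((x - cen w k) / 2) ^ 2) / 3) ≤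
        ∫ u in cell w k, kp w (x - u) := by
      apply setIntegral_mono_on _ (hint.mono_set (cell_subset hw hN hk)) (cell_meas _ _)
      · intro u hu
        have hc := cell_cen hw hu
        unfold kp
        rw [div_div]
        apply div_le_div_of_nonneg_left hw.le (kp_den_pos hw _)
        rw [mul_comm]
        apply kp_pert
        rw [show x - cen w k - (x - u) = u - cen w k by ring]; linarith
      · apply (integrableOn_const_iff (by simp)).mpr
        right; unfold cell; simp
    rw [setIntegral_const, cell_vol hw, smul_eq_mul] at this
    calc _ = 3 * (w * (w / (w ^ 2 + Real.sin ((x - cen w k) / 2) ^ 2) / 3)) := by ring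
      _ ≤ _ := by gcongr
  calc _ ≤ ∑ k ∈ Finset.range N, 3 * ∫ u in cell w k, kp w (x - u) := Finset.sum_le_sum h1
    _ = 3 * ∫ u in T1, kp w (x - u) := by rw [← Finset.mul_sum, ← cell_sum hw _ N hN hint]
    _ ≤ 3 * 10 := by gcongr; exact kp_int' hw x
    _ = 30 := by norm_num

/-- half open interval attached to a pair (left end, length). -/
def iv (q : ℝ × ℝ) : Set ℝ := Ico q.1 (q.1 + q.2)

/-- A Calderon-Zygmund family for `v` at height `lam` in `[a, a+w)`, down to depth `J`. -/
structure CZ (v : ℝ → ℝ) (lam : ℝ) (J : ℕ) (a w : ℝ) (Q : Finset (ℝ × ℝ)) : Prop where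
  pos : ∀ q ∈ Q, 0 < q.2
  sub : ∀ q ∈ Q, iv q ⊆ iv (a, w)
  disj : ∀ q ∈ Q, ∀ q' ∈ Q, q ≠ q' → Disjoint (iv q) (iv q')
  lower : ∀ q ∈ Q, lam * q.2 ≤ ∫ u in iv q, v u
  upper : ∀ q ∈ Q, ∫ u in iv q, v u ≤ 2 * lam * q.2
  off : ∀ u ∈ iv (a, w), (∀ q ∈ Q, u ∉ iv q) → v u ≤ 2 * lam
  sub_cell : ∀ i ≤ J, ∀ k : ℕ, k < 2 ^ i →
    (∫ u in iv (a + k * (w / 2 ^ i), w / 2 ^ i), v u ≤ lam * (w / 2 ^ i)) ∨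
    ∃ q ∈ Q, iv (a + k * (w / 2 ^ i), w / 2 ^ i) ⊆ iv q

lemma iv_half (a w : ℝ) (hw : 0 < w) : iv (a, w) = iv (a, w/2) ∪ iv (a + w/2, w/2) := by
  unfold iv
  simp only
  rw [Ico_union_Ico_eq_Ico (by linarith) (by linarith)]
  congr 1; ring

lemma iv_half_disj (a w : ℝ) : Disjoint (iv (a, w/2)) (iv (a + w/2, w/2)) := by
  rw [Set.disjoint_left]
  intro u hu hu'
  exact absurd hu.2 (not_lt.mpr hu'.1)

lemma iv_int {v : ℝ → ℝ} (hv : Continuous v) (q : ℝ × ℝ) : IntegrableOn v (iv q) :=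
  (hv.integrableOn_Icc).mono_set Ico_subset_Icc_self

lemma CZ_single {v : ℝ → ℝ} {lam : ℝ} (hlam : 0 < lam) (J : ℕ) (a w : ℝ) (hw : 0 < w)
    (h1 : lam * w ≤ ∫ u in iv (a, w), v u) (h2 : ∫ u in iv (a, w), v u ≤ 2 * lam * w) :
    CZ v lam J a w {(a, w)} := by
  refine ⟨?_, ?_, ?_, ?_, ?_, ?_, ?_⟩
  · intro q hq; rw [Finset.mem_singleton] at hq; rw [hq]; exact hw
  · intro q hq; rw [Finset.mem_singleton] at hq; rw [hq]
  · intro q hq q' hq' hne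
    rw [Finset.mem_singleton] at hq hq'; exact absurd (hq.trans hq'.symm) hne
  · intro q hq; rw [Finset.mem_singleton] at hq; rw [hq]; exact h1
  · intro q hq; rw [Finset.mem_singleton] at hq; rw [hq]; exact h2
  · intro u hu h; exact absurd hu (h _ (Finset.mem_singleton_self _))
  · intro i _ k hk
    right
    refine ⟨_, Finset.mem_singleton_self _, ?_⟩
    unfold iv
    simp only
    have hk' : ((k:ℝ) + 1) ≤ 2 ^ i := by exact_mod_cast hk
    have hp : (0:ℝ) < w / 2 ^ i := by positivity
    have h3 : (2:ℝ) ^ i * (w / 2 ^ i) = w := by field_simp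
    apply Ico_subset_Ico
    · have : 0 ≤ (k:ℝ) * (w / 2 ^ i) := by positivity
      linarith
    · nlinarith

lemma CZ_merge {v : ℝ → ℝ} {lam : ℝ} (J : ℕ) (a w : ℝ) (hw : 0 < w)
    (hm : ∫ u in iv (a, w), v u ≤ lam * w) (Q1 Q2 : Finset (ℝ × ℝ))
    (h1 : CZ v lam J a (w/2) Q1) (h2 : CZ v lam J (a + w/2) (w/2) Q2) :
    CZ v lam (J+1) a w (Q1 ∪ Q2) := by
  refine ⟨?_, ?_, ?_, ?_, ?_, ?_, ?_⟩
  · intro q hq; rcases Finset.mem_union.mp hq with h | h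
    · exact h1.pos q h
    · exact h2.pos q h
  · intro q hq; rw [iv_half a w hw]; rcases Finset.mem_union.mp hq with h | h
    · exact (h1.sub q h).trans subset_union_left
    · exact (h2.sub q h).trans subset_union_right
  · intro q hq q' hq' hne
    rcases Finset.mem_union.mp hq with h | h <;> rcases Finset.mem_union.mp hq' with h' | h'
    · exact h1.disj q h q' h' hne
    · exact (iv_half_disj a w).mono (h1.sub q h) (h2.sub q' h')
    · exact ((iv_half_disj a w).mono (h1.sub q' h') (h2.sub q h)).symm
    · exact h2.disj q h q' h' hne
  · intro q hq; rcases Finset.mem_union.mp hq with h | h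
    · exact h1.lower q h
    · exact h2.lower q h
  · intro q hq; rcases Finset.mem_union.mp hq with h | h
    · exact h1.upper q h
    · exact h2.upper q h
  · intro u hu h
    rw [iv_half a w hw] at hu
    rcases hu with hu | hu
    · exact h1.off u hu (fun q hq => h q (Finset.mem_union_left _ hq))
    · exact h2.off u hu (fun q hq => h q (Finset.mem_union_right _ hq))
  · intro i hi k hk
    rcases i with _ | i
    · left
      have : k = 0 := by simpa using hk
      subst this
      simpa using hm
    · have hw2 : w / 2 ^ (i+1) = w / 2 / 2 ^ i := by rw [pow_succ]; field_simp
      rw [hw2]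
      by_cases hk2 : k < 2 ^ i
      · rcases h1.sub_cell i (by omega) k hk2 with h | ⟨q, hq, h⟩
        · left; exact h
        · right; exact ⟨q, Finset.mem_union_left _ hq, h⟩
      · push Not at hk2
        obtain ⟨k', rfl⟩ := Nat.exists_eq_add_of_le hk2
        have hk3 : k' < 2 ^ i := by rw [pow_succ] at hk; omega
        have e : a + ((2 ^ i + k' : ℕ) : ℝ) * (w / 2 / 2 ^ i) = a + w / 2 + (k':ℝ) * (w / 2 / 2 ^ i) := by
          push_cast; field_simp; ring
        rw [e]
        rcases h2.sub_cell i (by omega) k' hk3 with h | ⟨q, hq, h⟩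
        · left; exact h
        · right; exact ⟨q, Finset.mem_union_right _ hq, h⟩

lemma CZ_exists {v : ℝ → ℝ} (hv : Continuous v) (hv0 : ∀ u, 0 ≤ v u) {lam : ℝ} (hlam : 0 < lam) (J : ℕ) :
    ∀ (a w : ℝ) (_ : 0 < w) (_ : ∫ u in iv (a, w), v u ≤ lam * w)
    (_ : ∀ u ∈ iv (a, w), ∀ u' ∈ iv (a, w), |u - u'| ≤ w / 2 ^ J → v u ≤ v u' + lam),
    ∃ Q, CZ v lam J a w Q := by
  induction J with
  | zero =>
    intro a w hw hm hosc
    refine ⟨∅, ⟨by simp, by simp, by simp, by simp, by simp, ?_, ?_⟩⟩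
    · intro u hu _
      by_contra hcon
      push Not at hcon
      have h2 : ∀ u' ∈ iv (a, w), v u - lam ≤ v u' := by
        intro u' hu'
        have := hosc u hu u' hu' (by
          obtain ⟨p1, p2⟩ := hu; obtain ⟨p3, p4⟩ := hu'
          simp only at p1 p2 p3 p4
          rw [pow_zero, div_one, abs_le]; constructor <;> linarith)
        linarith
      have h3 : ∫ u' in iv (a, w), (v u - lam) ≤ ∫ u' in iv (a, w), v u' := by
        apply setIntegral_mono_on _ (iv_int hv _) measurableSet_Ico h2
        apply (integrableOn_const_iff (by simp)).mpr
        right; unfold iv; simp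
      rw [setIntegral_const] at h3
      have h4 : volume.real (iv (a, w)) = w := by
        unfold iv; rw [Real.volume_real_Ico_of_le (by simp only; linarith)]; simp
      rw [h4, smul_eq_mul] at h3
      nlinarith
    · intro i hi k hk
      left
      have : i = 0 := by omega
      subst this
      have : k = 0 := by simpa using hk
      subst this
      simpa using hm
  | succ J ih =>
    intro a w hw hm hosc
    have hw2 : w / 2 ^ (J+1) = w / 2 / 2 ^ J := by rw [pow_succ]; field_simp
    rw [hw2] at hosc
    have hsplit : ∫ u in iv (a, w), v u = (∫ u in iv (a, w/2), v u) + ∫ u in iv (a + w/2, w/2), v u := by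
      rw [iv_half a w hw, setIntegral_union (iv_half_disj a w) measurableSet_Ico (iv_int hv _) (iv_int hv _)]
    have n1 : 0 ≤ ∫ u in iv (a, w/2), v u := integral_nonneg hv0
    have n2 : 0 ≤ ∫ u in iv (a + w/2, w/2), v u := integral_nonneg hv0
    have c1 : ∃ Q, CZ v lam J a (w/2) Q := by
      by_cases h : ∫ u in iv (a, w/2), v u ≤ lam * (w/2)
      · refine ih a (w/2) (by linarith) h ?_
        intro u hu u' hu'
        exact hosc u (by rw [iv_half a w hw]; exact Or.inl hu) u' (by rw [iv_half a w hw]; exact Or.inl hu')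
      · push Not at h
        exact ⟨_, CZ_single hlam J a (w/2) (by linarith) h.le (by linarith)⟩
    have c2 : ∃ Q, CZ v lam J (a + w/2) (w/2) Q := by
      by_cases h : ∫ u in iv (a + w/2, w/2), v u ≤ lam * (w/2)
      · refine ih (a + w/2) (w/2) (by linarith) h ?_
        intro u hu u' hu'
        exact hosc u (by rw [iv_half a w hw]; exact Or.inr hu) u' (by rw [iv_half a w hw]; exact Or.inr hu')
      · push Not at h
        exact ⟨_, CZ_single hlam J (a + w/2) (w/2) (by linarith) h.le (by linarith)⟩
    obtain ⟨Q1, h1⟩ := c1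
    obtain ⟨Q2, h2⟩ := c2
    exact ⟨_, CZ_merge J a w hw hm Q1 Q2 h1 h2⟩

/-- the CZ family on the circle. -/
lemma CZ_circle {v : ℝ → ℝ} (hv : Continuous v) (hv0 : ∀ u, 0 ≤ v u) {lam : ℝ} (hlam : 0 < lam) (J0 : ℕ)
    (hm : ∫ u in T1, v u ≤ lam * (2 * Real.pi)) :
    ∃ Q J, J0 ≤ J ∧ CZ v lam J (-Real.pi) (2 * Real.pi) Q := by
  have hpi := Real.pi_pos
  have huc : UniformContinuousOn v (Icc (-Real.pi) Real.pi) :=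
    isCompact_Icc.uniformContinuousOn_of_continuous hv.continuousOn
  rw [Metric.uniformContinuousOn_iff] at huc
  obtain ⟨δ, hδ, hu⟩ := huc lam hlam
  obtain ⟨n, hn⟩ := exists_nat_gt (2 * Real.pi / δ)
  have hT : iv (-Real.pi, 2 * Real.pi) = T1 := by unfold iv T1; congr 1; simp only; ring
  obtain ⟨Q, hQ⟩ := CZ_exists hv hv0 hlam (max J0 n) (-Real.pi) (2 * Real.pi) (by linarith)
    (by rw [hT]; exact hm) (by
      intro u h u' h' hd
      rw [hT] at h h'
      have h3 : 2 * Real.pi / 2 ^ (max J0 n) < δ := by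
        rw [div_lt_iff₀ (by positivity)]
        rw [div_lt_iff₀ hδ] at hn
        have : (n:ℝ) < 2 ^ n := by exact_mod_cast Nat.lt_two_pow_self
        have : (2:ℝ) ^ n ≤ 2 ^ (max J0 n) := pow_le_pow_right₀ (by norm_num) (le_max_right _ _)
        nlinarith
      have := hu u (Ico_subset_Icc_self h) u' (Ico_subset_Icc_self h') (by rw [Real.dist_eq]; linarith)
      rw [Real.dist_eq] at this
      linarith [(abs_lt.mp this).2])
  exact ⟨Q, _, le_max_left _ _, hQ⟩

def cq (q : ℝ × ℝ) : ℝ := q.1 + q.2 / 2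

def eQ (q : ℝ × ℝ) (x : ℝ) : ℝ := q.2 ^ 2 / (q.2 ^ 2 + Real.sin ((x - cq q) / 2) ^ 2)

def EQ (Q : Finset (ℝ × ℝ)) (x : ℝ) : ℝ := ∑ q ∈ Q, eQ q x

lemma eQ_nonneg (q : ℝ × ℝ) (x : ℝ) : 0 ≤ eQ q x := by unfold eQ; positivity

lemma eQ_eq {q : ℝ × ℝ} (x : ℝ) : eQ q x = q.2 * kp q.2 (x - cq q) := by
  unfold eQ kp; ring

lemma eQ_continuous {q : ℝ × ℝ} (hq : 0 < q.2) : Continuous (eQ q) := by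
  have : eQ q = fun x => q.2 * kp q.2 (x - cq q) := by funext x; exact eQ_eq x
  rw [this]
  exact continuous_const.mul ((kp_continuous hq).comp (by fun_prop))

lemma T1_iv : iv (-Real.pi, 2 * Real.pi) = T1 := by unfold iv T1; congr 1; simp only; ring

lemma iv_meas (q : ℝ × ℝ) : MeasurableSet (iv q) := measurableSet_Ico

lemma T1_meas : MeasurableSet T1 := measurableSet_Ico

lemma T1_vol_lt : volume T1 < ⊤ := by unfold T1; simp

lemma CZ_split {v : ℝ → ℝ} {lam : ℝ} {J : ℕ} {Q : Finset (ℝ × ℝ)}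
    (h : CZ v lam J (-Real.pi) (2 * Real.pi) Q) {E : Type*} [NormedAddCommGroup E] [NormedSpace ℝ E]
    {F : ℝ → E} (hF : IntegrableOn F T1) :
    ∫ u in T1, F u = (∑ q ∈ Q, ∫ u in iv q, F u) + ∫ u in T1 \ ⋃ q ∈ Q, iv q, F u := by
  have hsub : (⋃ q ∈ Q, iv q) ⊆ T1 := by
    apply iUnion₂_subset; intro q hq; rw [← T1_iv]; exact h.sub q hq
  have hm : MeasurableSet (⋃ q ∈ Q, iv q) := Finset.measurableSet_biUnion _ (fun q _ => iv_meas q)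
  rw [← integral_biUnion_finset Q (fun q _ => iv_meas q)
    (fun q hq q' hq' hne => h.disj q hq q' hq' hne)
    (fun q hq => hF.mono_set ((subset_biUnion_of_mem (u := fun q => iv q) hq).trans hsub)),
    ← setIntegral_union disjoint_sdiff_self_right (T1_meas.diff hm) (hF.mono_set hsub)
      (hF.mono_set sdiff_subset), union_sdiff_cancel hsub]

lemma CZ_sum_len {v : ℝ → ℝ} (hv : Continuous v) (hv0 : ∀ u, 0 ≤ v u) {lam : ℝ} {J : ℕ} {Q : Finset (ℝ × ℝ)}
    (h : CZ v lam J (-Real.pi) (2 * Real.pi) Q) :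
    lam * ∑ q ∈ Q, q.2 ≤ ∫ u in T1, v u := by
  rw [CZ_split h (continuous_integrableOn_T1 hv), Finset.mul_sum]
  have : 0 ≤ ∫ u in T1 \ ⋃ q ∈ Q, iv q, v u := integral_nonneg hv0
  have := Finset.sum_le_sum (fun q hq => h.lower q hq)
  linarith

lemma EQ_meas {v : ℝ → ℝ} (hv : Continuous v) (hv0 : ∀ u, 0 ≤ v u) {lam : ℝ} (hlam : 0 < lam) {J : ℕ}
    {Q : Finset (ℝ × ℝ)} (h : CZ v lam J (-Real.pi) (2 * Real.pi) Q) :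
    volume {x | x ∈ T1 ∧ 1 / 2 < EQ Q x} ≤ ENNReal.ofReal (20 * (∫ u in T1, v u) / lam) := by
  have hE0 : ∀ x, 0 ≤ EQ Q x := fun x => Finset.sum_nonneg (fun q _ => eQ_nonneg q x)
  have hEc : Continuous (EQ Q) := by
    unfold EQ; exact continuous_finsetSum _ (fun q hq => eQ_continuous (h.pos q hq))
  have hEi : ∫ x in T1, EQ Q x ≤ 10 * ∑ q ∈ Q, q.2 := by
    unfold EQ
    rw [integral_finsetSum _ (fun q hq => continuous_integrableOn_T1 (eQ_continuous (h.pos q hq))),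
      Finset.mul_sum]
    apply Finset.sum_le_sum
    intro q hq
    simp only [eQ_eq]
    rw [integral_const_mul]
    have := kp_int (h.pos q hq) (cq q)
    have := h.pos q hq
    nlinarith
  have hmk := mul_meas_ge_le_integral_of_nonneg (μ := volume.restrict T1) (f := EQ Q)
    (Eventually.of_forall hE0) (continuous_integrableOn_T1 hEc) (1/2)
  have hlen := CZ_sum_len hv hv0 h
  have hset : {x | x ∈ T1 ∧ 1 / 2 < EQ Q x} ⊆ {x | 1/2 ≤ EQ Q x} ∩ T1 := by
    rintro x ⟨h1, h2⟩; exact ⟨h2.le, h1⟩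
  have hfin : volume ({x | 1/2 ≤ EQ Q x} ∩ T1) < ⊤ :=
    (measure_mono inter_subset_right).trans_lt T1_vol_lt
  refine (measure_mono hset).trans ?_
  rw [measureReal_restrict_apply (measurableSet_le measurable_const hEc.measurable)] at hmk
  rw [← ENNReal.ofReal_toReal hfin.ne]
  apply ENNReal.ofReal_le_ofReal
  rw [le_div_iff₀ hlam]
  unfold Measure.real at hmk
  have h20 : (volume ({x | 1/2 ≤ EQ Q x} ∩ T1)).toReal ≤ 20 * ∑ q ∈ Q, q.2 := by linarith
  nlinarith

section point
variable {q : ℝ × ℝ} {x : ℝ}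

lemma eQ_half (hq : 0 < q.2) (he : eQ q x ≤ 1 / 2) : q.2 ≤ |Real.sin ((x - cq q) / 2)| := by
  unfold eQ at he
  rw [div_le_iff₀ (kp_den_pos hq _)] at he
  apply abs_le_of_sq_le_sq' _ (abs_nonneg _) |>.2
  rw [sq_abs]; linarith

lemma iv_cq {u : ℝ} (hu : u ∈ iv q) : |u - cq q| ≤ q.2 / 2 := by
  obtain ⟨h1, h2⟩ := hu
  unfold cq; rw [abs_le]; constructor <;> linarith

lemma s_near (hq : 0 < q.2) (he : eQ q x ≤ 1 / 2) {u : ℝ} (hu : u ∈ iv q) :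
    3 / 4 * |Real.sin ((x - cq q) / 2)| ≤ |Real.sin ((x - u) / 2)| ∧
    |Real.sin ((x - u) / 2)| ≤ 5 / 4 * |Real.sin ((x - cq q) / 2)| := by
  have h1 := eQ_half hq he
  have h2 := iv_cq hu
  have h3 := sin_half_sub (x - u) (x - cq q)
  have h4 : |x - u - (x - cq q)| = |u - cq q| := by rw [← abs_neg]; congr 1; ring
  rw [h4] at h3
  have h5 := abs_sub_abs_le_abs_sub (Real.sin ((x - u) / 2)) (Real.sin ((x - cq q) / 2))
  have h6 := abs_sub_abs_le_abs_sub (Real.sin ((x - cq q) / 2)) (Real.sin ((x - u) / 2))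
  rw [abs_sub_comm] at h6
  constructor <;> linarith

lemma s_lower (hq : 0 < q.2) (he : eQ q x ≤ 1 / 2) {u : ℝ} (hu : u ∈ iv q) :
    q.2 ^ 2 + Real.sin ((x - cq q) / 2) ^ 2 ≤ 4 * Real.sin ((x - u) / 2) ^ 2 := by
  have h1 := eQ_half hq he
  have h2 := (s_near hq he hu).1
  rw [← sq_abs (Real.sin ((x - cq q) / 2)), ← sq_abs (Real.sin ((x - u) / 2))]
  nlinarith [abs_nonneg (Real.sin ((x - cq q) / 2))]

lemma s_comp (hq : 0 < q.2) (he : eQ q x ≤ 1 / 2) {u u' : ℝ} (hu : u ∈ iv q) (hu' : u' ∈ iv q) :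
    Real.sin ((x - u) / 2) ^ 2 ≤ 3 * Real.sin ((x - u') / 2) ^ 2 := by
  have h1 := (s_near hq he hu).2
  have h2 := (s_near hq he hu').1
  rw [← sq_abs (Real.sin ((x - u) / 2)), ← sq_abs (Real.sin ((x - u') / 2))]
  nlinarith [abs_nonneg (Real.sin ((x - cq q) / 2)), abs_nonneg (Real.sin ((x - u) / 2))]

end point

lemma CZ_dom {v : ℝ → ℝ} (hv : Continuous v) (hv0 : ∀ u, 0 ≤ v u) {lam : ℝ} (hlam : 0 < lam) {J : ℕ}
    {Q : Finset (ℝ × ℝ)} (h : CZ v lam J (-Real.pi) (2 * Real.pi) Q)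
    {k : ℝ → ℝ} (hk : Continuous k) (hk0 : ∀ u, 0 ≤ k u)
    (hc : ∀ q ∈ Q, ∀ u ∈ iv q, ∀ u' ∈ iv q, k u ≤ 3 * k u') :
    ∫ u in T1, v u * k u ≤ 6 * lam * ∫ u in T1, k u := by
  rw [CZ_split h (F := fun u => v u * k u) (continuous_integrableOn_T1 (hv.mul hk)), CZ_split h (continuous_integrableOn_T1 hk),
    mul_add, Finset.mul_sum]
  apply add_le_add
  · apply Finset.sum_le_sum
    intro q hq
    have h1 : ∀ u' ∈ iv q, ∫ u in iv q, v u * k u ≤ 6 * lam * q.2 * k u' := by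
      intro u' hu'
      have : ∫ u in iv q, v u * k u ≤ ∫ u in iv q, v u * (3 * k u') := by
        apply setIntegral_mono_on (iv_int (hv.mul hk) q) ((iv_int hv q).mul_const _) (iv_meas q)
        intro u hu
        exact mul_le_mul_of_nonneg_left (hc q hq u hu u' hu') (hv0 u)
      rw [integral_mul_const] at this
      have h2 := h.upper q hq
      have h3 := hk0 u'
      nlinarith
    have h2 : ∫ u' in iv q, (∫ u in iv q, v u * k u) ≤ ∫ u' in iv q, 6 * lam * q.2 * k u' := by
      apply setIntegral_mono_on _ ((iv_int hk q).const_mul _) (iv_meas q) h1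
      apply (integrableOn_const_iff (by simp)).mpr
      right; unfold iv; simp
    rw [setIntegral_const, integral_const_mul] at h2
    have hp := h.pos q hq
    have h4 : volume.real (iv q) = q.2 := by
      unfold iv; rw [Real.volume_real_Ico_of_le (by linarith)]; simp
    rw [h4, smul_eq_mul] at h2
    nlinarith
  · rw [← integral_const_mul]
    have hm : MeasurableSet (T1 \ ⋃ q ∈ Q, iv q) :=
      T1_meas.diff (Finset.measurableSet_biUnion _ (fun q _ => iv_meas q))
    apply setIntegral_mono_on ((continuous_integrableOn_T1 (hv.mul hk)).mono_set sdiff_subset)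
      (((continuous_integrableOn_T1 hk).mono_set sdiff_subset).const_mul _) hm
    rintro u ⟨hu1, hu2⟩
    have := h.off u (by rw [T1_iv]; exact hu1) (fun q hq hq' => hu2 (mem_biUnion hq hq'))
    have := hk0 u
    change v u * k u ≤ 6 * lam * k u
    nlinarith

lemma CZ_kp {v : ℝ → ℝ} (hv : Continuous v) (hv0 : ∀ u, 0 ≤ v u) {lam : ℝ} (hlam : 0 < lam) {J : ℕ}
    {Q : Finset (ℝ × ℝ)} (h : CZ v lam J (-Real.pi) (2 * Real.pi) Q) {x : ℝ} (hx : EQ Q x ≤ 1 / 2)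
    {w : ℝ} (hw : 0 < w) :
    ∫ u in T1, v u * kp w (x - u) ≤ 60 * lam := by
  have h1 := CZ_dom hv hv0 hlam h (k := fun u => kp w (x - u))
    ((kp_continuous hw).comp (by fun_prop)) (fun u => kp_nonneg hw _) (by
      intro q hq u hu u' hu'
      have he : eQ q x ≤ 1 / 2 :=
        (Finset.single_le_sum (fun q _ => eQ_nonneg q x) hq).trans hx
      have := s_comp (h.pos q hq) he hu' hu
      unfold kp
      rw [← mul_div_assoc, div_le_div_iff₀ (kp_den_pos hw _) (kp_den_pos hw _)]
      nlinarith [sq_nonneg w])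
  have h2 := kp_int' hw x
  nlinarith

lemma cell_eq_iv (w : ℝ) (k : ℕ) : cell w k = iv (-Real.pi + k * w, w) := by
  unfold cell iv; congr 1; simp only; ring

lemma cen_mem {w : ℝ} (hw : 0 < w) (k : ℕ) : cen w k ∈ cell w k := by
  unfold cen cell; constructor <;> nlinarith

lemma CZ_cells {v : ℝ → ℝ} (hv : Continuous v) (hv0 : ∀ u, 0 ≤ v u) {lam : ℝ} (hlam : 0 < lam) {J : ℕ}
    {Q : Finset (ℝ × ℝ)} (h : CZ v lam J (-Real.pi) (2 * Real.pi) Q) {x : ℝ} (hx : EQ Q x ≤ 1 / 2)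
    {j : ℕ} (hj : j ≤ J) {w : ℝ} (hwj : w = 2 * Real.pi / 2 ^ j) :
    ∑ k ∈ Finset.range (2 ^ j), (∫ u in cell w k, v u) ^ 2 /
      (w ^ 2 + Real.sin ((x - cen w k) / 2) ^ 2) ≤ 200 * lam ^ 2 := by
  have hw : 0 < w := by rw [hwj]; have := Real.pi_pos; positivity
  have hN : ((2 ^ j : ℕ) : ℝ) * w = 2 * Real.pi := by rw [hwj]; push_cast; field_simp
  set K : ℝ → ℝ := fun u => ∑ q ∈ Q, (iv q).indicator (fun _ => q.2 / (q.2 ^ 2 + Real.sin ((x - cq q) / 2) ^ 2)) u with hK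
  have he : ∀ q ∈ Q, eQ q x ≤ 1 / 2 := fun q hq =>
        (Finset.single_le_sum (fun q _ => eQ_nonneg q x) hq).trans hx
  have hK1 : ∀ q ∈ Q, ∀ u ∈ iv q, K u = q.2 / (q.2 ^ 2 + Real.sin ((x - cq q) / 2) ^ 2) := by
    intro q hq u hu
    rw [hK]
    simp only
    rw [Finset.sum_eq_single q]
    · rw [indicator_of_mem hu]
    · intro q' hq' hne
      rw [indicator_of_notMem]
      intro hu'
      exact (Set.disjoint_left.mp (h.disj q' hq' q hq hne) hu' hu)
    · intro h'; exact absurd hq h'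
  have hK2 : ∀ u, u ∉ (⋃ q ∈ Q, iv q) → K u = 0 := by
    intro u hu
    apply Finset.sum_eq_zero
    intro q hq
    rw [indicator_of_notMem]
    intro hu'; exact hu (mem_biUnion hq hu')
  have hK0 : ∀ u, 0 ≤ K u := by
    intro u
    apply Finset.sum_nonneg
    intro q hq
    apply indicator_nonneg
    intro _ _
    have := h.pos q hq
    positivity
  have hvK : IntegrableOn (fun u => v u * K u) T1 := by
    simp only [hK, Finset.mul_sum]
    apply integrable_finsetSum
    intro q hq
    have : (fun u => v u * (iv q).indicator (fun _ => q.2 / (q.2 ^ 2 + Real.sin ((x - cq q) / 2) ^ 2)) u)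
      = (iv q).indicator (fun u => v u * (q.2 / (q.2 ^ 2 + Real.sin ((x - cq q) / 2) ^ 2))) := by
      funext u; by_cases hu : u ∈ iv q <;> simp [hu]
    rw [this]
    exact ((continuous_integrableOn_T1 hv).mul_const _).indicator (iv_meas q)
  have hkpi : IntegrableOn (fun u => v u * kp w (x - u)) T1 :=
    continuous_integrableOn_T1 (hv.mul ((kp_continuous hw).comp (by fun_prop)))
  have hvKint : ∫ u in T1, v u * K u ≤ lam := by
    rw [CZ_split h hvK]
    have z : ∫ u in T1 \ ⋃ q ∈ Q, iv q, v u * K u = 0 := by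
      apply setIntegral_eq_zero_of_forall_eq_zero
      intro u hu; rw [hK2 u hu.2, mul_zero]
    rw [z, add_zero]
    have : ∀ q ∈ Q, ∫ u in iv q, v u * K u ≤ 2 * lam * eQ q x := by
      intro q hq
      rw [setIntegral_congr_fun (iv_meas q) (g := fun u => v u * (q.2 / (q.2 ^ 2 + Real.sin ((x - cq q) / 2) ^ 2)))
        (fun u hu => by simp only; rw [hK1 q hq u hu]), integral_mul_const]
      have h1 := h.upper q hq
      have h2 := h.pos q hq
      have : eQ q x = q.2 * (q.2 / (q.2 ^ 2 + Real.sin ((x - cq q) / 2) ^ 2)) := by unfold eQ; ring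
      rw [this]
      have h3 : 0 ≤ q.2 / (q.2 ^ 2 + Real.sin ((x - cq q) / 2) ^ 2) := by positivity
      nlinarith
    refine (Finset.sum_le_sum this).trans ?_
    rw [← Finset.mul_sum]
    change 2 * lam * EQ Q x ≤ lam
    nlinarith
  have hterm : ∀ k ∈ Finset.range (2 ^ j), (∫ u in cell w k, v u) ^ 2 /
      (w ^ 2 + Real.sin ((x - cen w k) / 2) ^ 2) ≤
      3 * lam * (∫ u in cell w k, v u * kp w (x - u)) + 8 * lam * ∫ u in cell w k, v u * K u := by
    intro k hk
    rw [Finset.mem_range] at hk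
    have hsub := cell_subset hw hN hk
    have hD := kp_den_pos hw (x - cen w k)
    have p1 : 0 ≤ ∫ u in cell w k, v u * kp w (x - u) :=
      integral_nonneg (fun u => mul_nonneg (hv0 u) (kp_nonneg hw _))
    have p2 : 0 ≤ ∫ u in cell w k, v u * K u :=
      integral_nonneg (fun u => mul_nonneg (hv0 u) (hK0 _))
    have p3 : 0 ≤ ∫ u in cell w k, v u := integral_nonneg hv0
    have hvc : IntegrableOn v (cell w k) := (continuous_integrableOn_T1 hv).mono_set hsub
    have hcase := h.sub_cell j hj k hk
    rw [← hwj, ← cell_eq_iv] at hcase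
    rcases hcase with h1 | ⟨q, hq, h1⟩
    · have h2 : (∫ u in cell w k, v u) * (w / (w ^ 2 + Real.sin ((x - cen w k) / 2) ^ 2)) ≤
          3 * ∫ u in cell w k, v u * kp w (x - u) := by
        rw [← integral_mul_const, ← integral_const_mul]
        apply setIntegral_mono_on (hvc.mul_const _) ((hkpi.mono_set hsub).const_mul _) (cell_meas w k)
        intro u hu
        have h3 := cell_cen hw hu
        have h4 := kp_pert (w := w) (θ := x - cen w k) (θ' := x - u) (by
          rw [show x - cen w k - (x - u) = u - cen w k by ring]; linarith)
        have : w / (w ^ 2 + Real.sin ((x - cen w k) / 2) ^ 2) ≤ 3 * kp w (x - u) := by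
          unfold kp
          rw [← mul_div_assoc, div_le_div_iff₀ hD (kp_den_pos hw _)]
          nlinarith
        nlinarith [mul_le_mul_of_nonneg_left this (hv0 u)]
      have h5 : (∫ u in cell w k, v u) ^ 2 / (w ^ 2 + Real.sin ((x - cen w k) / 2) ^ 2) ≤
          lam * ((∫ u in cell w k, v u) * (w / (w ^ 2 + Real.sin ((x - cen w k) / 2) ^ 2))) := by
        rw [← mul_div_assoc, ← mul_div_assoc]
        apply div_le_div_of_nonneg_right _ hD.le
        nlinarith
      nlinarith
    · have hq2 := h.pos q hq
      have h2 := s_lower hq2 (he q hq) (h1 (cen_mem hw k))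
      have h3 : ∫ u in cell w k, v u ≤ 2 * lam * q.2 :=
        (setIntegral_mono_set (iv_int hv q) (Eventually.of_forall hv0) h1.eventuallyLE).trans (h.upper q hq)
      have h4 : ∫ u in cell w k, v u * K u = (∫ u in cell w k, v u) * (q.2 / (q.2 ^ 2 + Real.sin ((x - cq q) / 2) ^ 2)) := by
        rw [setIntegral_congr_fun (cell_meas w k) (g := fun u => v u * (q.2 / (q.2 ^ 2 + Real.sin ((x - cq q) / 2) ^ 2)))
        (fun u hu => by simp only; rw [hK1 q hq u (h1 hu)]), integral_mul_const]
      have h5 : (∫ u in cell w k, v u) ^ 2 / (w ^ 2 + Real.sin ((x - cen w k) / 2) ^ 2) ≤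
          8 * lam * ∫ u in cell w k, v u * K u := by
        rw [h4, ← mul_div_assoc, ← mul_div_assoc, div_le_div_iff₀ hD (kp_den_pos hq2 _)]
        have hA : (∫ u in cell w k, v u) ^ 2 ≤ 2 * lam * q.2 * ∫ u in cell w k, v u := by nlinarith
        have hB : q.2 ^ 2 + Real.sin ((x - cq q) / 2) ^ 2 ≤ 4 * (w ^ 2 + Real.sin ((x - cen w k) / 2) ^ 2) := by
          nlinarith [sq_nonneg w]
        calc _ ≤ (2 * lam * q.2 * ∫ u in cell w k, v u) * (4 * (w ^ 2 + Real.sin ((x - cen w k) / 2) ^ 2)) :=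
              mul_le_mul hA hB (by positivity) (by positivity)
          _ = _ := by ring
      have : 0 ≤ 3 * lam * ∫ u in cell w k, v u * kp w (x - u) := by positivity
      linarith
  refine (Finset.sum_le_sum hterm).trans ?_
  rw [Finset.sum_add_distrib, ← Finset.mul_sum, ← Finset.mul_sum, ← cell_sum hw _ _ hN hkpi,
    ← cell_sum hw _ _ hN hvK]
  have := CZ_kp hv hv0 hlam h hx hw
  nlinarith

def ee (m : ℤ) (u : ℝ) : ℂ := Complex.exp (Complex.I * ((m : ℂ) * (u : ℂ)))

lemma ee_continuous (m : ℤ) : Continuous (ee m) := by unfold ee; fun_prop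

lemma ee_norm (m : ℤ) (u : ℝ) : ‖ee m u‖ = 1 := by
  unfold ee
  rw [show Complex.I * ((m : ℂ) * (u : ℂ)) = ((m * u : ℝ) : ℂ) * Complex.I by push_cast; ring]
  exact Complex.norm_exp_ofReal_mul_I _

lemma ee_mul (m k : ℤ) (u : ℝ) : ee m u * ee k u = ee (m + k) u := by
  unfold ee; rw [← Complex.exp_add]; congr 1; push_cast; ring

lemma ee_conj (m : ℤ) (u : ℝ) : (starRingEnd ℂ) (ee m u) = ee (-m) u := by
  unfold ee; rw [← Complex.exp_conj]; congr 1; simp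

lemma ee_zero (u : ℝ) : ee 0 u = 1 := by unfold ee; simp

lemma ee_add (m : ℤ) (u v : ℝ) : ee m (u + v) = ee m u * ee m v := by
  unfold ee; rw [← Complex.exp_add]; congr 1; push_cast; ring

lemma ee_neg (m : ℤ) (u : ℝ) : ee m (-u) = ee (-m) u := by
  unfold ee; congr 1; push_cast; ring

lemma ee_sub (m : ℤ) (u v : ℝ) : ee m (u - v) = ee m u * ee (-m) v := by
  rw [sub_eq_add_neg, ee_add, ee_neg]

lemma ee_periodic (m : ℤ) (u : ℝ) : ee m (u + 2 * Real.pi) = ee m u := by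
  unfold ee
  rw [show Complex.I * ((m : ℂ) * ((u + 2 * Real.pi : ℝ) : ℂ)) = Complex.I * ((m : ℂ) * (u : ℂ)) + m * (2 * Real.pi * Complex.I) by push_cast; ring]
  rw [Complex.exp_add, Complex.exp_int_mul_two_pi_mul_I, mul_one]

lemma setT1_eq_C (F : ℝ → ℂ) : ∫ x in T1, F x = ∫ x in (-Real.pi)..Real.pi, F x := by
  rw [T1, intervalIntegral.integral_of_le (by linarith [Real.pi_pos]), integral_Ico_eq_integral_Ioc]

lemma ee_int (m : ℤ) : ∫ u in T1, ee m u = if m = 0 then ((2 * Real.pi : ℝ) : ℂ) else 0 := by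
  rw [setT1_eq_C]
  split_ifs with h
  · subst h; simp only [ee_zero]; simp; ring
  · have hc : Complex.I * (m:ℂ) ≠ 0 := mul_ne_zero Complex.I_ne_zero (by exact_mod_cast h)
    have : ∀ u : ℝ, ee m u = Complex.exp ((Complex.I * (m:ℂ)) * (u:ℂ)) := by
      intro u; unfold ee; rw [mul_assoc]
    simp only [this]
    rw [integral_exp_mul_complex hc]
    rw [← this, ← this]
    have h2 := ee_periodic m (-Real.pi)
    rw [show -Real.pi + 2 * Real.pi = Real.pi by ring] at h2
    rw [h2, sub_self, zero_div]

lemma norm_sq_int_C {A : ℝ → ℂ} {s : Set ℝ} :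
    ((∫ u in s, ‖A u‖ ^ 2 : ℝ) : ℂ) = ∫ u in s, A u * (starRingEnd ℂ) (A u) := by
  rw [← integral_complex_ofReal]
  congr 1; funext u
  rw [Complex.mul_conj, Complex.normSq_eq_norm_sq]

lemma parseval (s : Finset ℤ) (a : ℤ → ℂ) :
    ∫ u in T1, ‖∑ m ∈ s, a m * ee m u‖ ^ 2 = 2 * Real.pi * ∑ m ∈ s, ‖a m‖ ^ 2 := by
  have : ((∫ u in T1, ‖∑ m ∈ s, a m * ee m u‖ ^ 2 : ℝ) : ℂ) = ((2 * Real.pi * ∑ m ∈ s, ‖a m‖ ^ 2 : ℝ) : ℂ) := by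
    rw [norm_sq_int_C]
    have e : ∀ u : ℝ, (∑ m ∈ s, a m * ee m u) * (starRingEnd ℂ) (∑ m ∈ s, a m * ee m u) =
        ∑ m ∈ s, ∑ k ∈ s, (a m * (starRingEnd ℂ) (a k)) * ee (m - k) u := by
      intro u
      rw [map_sum, Finset.sum_mul_sum]
      refine Finset.sum_congr rfl (fun m _ => Finset.sum_congr rfl (fun k _ => ?_))
      rw [map_mul, ee_conj, sub_eq_add_neg, ← ee_mul]; ring
    simp only [e]
    have hi : ∀ (c : ℂ) (k : ℤ), IntegrableOn (fun u => c * ee k u) T1 := fun c k =>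
      continuous_integrableOn_T1 (continuous_const.mul (ee_continuous k))
    rw [integral_finsetSum _ (fun m _ => integrable_finsetSum _ (fun k _ => hi _ _))]
    rw [Complex.ofReal_mul, Complex.ofReal_sum, Finset.mul_sum]
    refine Finset.sum_congr rfl (fun m hm => ?_)
    rw [integral_finsetSum _ (fun k _ => hi _ _)]
    rw [Finset.sum_eq_single m]
    · rw [integral_const_mul, ee_int, if_pos (sub_self m), Complex.mul_conj, Complex.normSq_eq_norm_sq]; ring
    · intro k _ hk
      rw [integral_const_mul, ee_int, if_neg (by intro h; apply hk; omega), mul_zero]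
    · intro h; exact absurd hm h
  exact_mod_cast this

lemma gallagher {w : ℝ} (hw : 0 < w) {A A' : ℝ → ℂ} (hA : ∀ u, HasDerivAt A (A' u) u) (hA' : Continuous A')
    (k : ℕ) {η : ℝ} (hη : 0 < η) {u : ℝ} (hu : u ∈ cell w k) :
    w * ‖A u‖ ^ 2 ≤ (1 + w * η) * (∫ t in cell w k, ‖A t‖ ^ 2) + w / η * ∫ t in cell w k, ‖A' t‖ ^ 2 := by
  have hAc : Continuous A := continuous_iff_continuousAt.mpr (fun u => (hA u).continuousAt)
  have hi1 : IntegrableOn (fun t => ‖A t‖ ^ 2) (cell w k) := by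
    rw [cell_eq_iv]; exact iv_int (by fun_prop) _
  have hi2 : IntegrableOn (fun t => ‖A' t‖ ^ 2) (cell w k) := by
    rw [cell_eq_iv]; exact iv_int (by fun_prop) _
  have key : ∀ u' ∈ cell w k, ‖A u‖ ^ 2 - (∫ t in cell w k, (η * ‖A t‖ ^ 2 + ‖A' t‖ ^ 2 / η)) ≤ ‖A u'‖ ^ 2 := by
    intro u' hu'
    have hd : ∀ t ∈ uIcc u' u, HasDerivAt (fun t => ‖A t‖ ^ 2) (2 * inner ℝ (A t) (A' t)) t :=
      fun t _ => (hA t).norm_sq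
    have hcont : Continuous (fun t => 2 * inner ℝ (A t) (A' t)) := by fun_prop
    have h1 := intervalIntegral.integral_eq_sub_of_hasDerivAt hd (hcont.intervalIntegrable _ _)
    have h2 : ∫ t in u'..u, 2 * inner ℝ (A t) (A' t) ≤ ∫ t in cell w k, (η * ‖A t‖ ^ 2 + ‖A' t‖ ^ 2 / η) := by
      refine (le_abs_self _).trans ?_
      rw [← Real.norm_eq_abs]
      refine (intervalIntegral.norm_integral_le_integral_norm_uIoc).trans ?_
      have hsub : uIoc u' u ⊆ cell w k := by
        intro t ht
        rw [mem_uIoc] at ht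
        obtain ⟨p1, p2⟩ := hu; obtain ⟨p3, p4⟩ := hu'
        rcases ht with ⟨h, h'⟩ | ⟨h, h'⟩
        · exact ⟨by linarith, by linarith⟩
        · exact ⟨by linarith, by linarith⟩
      have hi3 : IntegrableOn (fun t => η * ‖A t‖ ^ 2 + ‖A' t‖ ^ 2 / η) (cell w k) :=
        (hi1.const_mul _).add (hi2.div_const _)
      refine le_trans ?_ (setIntegral_mono_set hi3 (Eventually.of_forall (fun t => by
        simp only [Pi.zero_apply]; positivity)) hsub.eventuallyLE)
      apply setIntegral_mono_on _ (hi3.mono_set hsub) measurableSet_uIoc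
      · intro t _
        rw [Real.norm_eq_abs, abs_mul, abs_two]
        have h3 := abs_real_inner_le_norm (A t) (A' t)
        have h4 : 0 ≤ (η * ‖A t‖ - ‖A' t‖) ^ 2 / η := by positivity
        have h5 : (η * ‖A t‖ - ‖A' t‖) ^ 2 / η = η * ‖A t‖ ^ 2 + ‖A' t‖ ^ 2 / η - 2 * (‖A t‖ * ‖A' t‖) := by
          field_simp; ring
        linarith
      · exact (hcont.norm.intervalIntegrable u' u).def'
    linarith
  have hvol : volume (cell w k) ≠ ⊤ := by unfold cell; simp
  have h2 := setIntegral_mono_on ((integrableOn_const_iff (by simp)).mpr (Or.inr hvol.lt_top)) hi1 (cell_meas w k) key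
  rw [setIntegral_const, cell_vol hw, smul_eq_mul, integral_add (hi1.const_mul _) (hi2.div_const _),
    integral_const_mul, integral_div] at h2
  have : w / η * ∫ t in cell w k, ‖A' t‖ ^ 2 = w * ((∫ t in cell w k, ‖A' t‖ ^ 2) / η) := by ring
  rw [this]
  linarith

lemma gallagher_sum {w : ℝ} (hw : 0 < w) {N : ℕ} (hN : N * w = 2 * Real.pi) (s : Finset ℤ)
    (hs : ∀ m ∈ s, |m| ≤ N) (h : ℝ → ℂ) (hh : IntegrableOn h T1) :
    ∑ m ∈ s, ‖∫ u in T1, h u * ee m u‖ ^ 2 ≤ 14 * N * ∑ k ∈ Finset.range N, (∫ u in cell w k, ‖h u‖) ^ 2 := by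
  have hpi := Real.pi_pos
  have hN0 : (0:ℝ) < N := by
    by_contra hcon
    have : (N:ℝ) ≤ 0 := not_lt.mp hcon
    nlinarith
  set a : ℤ → ℂ := fun m => (starRingEnd ℂ) (∫ u in T1, h u * ee m u) with ha
  set A : ℝ → ℂ := fun u => ∑ m ∈ s, a m * ee m u with hA
  set A' : ℝ → ℂ := fun u => ∑ m ∈ s, (a m * (Complex.I * m)) * ee m u with hA'
  have hAc : Continuous A := by
    apply continuous_finsetSum; intro m _; exact continuous_const.mul (ee_continuous m)
  have hA'c : Continuous A' := by
    apply continuous_finsetSum; intro m _; exact continuous_const.mul (ee_continuous m)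
  have hder : ∀ u, HasDerivAt A (A' u) u := by
    intro u
    apply HasDerivAt.fun_sum
    intro m _
    have h1 : HasDerivAt (fun u : ℝ => Complex.I * ((m:ℂ) * (u:ℂ))) (Complex.I * m) u := by
      have := ((Complex.ofRealCLM.hasDerivAt (x := u)).const_mul (m:ℂ)).const_mul Complex.I
      simpa using this
    have h2 := (h1.cexp).const_mul (a m)
    refine h2.congr_deriv ?_
    unfold ee; ring
  set S := ∑ m ∈ s, ‖∫ u in T1, h u * ee m u‖ ^ 2 with hS
  have hS0 : 0 ≤ S := Finset.sum_nonneg (fun m _ => by positivity)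
  have hPA : ∫ u in T1, ‖A u‖ ^ 2 = 2 * Real.pi * S := by
    rw [hA, parseval]; simp [ha, hS]
  have hPA' : ∫ u in T1, ‖A' u‖ ^ 2 ≤ 2 * Real.pi * (N ^ 2 * S) := by
    rw [hA', parseval]
    apply mul_le_mul_of_nonneg_left _ (by positivity)
    rw [hS, Finset.mul_sum]
    apply Finset.sum_le_sum
    intro m hm
    rw [norm_mul, norm_mul, Complex.norm_I, one_mul, mul_pow, Complex.norm_intCast, sq_abs, mul_comm]
    have : ((m:ℝ)) ^ 2 ≤ (N:ℝ) ^ 2 := by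
      apply sq_le_sq'
      · have := (abs_le.mp (hs m hm)).1; exact_mod_cast this
      · have := (abs_le.mp (hs m hm)).2; exact_mod_cast this
    simp only [ha, RCLike.norm_conj]
    exact mul_le_mul_of_nonneg_right this (by positivity)
  set R : ℕ → ℝ := fun k => ((1 + w * N) * (∫ t in cell w k, ‖A t‖ ^ 2) + w / N * ∫ t in cell w k, ‖A' t‖ ^ 2) / w with hR
  have hR0 : ∀ k, 0 ≤ R k := by
    intro k
    have h1 : 0 ≤ ∫ t in cell w k, ‖A t‖ ^ 2 := integral_nonneg (fun t => by positivity)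
    have h2 : 0 ≤ ∫ t in cell w k, ‖A' t‖ ^ 2 := integral_nonneg (fun t => by positivity)
    simp only [hR]; positivity
  have hRA : ∀ k, ∀ u ∈ cell w k, ‖A u‖ ≤ Real.sqrt (R k) := by
    intro k u hu
    apply Real.le_sqrt_of_sq_le
    simp only [hR]
    rw [le_div_iff₀ hw]
    have := gallagher hw hder hA'c k hN0 hu
    linarith
  have hRsum : ∑ k ∈ Finset.range N, R k ≤ 14 * N * S := by
    simp only [hR]
    rw [← Finset.sum_div, Finset.sum_add_distrib, ← Finset.mul_sum, ← Finset.mul_sum,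
      ← cell_sum hw _ N hN (continuous_integrableOn_T1 (by fun_prop)),
      ← cell_sum hw _ N hN (continuous_integrableOn_T1 (by fun_prop)), hPA, div_le_iff₀ hw]
    have e1 : w / N * (∫ u in T1, ‖A' u‖ ^ 2) ≤ w / N * (2 * Real.pi * (N ^ 2 * S)) :=
      mul_le_mul_of_nonneg_left hPA' (by positivity)
    have e2 : w / N * (2 * Real.pi * (N ^ 2 * S)) = 2 * Real.pi * (N * w) * S := by field_simp
    have e3 : 14 * N * S * w = 14 * (N * w) * S := by ring
    rw [e3, show w * N = N * w by ring, hN]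
    rw [e2, hN] at e1
    have hpi4 : Real.pi ≤ 3.15 := Real.pi_lt_d2.le
    have : 0 ≤ Real.pi * S := by positivity
    nlinarith
  have hhA : IntegrableOn (fun u => h u * A u) T1 := by
    have hb : IsCompact (Icc (-Real.pi) Real.pi) := isCompact_Icc
    obtain ⟨C, hC⟩ := hb.exists_bound_of_continuousOn hAc.continuousOn
    refine Integrable.mul_bdd (c := C) hh hAc.aestronglyMeasurable ?_
    exact (ae_restrict_iff' T1_meas).mpr (Eventually.of_forall (fun u hu => hC u (Ico_subset_Icc_self hu)))
  have hSA : (S : ℂ) = ∫ u in T1, h u * A u := by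
    have : ∀ u, h u * A u = ∑ m ∈ s, a m * (h u * ee m u) := by
      intro u; rw [hA, Finset.mul_sum]; refine Finset.sum_congr rfl (fun m _ => by ring)
    simp only [this]
    rw [integral_finsetSum]
    · rw [hS, Complex.ofReal_sum]
      refine Finset.sum_congr rfl (fun m _ => ?_)
      rw [integral_const_mul]
      simp only [ha]
      rw [mul_comm, Complex.mul_conj, Complex.normSq_eq_norm_sq]
    · intro m _
      apply Integrable.const_mul
      exact Integrable.mul_bdd (c := 1) hh (ee_continuous m).aestronglyMeasurable
        (Eventually.of_forall (fun u => (ee_norm m u).le))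
  have hSle : S ≤ ∑ k ∈ Finset.range N, (∫ u in cell w k, ‖h u‖) * Real.sqrt (R k) := by
    have : S = ‖(S:ℂ)‖ := by rw [Complex.norm_real, Real.norm_of_nonneg hS0]
    rw [this, hSA, cell_sum hw _ N hN hhA]
    refine (norm_sum_le _ _).trans (Finset.sum_le_sum (fun k hk => ?_))
    refine (norm_integral_le_integral_norm _).trans ?_
    have hsub := cell_subset hw hN (Finset.mem_range.mp hk)
    rw [← integral_mul_const]
    apply setIntegral_mono_on (hhA.mono_set hsub).norm ((hh.mono_set hsub).norm.mul_const _) (cell_meas w k)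
    intro u hu
    rw [norm_mul]
    exact mul_le_mul_of_nonneg_left (hRA k u hu) (norm_nonneg _)
  have hfin : S ≤ 7 * N * (∑ k ∈ Finset.range N, (∫ u in cell w k, ‖h u‖) ^ 2) +
      (∑ k ∈ Finset.range N, R k) / (28 * N) := by
    refine hSle.trans ?_
    rw [Finset.mul_sum, Finset.sum_div, ← Finset.sum_add_distrib]
    apply Finset.sum_le_sum
    intro k _
    set H := ∫ u in cell w k, ‖h u‖
    have h1 := Real.sq_sqrt (hR0 k)
    have h2 : 0 ≤ (14 * N * H - Real.sqrt (R k)) ^ 2 / (28 * N) := by positivity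
    have h3 : (14 * N * H - Real.sqrt (R k)) ^ 2 / (28 * N) = 7 * N * H ^ 2 + (Real.sqrt (R k)) ^ 2 / (28 * N) - H * Real.sqrt (R k) := by
      field_simp; ring
    rw [h1] at h3
    linarith
  have : (∑ k ∈ Finset.range N, R k) / (28 * N) ≤ S / 2 := by
    rw [div_le_iff₀ (by positivity)]; nlinarith
  linarith

def Dt (n : ℕ) (t : ℝ) : ℝ := ∑ m ∈ Finset.range n, Real.sin (((m : ℝ) + 1) * t)

def cj (g : ℝ → ℂ) (n : ℕ) (x : ℝ) : ℂ := ∫ u in T1, g u * (Dt n (x - u) : ℂ)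

lemma Dt_continuous (n : ℕ) : Continuous (Dt n) := by
  unfold Dt; exact continuous_finsetSum _ (fun m _ => by fun_prop)

lemma Dt_closed (n : ℕ) (t : ℝ) : 2 * Real.sin (t / 2) * Dt n t = Real.cos (t / 2) - Real.cos ((n + 1 / 2) * t) := by
  induction n with
  | zero => unfold Dt; simp; rw [show (2:ℝ)⁻¹ * t = t / 2 by ring]; ring
  | succ n ih =>
    have : Dt (n+1) t = Dt n t + Real.sin (((n : ℝ) + 1) * t) := by unfold Dt; rw [Finset.sum_range_succ]
    rw [this, mul_add, ih]
    have e1 : ((n:ℝ) + 1 / 2) * t = ((n:ℝ) + 1) * t - t / 2 := by ring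
    have e2 : (((n+1:ℕ):ℝ) + 1 / 2) * t = ((n:ℝ) + 1) * t + t / 2 := by push_cast; ring
    rw [e1, e2, Real.cos_sub, Real.cos_add]; ring

lemma Dt_diff (b l : ℕ) (t : ℝ) : |Dt (b + l) t - Dt b t| ≤ l := by
  unfold Dt
  rw [Finset.sum_range_add, add_sub_cancel_left]
  refine (Finset.abs_sum_le_sum_abs _ _).trans ?_
  refine (Finset.sum_le_sum (fun i _ => Real.abs_sin_le_one _)).trans ?_
  simp

lemma abs_Dt_le (n : ℕ) (t : ℝ) : |Dt n t| ≤ n := by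
  have := Dt_diff 0 n t
  simpa [Dt] using this

lemma isub {f g : ℝ → ℂ} {s : Set ℝ} (hf : IntegrableOn f s) (hg : IntegrableOn g s) :
    IntegrableOn (fun u => f u - g u) s := hf.sub hg

lemma osc_block {g : ℝ → ℂ} (hg : Continuous g) {lam : ℝ} (hlam : 0 < lam) {J : ℕ}
    {Q : Finset (ℝ × ℝ)} (h : CZ (fun u => ‖g u‖) lam J (-Real.pi) (2 * Real.pi) Q) {x : ℝ}
    (hx : EQ Q x ≤ 1 / 2) {j : ℕ} (hj : j ≤ J) (b : ℕ) :
    ∃ α : ℂ, ∑ l ∈ Finset.range (2 ^ j), ‖cj g (b + l) x - α‖ ^ 2 ≤ 2 ^ j * (1200 * lam) ^ 2 := by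
  have hpi := Real.pi_pos
  obtain ⟨w, hwj⟩ : ∃ w, w = 2 * Real.pi / 2 ^ j := ⟨_, rfl⟩
  have hw : 0 < w := by rw [hwj]; positivity
  have hN : ((2 ^ j : ℕ) : ℝ) * w = 2 * Real.pi := by rw [hwj]; push_cast; field_simp
  have hv : Continuous (fun u => ‖g u‖) := hg.norm
  have hv0 : ∀ u, 0 ≤ (fun u => ‖g u‖) u := fun u => norm_nonneg _
  have hb' := CZ_kp hv hv0 hlam h hx hw
  have ha' := CZ_cells hv hv0 hlam h hx hj hwj
  set F : Set ℝ := {u | w ≤ |Real.sin ((x - u) / 2)|} with hF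
  have hFm : MeasurableSet F := by
    apply measurableSet_le measurable_const; fun_prop
  set r : ℝ → ℂ := F.indicator (fun u => ((1 / (2 * Real.sin ((x - u) / 2)) : ℝ) : ℂ)) with hr
  have hrm : Measurable r := by
    apply Measurable.indicator _ hFm; fun_prop
  have hrb : ∀ u, ‖r u‖ ≤ 1 / (2 * w) := by
    intro u
    by_cases hu : u ∈ F
    · rw [hr, indicator_of_mem hu, Complex.norm_real, Real.norm_eq_abs, abs_div, abs_one, abs_mul, abs_two]
      have : w ≤ |Real.sin ((x - u) / 2)| := hu
      gcongr
    · rw [hr, indicator_of_notMem hu, norm_zero]; positivity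
  have hgi := continuous_integrableOn_T1 hg
  set h0 : ℝ → ℂ := fun u => g u * r u with hh0
  have h0i : IntegrableOn h0 T1 := Integrable.mul_bdd (c := 1 / (2 * w)) hgi
    hrm.aestronglyMeasurable (Eventually.of_forall hrb)
  set nr : ℕ → ℝ → ℂ := fun n => Fᶜ.indicator (fun u => g u * (Dt n (x - u) : ℂ)) with hnr
  have hgD : ∀ n, Continuous (fun u => g u * (Dt n (x - u) : ℂ)) := fun n =>
    hg.mul (Complex.continuous_ofReal.comp ((Dt_continuous n).comp (by fun_prop)))
  have nri : ∀ n, IntegrableOn (nr n) T1 := fun n =>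
    (continuous_integrableOn_T1 (hgD n)).indicator hFm.compl
  set cs : ℝ → ℝ → ℂ := fun β u => h0 u * (Real.cos (β * (x - u)) : ℂ) with hcs
  have csi : ∀ β, IntegrableOn (cs β) T1 := fun β => Integrable.mul_bdd (c := 1) h0i
    (by fun_prop) (Eventually.of_forall (fun u => by
      rw [Complex.norm_real, Real.norm_eq_abs]; exact Real.abs_cos_le_one _))
  have dec : ∀ n u, g u * (Dt n (x - u) : ℂ) = nr n u + (cs (1/2) u - cs (n + 1/2) u) := by
    intro n u
    by_cases hu : u ∈ F
    · simp only [hnr, hcs, hh0, hr]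
      rw [indicator_of_notMem (by simpa using hu), indicator_of_mem hu, zero_add]
      have h1 := Dt_closed n (x - u)
      have hs : Real.sin ((x - u) / 2) ≠ 0 := by
        intro h0; have h2 : w ≤ |Real.sin ((x - u) / 2)| := hu
        rw [h0, abs_zero] at h2; linarith
      have h2 : Dt n (x - u) = 1 / (2 * Real.sin ((x - u) / 2)) * (Real.cos (1/2 * (x - u)) - Real.cos ((n + 1 / 2) * (x - u))) := by
        rw [show 1/2 * (x - u) = (x - u) / 2 by ring, ← h1]; field_simp
      rw [h2]; push_cast; ring
    · simp only [hnr, hcs, hh0, hr]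
      rw [indicator_of_mem (by simpa using hu), indicator_of_notMem hu]
      simp
  refine ⟨∫ u in T1, (nr b u + cs (1/2) u), ?_⟩
  set φ : ℝ → ℂ := fun u => Complex.exp (-(Complex.I * (((b:ℂ) + 1/2) * (u:ℂ)))) with hφ
  have hφ1 : ∀ u, ‖φ u‖ = 1 := by
    intro u
    rw [hφ]; simp only
    rw [show -(Complex.I * (((b:ℂ) + 1/2) * (u:ℂ))) = ((-(b + 1/2) * u : ℝ) : ℂ) * Complex.I by push_cast; ring]
    exact Complex.norm_exp_ofReal_mul_I _
  have hφc : Continuous φ := by rw [hφ]; fun_prop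
  set A1 : ℤ → ℂ := fun m => ∫ u in T1, (h0 u * φ u) * ee m u with hA1
  set A2 : ℤ → ℂ := fun m => ∫ u in T1, (h0 u * (starRingEnd ℂ) (φ u)) * ee m u with hA2
  have hi1 : IntegrableOn (fun u => h0 u * φ u) T1 := Integrable.mul_bdd (c := 1) h0i
    hφc.aestronglyMeasurable (Eventually.of_forall (fun u => (hφ1 u).le))
  have hi2 : IntegrableOn (fun u => h0 u * (starRingEnd ℂ) (φ u)) T1 := Integrable.mul_bdd (c := 1) h0i
    (Complex.continuous_conj.comp hφc).aestronglyMeasurable (Eventually.of_forall (fun u => by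
      rw [RCLike.norm_conj]; exact (hφ1 u).le))
  have hH : ∀ k ∈ Finset.range (2 ^ j), (∫ u in cell w k, ‖h0 u‖) ^ 2 ≤
      3 / 2 * ((∫ u in cell w k, ‖g u‖) ^ 2 / (w ^ 2 + Real.sin ((x - cen w k) / 2) ^ 2)) := by
    intro k hk
    have hsub := cell_subset hw hN (Finset.mem_range.mp hk)
    have hD := kp_den_pos hw (x - cen w k)
    set D := w ^ 2 + Real.sin ((x - cen w k) / 2) ^ 2 with hDdef
    set c := Real.sqrt (3 / 2 / D) with hc
    have hc2 : c ^ 2 = 3 / 2 / D := Real.sq_sqrt (by positivity)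
    have h1 : ∫ u in cell w k, ‖h0 u‖ ≤ ∫ u in cell w k, ‖g u‖ * c := by
      apply setIntegral_mono_on (h0i.mono_set hsub).norm ((hgi.mono_set hsub).norm.mul_const _) (cell_meas w k)
      intro u hu
      simp only [hh0]
      rw [norm_mul]
      apply mul_le_mul_of_nonneg_left _ (norm_nonneg _)
      by_cases huF : u ∈ F
      · rw [hr, indicator_of_mem huF, Complex.norm_real, Real.norm_eq_abs]
        apply Real.le_sqrt_of_sq_le
        rw [sq_abs]
        have h2 : w ≤ |Real.sin ((x - u) / 2)| := huF
        have h2' : w ^ 2 ≤ Real.sin ((x - u) / 2) ^ 2 := by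
          rw [← sq_abs (Real.sin ((x - u) / 2))]; nlinarith
        have h3 := cell_cen hw hu
        have h4 := kp_pert (w := w) (θ := x - u) (θ' := x - cen w k) (by
          rw [show x - u - (x - cen w k) = -(u - cen w k) by ring, abs_neg]; linarith)
        rw [div_pow, one_pow, mul_pow]
        rw [div_le_div_iff₀ (by nlinarith [sq_nonneg w]) hD]
        nlinarith
      · rw [hr, indicator_of_notMem huF, norm_zero]; exact Real.sqrt_nonneg _
    rw [integral_mul_const] at h1
    have h5 : 0 ≤ ∫ u in cell w k, ‖h0 u‖ := integral_nonneg (fun u => norm_nonneg _)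
    calc (∫ u in cell w k, ‖h0 u‖) ^ 2 ≤ ((∫ u in cell w k, ‖g u‖) * c) ^ 2 := pow_le_pow_left₀ h5 h1 2
      _ = _ := by rw [mul_pow, hc2]; field_simp
  have hHs : ∑ k ∈ Finset.range (2 ^ j), (∫ u in cell w k, ‖h0 u‖) ^ 2 ≤ 300 * lam ^ 2 := by
    refine (Finset.sum_le_sum hH).trans ?_
    rw [← Finset.mul_sum]; linarith
  have hG1 : ∑ l ∈ Finset.range (2 ^ j), ‖A1 (-(l:ℤ))‖ ^ 2 ≤ 14 * 2 ^ j * (300 * lam ^ 2) := by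
    have := gallagher_sum hw hN ((Finset.range (2 ^ j)).image (fun l : ℕ => -(l:ℤ))) (by
      intro m hm
      rw [Finset.mem_image] at hm
      obtain ⟨l, hl, rfl⟩ := hm
      rw [Finset.mem_range] at hl
      rw [abs_neg, Nat.abs_cast]; exact_mod_cast hl.le) _ hi1
    rw [Finset.sum_image (by intro a _ b _ hab; simpa using hab)] at this
    refine this.trans ?_
    simp only [norm_mul (h0 _), hφ1, mul_one]
    push_cast
    exact mul_le_mul_of_nonneg_left hHs (by positivity)
  have hG2 : ∑ l ∈ Finset.range (2 ^ j), ‖A2 (l:ℤ)‖ ^ 2 ≤ 14 * 2 ^ j * (300 * lam ^ 2) := by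
    have := gallagher_sum hw hN ((Finset.range (2 ^ j)).image (fun l : ℕ => (l:ℤ))) (by
      intro m hm
      rw [Finset.mem_image] at hm
      obtain ⟨l, hl, rfl⟩ := hm
      rw [Finset.mem_range] at hl
      rw [Nat.abs_cast]; exact_mod_cast hl.le) _ hi2
    rw [Finset.sum_image (by intro a _ b _ hab; simpa using hab)] at this
    refine this.trans ?_
    simp only [norm_mul (h0 _), RCLike.norm_conj, hφ1, mul_one]
    push_cast
    exact mul_le_mul_of_nonneg_left hHs (by positivity)
  have hcos : ∀ l : ℕ, ‖∫ u in T1, cs ((b + l : ℕ) + 1/2) u‖ ^ 2 ≤ (‖A1 (-(l:ℤ))‖ ^ 2 + ‖A2 (l:ℤ)‖ ^ 2) / 2 := by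
    intro l
    set c : ℂ := Complex.exp (((((b + l : ℕ):ℝ) + 1/2) * x : ℝ) * Complex.I) with hc
    have hc1 : ‖c‖ = 1 := Complex.norm_exp_ofReal_mul_I _
    have e : ∀ u, cs ((b + l : ℕ) + 1/2) u = c / 2 * (h0 u * φ u * ee (-(l:ℤ)) u) +
        (starRingEnd ℂ) c / 2 * (h0 u * (starRingEnd ℂ) (φ u) * ee (l:ℤ) u) := by
      intro u
      have e1 : c * φ u * ee (-(l:ℤ)) u = Complex.exp (((((b + l : ℕ):ℝ) + 1/2) * (x - u) : ℝ) * Complex.I) := by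
        rw [hc, hφ]; unfold ee; simp only; rw [← Complex.exp_add, ← Complex.exp_add]; congr 1; push_cast; ring
      have e2 : (starRingEnd ℂ) c * (starRingEnd ℂ) (φ u) * ee (l:ℤ) u = (starRingEnd ℂ) (Complex.exp (((((b + l : ℕ):ℝ) + 1/2) * (x - u) : ℝ) * Complex.I)) := by
        rw [← e1, map_mul, map_mul, ee_conj, neg_neg]
      have e3 : ((Real.cos ((((b + l : ℕ):ℝ) + 1/2) * (x - u)) : ℝ) : ℂ) = (Complex.exp (((((b + l : ℕ):ℝ) + 1/2) * (x - u) : ℝ) * Complex.I) +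
        (starRingEnd ℂ) (Complex.exp (((((b + l : ℕ):ℝ) + 1/2) * (x - u) : ℝ) * Complex.I))) / 2 := by
        rw [Complex.ofReal_cos, Complex.cos, ← Complex.exp_conj]
        rw [map_mul, Complex.conj_I, Complex.conj_ofReal, mul_neg, neg_mul]
      simp only [hcs]
      rw [e3, ← e1, map_mul, map_mul, ee_conj, neg_neg]; ring
    have hib : ∀ (m : ℤ) (H : ℝ → ℂ), IntegrableOn H T1 → IntegrableOn (fun u => H u * ee m u) T1 := fun m H hH =>
      Integrable.mul_bdd (c := 1) hH (ee_continuous m).aestronglyMeasurable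
        (Eventually.of_forall (fun u => (ee_norm m u).le))
    have e4 : ∫ u in T1, cs ((b + l : ℕ) + 1/2) u = c / 2 * A1 (-(l:ℤ)) + (starRingEnd ℂ) c / 2 * A2 (l:ℤ) := by
      simp only [e]
      rw [integral_add ((hib _ _ hi1).const_mul _) ((hib _ _ hi2).const_mul _), integral_const_mul, integral_const_mul]
    have e5 : ‖∫ u in T1, cs ((b + l : ℕ) + 1/2) u‖ ≤ (‖A1 (-(l:ℤ))‖ + ‖A2 (l:ℤ)‖) / 2 := by
      rw [e4]
      refine (norm_add_le _ _).trans ?_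
      rw [norm_mul, norm_mul, norm_div, norm_div, RCLike.norm_conj, hc1]
      simp only [Complex.norm_ofNat]; linarith
    have e6 := norm_nonneg (∫ u in T1, cs ((b + l : ℕ) + 1/2) u)
    nlinarith [sq_nonneg (‖A1 (-(l:ℤ))‖ - ‖A2 (l:ℤ)‖)]
  have hnear : ∀ l ∈ Finset.range (2 ^ j), ‖∫ u in T1, (nr (b + l) u - nr b u)‖ ≤ 240 * Real.pi * lam := by
    intro l hl
    rw [Finset.mem_range] at hl
    refine (norm_integral_le_integral_norm _).trans ?_
    have h1 : ∫ u in T1, ‖nr (b + l) u - nr b u‖ ≤ ∫ u in T1, (2 * (2 ^ j * w)) * (‖g u‖ * kp w (x - u)) := by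
      apply setIntegral_mono_on (isub (nri _) (nri _)).norm _ T1_meas
      · intro u _
        simp only [hnr]
        by_cases hu : u ∈ F
        · rw [indicator_of_notMem (by simpa using hu), indicator_of_notMem (by simpa using hu), sub_zero, norm_zero]
          have := kp_nonneg hw (x - u)
          positivity
        · rw [indicator_of_mem (by simpa using hu), indicator_of_mem (by simpa using hu), ← mul_sub, norm_mul,
            ← Complex.ofReal_sub, Complex.norm_real, Real.norm_eq_abs]
          have h2 := Dt_diff b l (x - u)
          have h3 : (l:ℝ) ≤ 2 ^ j := by exact_mod_cast hl.le
          have h4 : |Real.sin ((x - u) / 2)| < w := by simpa [hF] using hu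
          have h5 : 1 ≤ 2 * w * kp w (x - u) := by
            unfold kp
            rw [← mul_div_assoc, le_div_iff₀ (kp_den_pos hw _), ← sq_abs (Real.sin _)]
            nlinarith [abs_nonneg (Real.sin ((x - u) / 2))]
          have h6 : |Dt (b + l) (x - u) - Dt b (x - u)| ≤ 2 ^ j * (2 * w * kp w (x - u)) := by
            have : (2:ℝ) ^ j * 1 ≤ 2 ^ j * (2 * w * kp w (x - u)) := mul_le_mul_of_nonneg_left h5 (by positivity)
            linarith
          calc _ ≤ ‖g u‖ * (2 ^ j * (2 * w * kp w (x - u))) := mul_le_mul_of_nonneg_left h6 (norm_nonneg _)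
            _ = _ := by ring
      · exact (continuous_integrableOn_T1 (hv.mul ((kp_continuous hw).comp (by fun_prop)))).const_mul _
    rw [integral_const_mul] at h1
    push_cast at hN
    rw [hN] at h1
    have hpl : 0 ≤ Real.pi := hpi.le
    nlinarith
  have hterm : ∀ l ∈ Finset.range (2 ^ j), ‖cj g (b + l) x - ∫ u in T1, (nr b u + cs (1/2) u)‖ ^ 2 ≤
      2 * (240 * Real.pi * lam) ^ 2 + (‖A1 (-(l:ℤ))‖ ^ 2 + ‖A2 (l:ℤ)‖ ^ 2) := by
    intro l hl
    have e : cj g (b + l) x - ∫ u in T1, (nr b u + cs (1/2) u) =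
        (∫ u in T1, (nr (b + l) u - nr b u)) - ∫ u in T1, cs ((b + l : ℕ) + 1/2) u := by
      unfold cj
      simp only [dec]
      rw [integral_add (nri _) (isub (csi _) (csi _)), integral_sub (csi _) (csi _), integral_add (nri _) (csi _),
        integral_sub (nri _) (nri _)]
      ring
    rw [e]
    have h1 := norm_sub_le (∫ u in T1, (nr (b + l) u - nr b u)) (∫ u in T1, cs ((b + l : ℕ) + 1/2) u)
    have h2 := hnear l hl
    have h3 := hcos l
    set X := ‖∫ u in T1, (nr (b + l) u - nr b u)‖
    set Y := ‖∫ u in T1, cs ((b + l : ℕ) + 1/2) u‖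
    have hX : 0 ≤ X := norm_nonneg _
    have h4 : X ^ 2 ≤ (240 * Real.pi * lam) ^ 2 := pow_le_pow_left₀ hX h2 2
    have h5 := pow_le_pow_left₀ (norm_nonneg _) h1 2
    nlinarith [sq_nonneg (X - Y)]
  refine (Finset.sum_le_sum hterm).trans ?_
  rw [Finset.sum_add_distrib, Finset.sum_add_distrib, Finset.sum_const, Finset.card_range, nsmul_eq_mul]
  push_cast
  have hp2 : Real.pi ^ 2 ≤ 10 := by have := Real.pi_lt_d2; nlinarith
  have hpw : (0:ℝ) < 2 ^ j := by positivity
  have : (2:ℝ) ^ j * (2 * (240 * Real.pi * lam) ^ 2) + (14 * 2 ^ j * (300 * lam ^ 2) + 14 * 2 ^ j * (300 * lam ^ 2)) ≤ 2 ^ j * (1200 * lam) ^ 2 := by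
    have e : (2:ℝ) ^ j * (2 * (240 * Real.pi * lam) ^ 2) + (14 * 2 ^ j * (300 * lam ^ 2) + 14 * 2 ^ j * (300 * lam ^ 2)) =
      (2 ^ j * lam ^ 2) * (115200 * Real.pi ^ 2 + 8400) := by ring
    rw [e]
    have : 0 ≤ (2:ℝ) ^ j * lam ^ 2 := by positivity
    nlinarith
  linarith

lemma sum_Icc_symm_succ {M : Type*} [AddCommMonoid M] (n : ℕ) (f : ℤ → M) :
    ∑ k ∈ Finset.Icc (-((n+1:ℕ):ℤ)) ((n+1:ℕ):ℤ), f k =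
      f ((n:ℤ)+1) + (f (-((n:ℤ)+1)) + ∑ k ∈ Finset.Icc (-(n:ℤ)) (n:ℤ), f k) := by
  have : Finset.Icc (-((n+1:ℕ):ℤ)) ((n+1:ℕ):ℤ) = insert ((n:ℤ)+1) (insert (-((n:ℤ)+1)) (Finset.Icc (-(n:ℤ)) (n:ℤ))) := by
    ext k; simp only [Finset.mem_Icc, Finset.mem_insert]; push_cast; omega
  rw [this, Finset.sum_insert, Finset.sum_insert]
  · simp
  · simp only [Finset.mem_insert, Finset.mem_Icc]; omega

def Dn (n : ℕ) (t : ℝ) : ℂ := ∑ k ∈ Finset.Icc (-(n:ℤ)) (n:ℤ), ee k t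

def FN (N : ℕ) (t : ℝ) : ℂ := ∑ n ∈ Finset.range N, Dn n t

lemma ee_pair_cos (m : ℤ) (t : ℝ) : ee m t + ee (-m) t = 2 * (Real.cos (m * t) : ℂ) := by
  unfold ee
  rw [Complex.ofReal_cos, Complex.cos]
  push_cast
  rw [show Complex.I * ((m:ℂ) * (t:ℂ)) = (m:ℂ) * (t:ℂ) * Complex.I by ring,
    show Complex.I * (-(m:ℂ) * (t:ℂ)) = -((m:ℂ) * (t:ℂ)) * Complex.I by ring]
  ring

lemma ee_pair_sin (m : ℤ) (t : ℝ) : ee m t - ee (-m) t = 2 * Complex.I * (Real.sin (m * t) : ℂ) := by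
  unfold ee
  rw [Complex.ofReal_sin, Complex.sin]
  push_cast
  rw [show Complex.I * ((m:ℂ) * (t:ℂ)) = (m:ℂ) * (t:ℂ) * Complex.I by ring,
    show Complex.I * (-(m:ℂ) * (t:ℂ)) = -((m:ℂ) * (t:ℂ)) * Complex.I by ring]
  linear_combination (Complex.exp ((m:ℂ) * (t:ℂ) * Complex.I) - Complex.exp (-((m:ℂ) * (t:ℂ)) * Complex.I)) * Complex.I_sq

lemma Dn_closed (n : ℕ) (t : ℝ) : (Real.sin (t / 2) : ℂ) * Dn n t = (Real.sin ((n + 1 / 2) * t) : ℂ) := by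
  induction n with
  | zero => unfold Dn; simp [ee_zero]; congr 1; ring
  | succ n ih =>
    have : Dn (n+1) t = 2 * (Real.cos (((n:ℝ)+1) * t) : ℂ) + Dn n t := by
      unfold Dn
      rw [sum_Icc_symm_succ, ← add_assoc, ee_pair_cos]; push_cast; rfl
    rw [this, mul_add, ih]
    have e1 : ((n:ℝ) + 1 / 2) * t = ((n:ℝ) + 1) * t - t / 2 := by ring
    have e2 : (((n+1:ℕ):ℝ) + 1 / 2) * t = ((n:ℝ) + 1) * t + t / 2 := by push_cast; ring
    rw [e1, e2, Real.sin_sub, Real.sin_add]; push_cast; ring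

lemma FN_closed (N : ℕ) (t : ℝ) : (Real.sin (t / 2) : ℂ) ^ 2 * FN N t = (((1 - Real.cos (N * t)) / 2 : ℝ) : ℂ) := by
  induction N with
  | zero => unfold FN; simp
  | succ N ih =>
    have : FN (N+1) t = FN N t + Dn N t := by unfold FN; rw [Finset.sum_range_succ]
    rw [this, mul_add, ih, sq, mul_assoc, Dn_closed, ← Complex.ofReal_mul, ← Complex.ofReal_add]
    congr 1
    have e1 : (N:ℝ) * t = ((N:ℝ) + 1/2) * t - t / 2 := by ring
    have e2 : ((N+1:ℕ):ℝ) * t = ((N:ℝ) + 1/2) * t + t / 2 := by push_cast; ring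
    rw [e2, e1, Real.cos_sub, Real.cos_add]; ring

lemma FN_bound {N : ℕ} (hN : 0 < N) (t : ℝ) : ‖FN N t‖ ≤ 2 * N * kp (1 / N) t := by
  have hN' : (0:ℝ) < N := by exact_mod_cast hN
  have h1 : ‖FN N t‖ ≤ (N:ℝ) ^ 2 := by
    have hD : ∀ n, ‖Dn n t‖ ≤ 2 * n + 1 := by
      intro n
      unfold Dn
      refine (norm_sum_le _ _).trans ?_
      simp only [ee_norm]
      rw [Finset.sum_const, Int.card_Icc]
      simp only [nsmul_eq_mul, mul_one]
      have : ((n:ℤ) + 1 - -(n:ℤ)).toNat = 2 * n + 1 := by omega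
      rw [this]; push_cast; exact le_refl _
    have : ∀ N : ℕ, ∑ n ∈ Finset.range N, (2 * (n:ℝ) + 1) = (N:ℝ) ^ 2 := by
      intro N
      induction N with
      | zero => simp
      | succ N ih => rw [Finset.sum_range_succ, ih]; push_cast; ring
    unfold FN
    exact (norm_sum_le _ _).trans ((Finset.sum_le_sum (fun n _ => hD n)).trans (this N).le)
  have h2 : Real.sin (t / 2) ^ 2 * ‖FN N t‖ ≤ 1 := by
    have := congrArg norm (FN_closed N t)
    rw [norm_mul, norm_pow, Complex.norm_real, Complex.norm_real, Real.norm_eq_abs, sq_abs, Real.norm_eq_abs] at this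
    rw [this, abs_le]
    constructor <;> linarith [Real.cos_le_one (N * t), Real.neg_one_le_cos (N * t)]
  unfold kp
  rw [← mul_div_assoc, le_div_iff₀ (by positivity)]
  have e : 2 * (N:ℝ) * (1 / N) = 2 := by field_simp
  rw [e, mul_add]
  have : ‖FN N t‖ * (1 / (N:ℝ)) ^ 2 ≤ 1 := by
    rw [div_pow, one_pow, mul_one_div, div_le_one (by positivity)]; exact h1
  linarith

lemma Dt_ee (n : ℕ) (t : ℝ) : (Dt n t : ℂ) = ∑ k ∈ Finset.Icc (-(n:ℤ)) (n:ℤ), ((Int.sign k : ℂ) / (2 * Complex.I)) * ee k t := by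
  induction n with
  | zero => unfold Dt; simp
  | succ n ih =>
    have : Dt (n+1) t = Dt n t + Real.sin (((n : ℝ) + 1) * t) := by unfold Dt; rw [Finset.sum_range_succ]
    rw [this, sum_Icc_symm_succ, ← ih]
    have s1 : Int.sign ((n:ℤ)+1) = 1 := Int.sign_eq_one_of_pos (by omega)
    have s2 : Int.sign (-((n:ℤ)+1)) = -1 := Int.sign_eq_neg_one_of_neg (by omega)
    rw [s1, s2]
    have h := ee_pair_sin ((n:ℤ)+1) t
    push_cast at h ⊢
    have h' : ee (↑n + 1) t = 2 * Complex.I * Complex.sin ((↑n + 1) * ↑t) + ee (-(↑n + 1)) t := by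
      rw [← h]; ring
    rw [h']
    field_simp
    ring

lemma ee_mul_int {γ : ℝ → ℂ} (hγ : IntegrableOn γ T1) (m : ℤ) : IntegrableOn (fun u => γ u * ee m u) T1 :=
  Integrable.mul_bdd (c := 1) hγ (ee_continuous m).aestronglyMeasurable
        (Eventually.of_forall (fun u => (ee_norm m u).le))

def cc (γ : ℝ → ℂ) (m : ℤ) : ℂ := ((Int.sign m : ℂ) / (2 * Complex.I)) * ∫ u in T1, γ u * ee (-m) u

lemma cj_cc {γ : ℝ → ℂ} (hγ : IntegrableOn γ T1) (n : ℕ) (x : ℝ) :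
    cj γ n x = ∑ m ∈ Finset.Icc (-(n:ℤ)) (n:ℤ), cc γ m * ee m x := by
  unfold cj cc
  have : ∀ u, γ u * (Dt n (x - u) : ℂ) = ∑ m ∈ Finset.Icc (-(n:ℤ)) (n:ℤ),
      (((Int.sign m : ℂ) / (2 * Complex.I)) * ee m x) * (γ u * ee (-m) u) := by
    intro u
    rw [Dt_ee, Finset.mul_sum]
    refine Finset.sum_congr rfl (fun m _ => ?_)
    rw [ee_sub]; ring
  simp only [this]
  rw [integral_finsetSum _ (fun m _ => (ee_mul_int hγ _).const_mul _)]
  refine Finset.sum_congr rfl (fun m _ => ?_)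
  rw [integral_const_mul]; ring

lemma bessel {γ : ℝ → ℂ} (hγ : IntegrableOn γ T1) (hγ2 : IntegrableOn (fun u => ‖γ u‖ ^ 2) T1) (s : Finset ℤ) :
    ∑ m ∈ s, ‖∫ u in T1, γ u * ee (-m) u‖ ^ 2 ≤ 2 * Real.pi * ∫ u in T1, ‖γ u‖ ^ 2 := by
  have hpi := Real.pi_pos
  set S := ∑ m ∈ s, ‖∫ u in T1, γ u * ee (-m) u‖ ^ 2 with hS
  have hS0 : 0 ≤ S := Finset.sum_nonneg (fun m _ => by positivity)
  set F : ℤ → ℂ := fun m => ∫ u in T1, γ u * ee (-m) u with hF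
  set A : ℝ → ℂ := fun u => ∑ m ∈ s, F m * ee m u with hA
  have hAc : Continuous A := by
    apply continuous_finsetSum; intro m _; exact continuous_const.mul (ee_continuous m)
  have hPA : ∫ u in T1, ‖A u‖ ^ 2 = 2 * Real.pi * S := parseval s F
  have hconj : ∀ u, (starRingEnd ℂ) (A u) = ∑ m ∈ s, (starRingEnd ℂ) (F m) * ee (-m) u := by
    intro u; rw [hA]; simp only; rw [map_sum]
    refine Finset.sum_congr rfl (fun m _ => by rw [map_mul, ee_conj])
  have hSA : (S : ℂ) = ∫ u in T1, γ u * (starRingEnd ℂ) (A u) := by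
    have : ∀ u, γ u * (starRingEnd ℂ) (A u) = ∑ m ∈ s, (starRingEnd ℂ) (F m) * (γ u * ee (-m) u) := by
      intro u; rw [hconj, Finset.mul_sum]; refine Finset.sum_congr rfl (fun m _ => by ring)
    simp only [this]
    rw [integral_finsetSum _ (fun m _ => (ee_mul_int hγ _).const_mul _), hS, Complex.ofReal_sum]
    refine Finset.sum_congr rfl (fun m _ => ?_)
    rw [integral_const_mul]
    change _ = (starRingEnd ℂ) (F m) * F m
    rw [mul_comm, Complex.mul_conj, Complex.normSq_eq_norm_sq]
  have iA : IntegrableOn (fun u => ‖A u‖ ^ 2 / (4 * Real.pi)) T1 := continuous_integrableOn_T1 (by fun_prop)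
  have iG : IntegrableOn (fun u => Real.pi * ‖γ u‖ ^ 2) T1 := hγ2.const_mul _
  have h1 : S ≤ ∫ u in T1, (Real.pi * ‖γ u‖ ^ 2 + ‖A u‖ ^ 2 / (4 * Real.pi)) := by
    have : S = ‖(S:ℂ)‖ := by rw [Complex.norm_real, Real.norm_of_nonneg hS0]
    rw [this, hSA]
    refine norm_integral_le_of_norm_le (iG.add iA) ?_
    refine Eventually.of_forall (fun u => ?_)
    rw [norm_mul, RCLike.norm_conj]
    have h4 : 0 ≤ (2 * Real.pi * ‖γ u‖ - ‖A u‖) ^ 2 / (4 * Real.pi) := by positivity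
    have h5 : (2 * Real.pi * ‖γ u‖ - ‖A u‖) ^ 2 / (4 * Real.pi) = Real.pi * ‖γ u‖ ^ 2 + ‖A u‖ ^ 2 / (4 * Real.pi) - ‖γ u‖ * ‖A u‖ := by
      field_simp; ring
    linarith
  rw [integral_add iG iA,
    integral_const_mul, integral_div, hPA] at h1
  have : 2 * Real.pi * S / (4 * Real.pi) = S / 2 := by field_simp; ring
  rw [this] at h1
  linarith

lemma conv_Dn (s : Finset ℤ) (c : ℤ → ℂ) (n : ℕ) (hs : Finset.Icc (-(n:ℤ)) (n:ℤ) ⊆ s) (x : ℝ) :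
    ∫ z in T1, (∑ m ∈ s, c m * ee m z) * Dn n (x - z) = 2 * Real.pi * ∑ m ∈ Finset.Icc (-(n:ℤ)) (n:ℤ), c m * ee m x := by
  have : ∀ z, (∑ m ∈ s, c m * ee m z) * Dn n (x - z) = ∑ k ∈ Finset.Icc (-(n:ℤ)) (n:ℤ), ∑ m ∈ s, (c m * ee k x) * ee (m - k) z := by
    intro z
    unfold Dn
    rw [mul_comm, Finset.sum_mul_sum]
    refine Finset.sum_congr rfl (fun k _ => Finset.sum_congr rfl (fun m _ => ?_))
    rw [ee_sub, sub_eq_add_neg, ← ee_mul]; ring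
  simp only [this]
  have hi : ∀ (c : ℂ) (k : ℤ), IntegrableOn (fun u => c * ee k u) T1 := fun c k =>
      continuous_integrableOn_T1 (continuous_const.mul (ee_continuous k))
  rw [integral_finsetSum _ (fun m _ => integrable_finsetSum _ (fun k _ => hi _ _)), Finset.mul_sum]
  refine Finset.sum_congr rfl (fun k hk => ?_)
  rw [integral_finsetSum _ (fun k _ => hi _ _), Finset.sum_eq_single k]
  · rw [integral_const_mul, ee_int, if_pos (sub_self k)]; push_cast; ring
  · intro m _ hm
    rw [integral_const_mul, ee_int, if_neg (by intro h; apply hm; omega), mul_zero]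
  · intro h; exact absurd (hs hk) h

/-- The good part : block means. -/
lemma good_mean {H : ℝ → ℂ} {s : Finset ℤ} {c : ℤ → ℂ} (hH : H = fun z => ∑ m ∈ s, c m * ee m z)
    {lam : ℝ} (hlam : 0 < lam) {x : ℝ} {N : ℕ} (hN : 0 < N)
    (hs : Finset.Icc (-(N:ℤ)) (N:ℤ) ⊆ s)
    (hkp : ∫ u in T1, ‖H u‖ ^ 2 * kp (1 / N) (x - u) ≤ 60 * lam ^ 2) :
    ‖∑ n ∈ Finset.range N, ∑ m ∈ Finset.Icc (-(n:ℤ)) (n:ℤ), c m * ee m x‖ ≤ 12 * N * lam := by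
  have hpi := Real.pi_pos
  have hN' : (0:ℝ) < N := by exact_mod_cast hN
  have hw : (0:ℝ) < 1 / N := by positivity
  have hHc : Continuous H := by
    rw [hH]; apply continuous_finsetSum; intro m _; exact continuous_const.mul (ee_continuous m)
  have hDc : ∀ n, Continuous (fun z => Dn n (x - z)) := by
    intro n; unfold Dn
    apply continuous_finsetSum; intro m _; exact (ee_continuous m).comp (by fun_prop)
  have h1 : (2 * Real.pi) * ∑ n ∈ Finset.range N, ∑ m ∈ Finset.Icc (-(n:ℤ)) (n:ℤ), c m * ee m x =
      ∫ z in T1, H z * FN N (x - z) := by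
    unfold FN
    simp only [Finset.mul_sum (Finset.range N)]
    have hi : ∀ n ∈ Finset.range N, IntegrableOn (fun z => H z * Dn n (x - z)) T1 :=
      fun n _ => continuous_integrableOn_T1 (hHc.mul (hDc n))
    rw [integral_finsetSum _ hi]
    refine Finset.sum_congr rfl (fun n hn => ?_)
    rw [hH, conv_Dn s c n _ x]
    rw [Finset.mem_range] at hn
    exact (Finset.Icc_subset_Icc (by omega) (by omega)).trans hs
  have hkc : Continuous (fun u => kp (1 / N) (x - u)) := (kp_continuous hw).comp (by fun_prop)
  have i1 : IntegrableOn (fun z => (N / lam) * (‖H z‖ ^ 2 * kp (1 / N) (x - z))) T1 :=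
    continuous_integrableOn_T1 (by fun_prop)
  have i2 : IntegrableOn (fun z => (N * lam) * kp (1 / N) (x - z)) T1 :=
    continuous_integrableOn_T1 (by fun_prop)
  have h2 : ‖∫ z in T1, H z * FN N (x - z)‖ ≤ ∫ z in T1, ((N / lam) * (‖H z‖ ^ 2 * kp (1 / N) (x - z)) + (N * lam) * kp (1 / N) (x - z)) := by
    refine norm_integral_le_of_norm_le (i1.add i2) (Eventually.of_forall (fun z => ?_))
    rw [norm_mul]
    have h3 := FN_bound hN (x - z)
    have h4 := kp_nonneg hw (x - z)
    set κ := kp (1 / N) (x - z)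
    have h5 : ‖H z‖ * ‖FN N (x - z)‖ ≤ ‖H z‖ * (2 * N * κ) := mul_le_mul_of_nonneg_left h3 (norm_nonneg _)
    have h6 : 0 ≤ N * κ / lam * (‖H z‖ - lam) ^ 2 := by positivity
    have h7 : N * κ / lam * (‖H z‖ - lam) ^ 2 = (N / lam) * (‖H z‖ ^ 2 * κ) + (N * lam) * κ - ‖H z‖ * (2 * N * κ) := by
      field_simp; ring
    linarith
  rw [integral_add i1 i2, integral_const_mul, integral_const_mul, ← h1, norm_mul] at h2
  have h8 := kp_int' hw x
  have h9 : ‖(2 * (Real.pi : ℂ))‖ = 2 * Real.pi := by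
    rw [norm_mul, Complex.norm_real, Real.norm_of_nonneg hpi.le]; simp
  rw [h9] at h2
  have h10 : (N / lam) * (∫ u in T1, ‖H u‖ ^ 2 * kp (1 / N) (x - u)) ≤ (N / lam) * (60 * lam ^ 2) :=
    mul_le_mul_of_nonneg_left hkp (by positivity)
  have h11 : (N / lam) * (60 * lam ^ 2) = 60 * (N * lam) := by field_simp
  have h12 : N * lam * (∫ x_1 in T1, kp (1 / N) (x - x_1)) ≤ N * lam * 10 := mul_le_mul_of_nonneg_left h8 (by positivity)
  set Z := ‖∑ n ∈ Finset.range N, ∑ m ∈ Finset.Icc (-(n:ℤ)) (n:ℤ), c m * ee m x‖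
  have hZ : 0 ≤ Z := norm_nonneg _
  have hNl : 0 < N * lam := by positivity
  have := Real.pi_gt_three
  nlinarith

def KN (N : ℕ) (t : ℝ) : ℝ := ∑ n ∈ Finset.range N, Dt n t

def KD (N : ℕ) (t : ℝ) : ℝ := ∑ n ∈ Finset.range N, ∑ m ∈ Finset.range n, ((m : ℝ) + 1) * Real.cos (((m : ℝ) + 1) * t)

lemma KN_continuous (N : ℕ) : Continuous (KN N) := by
  unfold KN; exact continuous_finsetSum _ (fun n _ => Dt_continuous n)

lemma KN_deriv (N : ℕ) (t : ℝ) : HasDerivAt (KN N) (KD N t) t := by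
  unfold KN KD
  apply HasDerivAt.fun_sum; intro n _
  unfold Dt
  apply HasDerivAt.fun_sum; intro m _
  have := ((hasDerivAt_id t).const_mul ((m:ℝ) + 1)).sin
  simp only [id, mul_one] at this
  rw [mul_comm]; exact this

lemma KN_closed (N : ℕ) (t : ℝ) : 4 * Real.sin (t / 2) ^ 2 * KN N t = N * Real.sin t - Real.sin (N * t) := by
  induction N with
  | zero => simp [KN]
  | succ N ih =>
    have h1 : KN (N+1) t = KN N t + Dt N t := by unfold KN; rw [Finset.sum_range_succ]
    have h2 := Dt_closed N t
    have e1 : (N:ℝ) * t = ((N:ℝ) + 1/2) * t - t / 2 := by ring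
    have e2 : ((N+1:ℕ):ℝ) * t = ((N:ℝ) + 1/2) * t + t / 2 := by push_cast; ring
    have e3 : Real.sin t = 2 * Real.sin (t/2) * Real.cos (t/2) := by
      rw [← Real.sin_two_mul]; congr 1; ring
    rw [h1, mul_add, ih, e2, e1, Real.sin_sub, Real.sin_add, e3]
    push_cast
    linear_combination 2 * Real.sin (t/2) * h2

lemma abs_sin_nat_mul (N : ℕ) (t : ℝ) : |Real.sin (N * t)| ≤ N * |Real.sin t| := by
  induction N with
  | zero => simp
  | succ N ih =>
    have e2 : ((N+1:ℕ):ℝ) * t = N * t + t := by push_cast; ring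
    rw [e2, Real.sin_add]
    refine (abs_add_le _ _).trans ?_
    rw [abs_mul, abs_mul]
    have h1 := Real.abs_cos_le_one t
    have h2 := Real.abs_cos_le_one (N * t)
    have := abs_nonneg (Real.sin t)
    have := abs_nonneg (Real.sin (N * t))
    push_cast
    nlinarith

lemma KD_bound (N : ℕ) (t : ℝ) : 4 * Real.sin (t / 2) ^ 2 * |KD N t| ≤ 6 * N := by
  have h1 : HasDerivAt (fun t => 4 * Real.sin (t / 2) ^ 2 * KN N t)
      ((4 * (2 * Real.sin (t/2) * (Real.cos (t/2) * (1/2)))) * KN N t + 4 * Real.sin (t/2) ^ 2 * KD N t) t := by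
    have h0 : HasDerivAt (fun t : ℝ => Real.sin (t/2)) (Real.cos (t/2) * (1/2)) t :=
      ((hasDerivAt_id t).div_const 2).sin
    have := ((h0.pow 2).const_mul 4).mul (KN_deriv N t)
    refine HasDerivAt.congr_deriv (f := fun t => 4 * Real.sin (t / 2) ^ 2 * KN N t) this ?_
    simp
  have h2 : HasDerivAt (fun t => N * Real.sin t - Real.sin (N * t)) (N * Real.cos t - Real.cos (N * t) * N) t := by
    have h3 := ((hasDerivAt_id t).const_mul (N:ℝ)).sin
    simp only [id, mul_one] at h3
    exact ((Real.hasDerivAt_sin t).const_mul _).sub h3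
  have h3 : (fun t => 4 * Real.sin (t / 2) ^ 2 * KN N t) = fun t => N * Real.sin t - Real.sin (N * t) := by
    funext t; exact KN_closed N t
  rw [h3] at h1
  have h4 := h1.unique h2
  have h5 := KN_closed N t
  have h6 := abs_sin_nat_mul N t
  have e3 : Real.sin t = 2 * Real.sin (t/2) * Real.cos (t/2) := by
    rw [← Real.sin_two_mul]; congr 1; ring
  have hc := Real.abs_cos_le_one (t/2)
  have hsn : |Real.sin t| ≤ 2 * |Real.sin (t/2)| := by
    rw [e3, abs_mul, abs_mul, abs_two]
    nlinarith [abs_nonneg (Real.sin (t/2))]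
  have hN : (0:ℝ) ≤ N := Nat.cast_nonneg N
  have h7 : 4 * |Real.sin (t/2)| ^ 2 * |KN N t| ≤ 4 * N * |Real.sin (t/2)| := by
    have : 4 * |Real.sin (t/2)| ^ 2 * |KN N t| = |4 * Real.sin (t / 2) ^ 2 * KN N t| := by
      rw [abs_mul, abs_mul, abs_of_pos (by norm_num : (0:ℝ) < 4), abs_pow]
    rw [this, h5]
    refine (abs_sub _ _).trans ?_
    rw [abs_mul, abs_of_nonneg hN]
    nlinarith
  by_cases hs : Real.sin (t/2) = 0
  · rw [hs]; simp
  have hs' : 0 < |Real.sin (t/2)| := abs_pos.mpr hs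
  have h8 : 4 * |Real.sin (t/2)| * |KN N t| ≤ 4 * N := by
    by_contra hc; push Not at hc
    nlinarith
  have h9 : 4 * Real.sin (t / 2) ^ 2 * |KD N t| = |N * Real.cos t - Real.cos (N * t) * N - (4 * Real.sin (t/2) * KN N t) * Real.cos (t/2)| := by
    rw [← h4, ← abs_of_nonneg (by positivity : 0 ≤ 4 * Real.sin (t / 2) ^ 2), ← abs_mul,
      abs_of_nonneg (by positivity : 0 ≤ 4 * Real.sin (t / 2) ^ 2)]
    congr 1; ring
  rw [h9]
  refine (abs_sub _ _).trans ?_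
  have a1 : |N * Real.cos t - Real.cos (N * t) * N| ≤ 2 * N := by
    rw [abs_le]
    constructor <;> nlinarith [Real.cos_le_one t, Real.neg_one_le_cos t, Real.cos_le_one (N * t), Real.neg_one_le_cos (N * t)]
  have a2 : |(4 * Real.sin (t/2) * KN N t) * Real.cos (t/2)| ≤ 4 * N := by
    rw [abs_mul, abs_mul, abs_mul, abs_of_pos (by norm_num : (0:ℝ) < 4)]
    have : 0 ≤ 4 * |Real.sin (t/2)| * |KN N t| := by positivity
    nlinarith
  linarith

lemma KN_lip {q : ℝ × ℝ} {x : ℝ} (hq : 0 < q.2) (he : eQ q x ≤ 1 / 2) (N : ℕ) {u : ℝ} (hu : u ∈ iv q) :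
    |KN N (x - u) - KN N (x - cq q)| ≤ 3 * N * (q.2 / (q.2 ^ 2 + Real.sin ((x - cq q) / 2) ^ 2)) := by
  have hD := kp_den_pos hq (x - cq q)
  have hc : cq q ∈ iv q := by unfold iv cq; constructor <;> simp <;> linarith
  have := Convex.norm_image_sub_le_of_norm_hasDerivWithin_le (f := fun u => KN N (x - u)) (f' := fun u => KD N (x - u) * (-1))
    (s := iv q) (C := 6 * N / (q.2 ^ 2 + Real.sin ((x - cq q) / 2) ^ 2)) (x := cq q) (y := u)
    (fun v hv => ((KN_deriv N (x - v)).comp v ((hasDerivAt_id v).const_sub x)).hasDerivWithinAt)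
    (fun v hv => by
      have h1 := s_lower hq he hv
      have h2 := KD_bound N (x - v)
      rw [mul_neg_one, norm_neg, Real.norm_eq_abs, le_div_iff₀ hD]
      have := abs_nonneg (KD N (x - v))
      nlinarith) (convex_Ico _ _) hc hu
  rw [Real.norm_eq_abs, Real.norm_eq_abs] at this
  refine this.trans ?_
  have h3 := iv_cq hu
  have h4 : 6 * N / (q.2 ^ 2 + Real.sin ((x - cq q) / 2) ^ 2) * |u - cq q| ≤ 6 * N / (q.2 ^ 2 + Real.sin ((x - cq q) / 2) ^ 2) * (q.2 / 2) := by
    gcongr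
  refine h4.trans (le_of_eq ?_)
  field_simp; ring

def avq (g : ℝ → ℂ) (q : ℝ × ℝ) : ℂ := ((1 / q.2 : ℝ) : ℂ) * ∫ u in iv q, g u

lemma iv_vol {q : ℝ × ℝ} (hq : 0 < q.2) : volume.real (iv q) = q.2 := by
  unfold iv; rw [Real.volume_real_Ico_of_le (by linarith)]; ring

lemma iv_const_int (q : ℝ × ℝ) (c : ℂ) : IntegrableOn (fun _ : ℝ => c) (iv q) := by
  apply (integrableOn_const_iff (by simp)).mpr
  right; unfold iv; simp

lemma iv_intC {v : ℝ → ℂ} (hv : Continuous v) (q : ℝ × ℝ) : IntegrableOn v (iv q) :=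
  (hv.integrableOn_Icc).mono_set Ico_subset_Icc_self

lemma avq_norm {g : ℝ → ℂ} {q : ℝ × ℝ} (hq : 0 < q.2) : q.2 * ‖avq g q‖ ≤ ∫ u in iv q, ‖g u‖ := by
  unfold avq
  rw [norm_mul, Complex.norm_real, Real.norm_of_nonneg (by positivity), ← mul_assoc, mul_one_div_cancel hq.ne', one_mul]
  exact norm_integral_le_integral_norm _

lemma avq_zero {g : ℝ → ℂ} (hg : Continuous g) {q : ℝ × ℝ} (hq : 0 < q.2) : ∫ u in iv q, (avq g q - g u) = 0 := by
  rw [integral_sub (iv_const_int q _) (iv_intC hg q), setIntegral_const, iv_vol hq]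
  unfold avq
  rw [Complex.real_smul, ← mul_assoc, ← Complex.ofReal_mul, mul_one_div_cancel hq.ne']; simp

def gam (g : ℝ → ℂ) (Q : Finset (ℝ × ℝ)) (u : ℝ) : ℂ :=
  g u + ∑ q ∈ Q, (iv q).indicator (fun u => avq g q - g u) u

lemma gam_on {g : ℝ → ℂ} (hg : Continuous g) {lam : ℝ} (hlam : 0 < lam) {J : ℕ} {Q : Finset (ℝ × ℝ)}
  (h : CZ (fun u => ‖g u‖) lam J (-Real.pi) (2 * Real.pi) Q) {q : ℝ × ℝ} (hq : q ∈ Q) {u : ℝ} (hu : u ∈ iv q) : gam g Q u = avq g q := by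
  unfold gam
  rw [Finset.sum_eq_single q]
  · rw [indicator_of_mem hu]; ring
  · intro q' hq' hne
    exact indicator_of_notMem (fun hu' => (Set.disjoint_left.mp (h.disj q' hq' q hq hne) hu' hu)) _
  · intro hh; exact absurd hq hh

lemma gam_off {g : ℝ → ℂ} (hg : Continuous g) {lam : ℝ} (hlam : 0 < lam) {J : ℕ} {Q : Finset (ℝ × ℝ)}
  (h : CZ (fun u => ‖g u‖) lam J (-Real.pi) (2 * Real.pi) Q) {u : ℝ} (hu : ∀ q ∈ Q, u ∉ iv q) : gam g Q u = g u := by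
  unfold gam
  rw [Finset.sum_eq_zero, add_zero]
  intro q hq; exact indicator_of_notMem (hu q hq) _

lemma gam_int {g : ℝ → ℂ} (hg : Continuous g) {lam : ℝ} (hlam : 0 < lam) {J : ℕ} {Q : Finset (ℝ × ℝ)}
  (h : CZ (fun u => ‖g u‖) lam J (-Real.pi) (2 * Real.pi) Q) : IntegrableOn (gam g Q) T1 := by
  unfold gam
  refine (continuous_integrableOn_T1 hg).add (integrable_finsetSum _ (fun q _ => ?_))
  exact (continuous_integrableOn_T1 (continuous_const.sub hg)).indicator (iv_meas q)

lemma gam_le {g : ℝ → ℂ} (hg : Continuous g) {lam : ℝ} (hlam : 0 < lam) {J : ℕ} {Q : Finset (ℝ × ℝ)}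
  (h : CZ (fun u => ‖g u‖) lam J (-Real.pi) (2 * Real.pi) Q) {u : ℝ} (hu : u ∈ T1) : ‖gam g Q u‖ ≤ 2 * lam := by
  by_cases hc : ∀ q ∈ Q, u ∉ iv q
  · rw [gam_off hg hlam h hc]; exact h.off u (by rw [T1_iv]; exact hu) hc
  · push Not at hc
    obtain ⟨q, hq, hu⟩ := hc
    rw [gam_on hg hlam h hq hu]
    have h1 := avq_norm (g := g) (h.pos q hq)
    have h2 := h.upper q hq
    have h3 := h.pos q hq
    by_contra hcon
    push Not at hcon
    nlinarith

lemma gam_L1 {g : ℝ → ℂ} (hg : Continuous g) {lam : ℝ} (hlam : 0 < lam) {J : ℕ} {Q : Finset (ℝ × ℝ)}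
  (h : CZ (fun u => ‖g u‖) lam J (-Real.pi) (2 * Real.pi) Q) : ∫ u in T1, ‖gam g Q u‖ ≤ ∫ u in T1, ‖g u‖ := by
  rw [CZ_split h (gam_int hg hlam h).norm, CZ_split h (continuous_integrableOn_T1 hg).norm]
  apply add_le_add
  · apply Finset.sum_le_sum
    intro q hq
    rw [setIntegral_congr_fun (iv_meas q) (g := fun _ => ‖avq g q‖) (fun u hu => by simp only; rw [gam_on hg hlam h hq hu]),
      setIntegral_const, iv_vol (h.pos q hq)]
    exact avq_norm (h.pos q hq)
  · have hm : MeasurableSet (⋃ q ∈ Q, iv q) := Finset.measurableSet_biUnion _ (fun q _ => iv_meas q)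
    rw [setIntegral_congr_fun (T1_meas.diff hm) (g := fun u => ‖g u‖) (fun u hu => by
      simp only; rw [gam_off hg hlam h (fun q hq hu' => hu.2 (mem_biUnion hq hu'))])]

lemma gam_sq_int {g : ℝ → ℂ} (hg : Continuous g) {lam : ℝ} (hlam : 0 < lam) {J : ℕ} {Q : Finset (ℝ × ℝ)}
  (h : CZ (fun u => ‖g u‖) lam J (-Real.pi) (2 * Real.pi) Q) : IntegrableOn (fun u => ‖gam g Q u‖ ^ 2) T1 := by
  have h1 := gam_int hg hlam h
  refine Integrable.mono' (g := fun u => 2 * lam * ‖gam g Q u‖) (h1.norm.const_mul _) (h1.norm.aestronglyMeasurable.pow 2) ?_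
  rw [ae_restrict_iff' T1_meas]
  refine Eventually.of_forall (fun u hu => ?_)
  rw [Real.norm_of_nonneg (by positivity), sq]
  exact mul_le_mul_of_nonneg_right (gam_le hg hlam h hu) (norm_nonneg _)

lemma gam_sq {g : ℝ → ℂ} (hg : Continuous g) {lam : ℝ} (hlam : 0 < lam) {J : ℕ} {Q : Finset (ℝ × ℝ)}
  (h : CZ (fun u => ‖g u‖) lam J (-Real.pi) (2 * Real.pi) Q) : ∫ u in T1, ‖gam g Q u‖ ^ 2 ≤ 2 * lam * ∫ u in T1, ‖g u‖ := by
  have h1 := gam_int hg hlam h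
  have : ∫ u in T1, ‖gam g Q u‖ ^ 2 ≤ ∫ u in T1, 2 * lam * ‖gam g Q u‖ := by
    apply setIntegral_mono_on (gam_sq_int hg hlam h) (h1.norm.const_mul _) T1_meas
    intro u hu
    rw [sq]
    exact mul_le_mul_of_nonneg_right (gam_le hg hlam h hu) (norm_nonneg _)
  rw [integral_const_mul] at this
  exact this.trans (mul_le_mul_of_nonneg_left (gam_L1 hg hlam h) (by positivity))

lemma bad_mean {g : ℝ → ℂ} (hg : Continuous g) {lam : ℝ} (hlam : 0 < lam) {J : ℕ} {Q : Finset (ℝ × ℝ)}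
  (h : CZ (fun u => ‖g u‖) lam J (-Real.pi) (2 * Real.pi) Q) {x : ℝ} (hx : EQ Q x ≤ 1 / 2) (N : ℕ) :
    ‖∫ u in T1, (gam g Q u - g u) * (KN N (x - u) : ℂ)‖ ≤ 6 * N * lam := by
  have hKc : Continuous (fun u => (KN N (x - u) : ℂ)) :=
    Complex.continuous_ofReal.comp ((KN_continuous N).comp (by fun_prop))
  have e1 : ∀ u, (gam g Q u - g u) * (KN N (x - u) : ℂ) = ∑ q ∈ Q, (iv q).indicator (fun u => (avq g q - g u) * (KN N (x - u) : ℂ)) u := by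
    intro u
    unfold gam
    rw [add_sub_cancel_left, Finset.sum_mul]
    refine Finset.sum_congr rfl (fun q _ => ?_)
    by_cases hu : u ∈ iv q
    · rw [indicator_of_mem hu, indicator_of_mem hu]
    · rw [indicator_of_notMem hu, indicator_of_notMem hu, zero_mul]
  simp only [e1]
  have hc : ∀ q, Continuous (fun u => (avq g q - g u) * (KN N (x - u) : ℂ)) := fun q => by fun_prop
  rw [integral_finsetSum _ (fun q _ => (continuous_integrableOn_T1 (hc q)).indicator (iv_meas q))]
  refine (norm_sum_le _ _).trans ?_
  have hb : ∀ q ∈ Q, ‖∫ u in T1, (iv q).indicator (fun u => (avq g q - g u) * (KN N (x - u) : ℂ)) u‖ ≤ 12 * lam * N * eQ q x := by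
    intro q hq
    have hqp := h.pos q hq
    have heq : eQ q x ≤ 1 / 2 := (Finset.single_le_sum (fun q _ => eQ_nonneg q x) hq).trans hx
    rw [setIntegral_indicator (iv_meas q), inter_eq_right.mpr (by rw [← T1_iv]; exact h.sub q hq)]
    have e2 : ∫ u in iv q, (avq g q - g u) * (KN N (x - u) : ℂ) = ∫ u in iv q, (avq g q - g u) * ((KN N (x - u) - KN N (x - cq q) : ℝ) : ℂ) := by
      have i1 : IntegrableOn (fun u => (avq g q - g u) * (KN N (x - u) : ℂ)) (iv q) := iv_intC (hc q) q
      have i2 : IntegrableOn (fun u => (avq g q - g u) * (KN N (x - cq q) : ℂ)) (iv q) := iv_intC (by fun_prop) q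
      have e3 : ∀ u, (avq g q - g u) * ((KN N (x - u) - KN N (x - cq q) : ℝ) : ℂ) = (avq g q - g u) * (KN N (x - u) : ℂ) - (avq g q - g u) * (KN N (x - cq q) : ℂ) := by
        intro u; push_cast; ring
      simp only [e3]
      rw [integral_sub i1 i2, integral_mul_const, avq_zero hg hqp, zero_mul, sub_zero]
    rw [e2]
    set L := 3 * N * (q.2 / (q.2 ^ 2 + Real.sin ((x - cq q) / 2) ^ 2)) with hL
    have hL0 : 0 ≤ L := by rw [hL]; positivity
    have i3 : IntegrableOn (fun u => ‖g u‖) (iv q) := iv_int hg.norm q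
    have i4 : IntegrableOn (fun _ : ℝ => ‖avq g q‖) (iv q) := iv_int continuous_const q
    have h3 : ‖∫ u in iv q, (avq g q - g u) * ((KN N (x - u) - KN N (x - cq q) : ℝ) : ℂ)‖ ≤ ∫ u in iv q, (‖avq g q‖ + ‖g u‖) * L := by
      refine norm_integral_le_of_norm_le ((i4.add i3).mul_const L) ?_
      rw [ae_restrict_iff' (iv_meas q)]
      refine Eventually.of_forall (fun u hu => ?_)
      rw [norm_mul, Complex.norm_real, Real.norm_eq_abs]
      exact mul_le_mul (norm_sub_le _ _) (KN_lip hqp heq N hu) (abs_nonneg _) (by positivity)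
    rw [integral_mul_const, integral_add i4 i3, setIntegral_const, iv_vol hqp] at h3
    have h4 := avq_norm (g := g) hqp
    have h5 := h.upper q hq
    have h6 : (q.2 • ‖avq g q‖ + ∫ u in iv q, ‖g u‖) * L ≤ (4 * lam * q.2) * L := by
      apply mul_le_mul_of_nonneg_right _ hL0
      rw [smul_eq_mul]; linarith
    refine h3.trans (h6.trans (le_of_eq ?_))
    rw [hL]; unfold eQ; ring
  refine (Finset.sum_le_sum hb).trans ?_
  rw [← Finset.mul_sum]
  have : 12 * lam * N * EQ Q x ≤ 12 * lam * N * (1/2) := by gcongr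
  unfold EQ at this
  linarith


lemma cj_sum_KN {g : ℝ → ℂ} (hg : IntegrableOn g T1) (N : ℕ) (x : ℝ) :
    ∑ n ∈ Finset.range N, cj g n x = ∫ u in T1, g u * (KN N (x - u) : ℂ) := by
  unfold cj
  rw [← integral_finsetSum]
  · unfold KN; simp only [Complex.ofReal_sum, Finset.mul_sum]
  · intro n _
    refine Integrable.mul_bdd (c := n) hg (Complex.continuous_ofReal.comp ((Dt_continuous n).comp (by fun_prop))).aestronglyMeasurable (Eventually.of_forall (fun u => ?_))
    rw [Complex.norm_real]; exact abs_Dt_le n _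

lemma thm1D {g : ℝ → ℂ} (hg : Continuous g) {lam : ℝ} (hlam : 0 < lam) (N0 : ℕ) :
    ∃ X : Set ℝ, volume X ≤ ENNReal.ofReal (420 * (∫ u in T1, ‖g u‖) / lam) ∧ ∀ x ∈ T1, x ∉ X →
      (∀ j ≤ N0, ∀ b, ∃ α : ℂ, ∑ l ∈ Finset.range (2 ^ j), ‖cj g (b + l) x - α‖ ^ 2 ≤ 2 ^ j * (1200 * lam) ^ 2) ∧
      (∀ N, 0 < N → N ≤ 2 ^ N0 → ‖∑ n ∈ Finset.range N, cj g n x‖ ≤ 18 * N * lam) := by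
  have hpi := Real.pi_pos
  have hpi3 := Real.pi_gt_three
  have hpi4 := Real.pi_lt_d4
  set G := ∫ u in T1, ‖g u‖ with hG
  have hG0 : 0 ≤ G := integral_nonneg (fun u => norm_nonneg _)
  by_cases hbig : lam < Real.pi * G
  · refine ⟨T1, ?_, fun x hx hx' => absurd hx hx'⟩
    unfold T1; rw [Real.volume_Ico]
    apply ENNReal.ofReal_le_ofReal
    rw [le_div_iff₀ hlam]
    nlinarith
  push Not at hbig
  obtain ⟨Q, J, hJ, h⟩ := CZ_circle hg.norm (fun u => norm_nonneg (g u)) hlam N0 (by rw [← hG]; nlinarith)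
  have hgi := gam_int hg hlam h
  have hg2 := gam_sq_int hg hlam h
  have hb2 := gam_sq hg hlam h
  rw [← hG] at hb2
  set s : Finset ℤ := Finset.Icc (-((2 ^ N0 : ℕ) : ℤ)) ((2 ^ N0 : ℕ) : ℤ) with hs
  set H : ℝ → ℂ := fun z => ∑ m ∈ s, cc (gam g Q) m * ee m z with hH
  have hHc : Continuous H := by
    apply continuous_finsetSum; intro m _; exact continuous_const.mul (ee_continuous m)
  have hH2 : ∫ u in T1, ‖H u‖ ^ 2 ≤ 2 * Real.pi ^ 2 * lam * G := by
    have h1 := bessel hgi hg2 s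
    have h2 : ∑ m ∈ s, ‖cc (gam g Q) m‖ ^ 2 ≤ (1/4) * ∑ m ∈ s, ‖∫ u in T1, gam g Q u * ee (-m) u‖ ^ 2 := by
      rw [Finset.mul_sum]
      apply Finset.sum_le_sum
      intro m _
      unfold cc
      rw [norm_mul, mul_pow]
      apply mul_le_mul_of_nonneg_right _ (by positivity)
      rw [norm_div, norm_mul, Complex.norm_I]
      have : ‖((Int.sign m : ℤ) : ℂ)‖ ≤ 1 := by
        rcases lt_trichotomy m 0 with hm | hm | hm
        · rw [Int.sign_eq_neg_one_of_neg hm]; simp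
        · rw [hm]; simp
        · rw [Int.sign_eq_one_of_pos hm]; simp
      have h0 := norm_nonneg ((Int.sign m : ℤ) : ℂ)
      simp only [Complex.norm_ofNat, mul_one]
      rw [div_pow]
      have : ‖((Int.sign m : ℤ) : ℂ)‖ ^ 2 ≤ 1 := pow_le_one₀ h0 this
      rw [show (2:ℝ) ^ 2 = 4 by norm_num]; linarith
    have h3 : ∫ u in T1, ‖H u‖ ^ 2 = 2 * Real.pi * ∑ m ∈ s, ‖cc (gam g Q) m‖ ^ 2 := parseval s _
    rw [h3]
    have h4 : 2 * Real.pi * ∑ m ∈ s, ‖cc (gam g Q) m‖ ^ 2 ≤ 2 * Real.pi * ((1/4) * (2 * Real.pi * (2 * lam * G))) := by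
      apply mul_le_mul_of_nonneg_left _ (by positivity)
      refine h2.trans ?_
      apply mul_le_mul_of_nonneg_left _ (by norm_num)
      exact h1.trans (mul_le_mul_of_nonneg_left hb2 (by positivity))
    refine h4.trans (le_of_eq (by ring))
  have hl2 : 0 < lam ^ 2 := by positivity
  have hv2 : Continuous (fun u => ‖H u‖ ^ 2) := hHc.norm.pow 2
  have hv20 : ∀ u, 0 ≤ (fun u => ‖H u‖ ^ 2) u := fun u => by positivity
  obtain ⟨Q2, J2, -, h'⟩ := CZ_circle hv2 hv20 hl2 0 (by
    refine hH2.trans ?_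
    have : 2 * Real.pi * lam * (Real.pi * G) ≤ 2 * Real.pi * lam * lam := mul_le_mul_of_nonneg_left hbig (by positivity)
    linarith)
  refine ⟨{x | x ∈ T1 ∧ 1 / 2 < EQ Q x} ∪ {x | x ∈ T1 ∧ 1 / 2 < EQ Q2 x}, ?_, ?_⟩
  · refine (measure_union_le _ _).trans ?_
    have e1 := EQ_meas hg.norm (fun u => norm_nonneg (g u)) hlam h
    have e2 := EQ_meas hv2 hv20 hl2 h'
    refine (add_le_add e1 e2).trans ?_
    rw [← hG, ← ENNReal.ofReal_add (by positivity) (by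
      apply div_nonneg _ hl2.le
      have : 0 ≤ ∫ u in T1, ‖H u‖ ^ 2 := integral_nonneg hv20
      linarith)]
    apply ENNReal.ofReal_le_ofReal
    have e3 : 20 * (∫ u in T1, ‖H u‖ ^ 2) / lam ^ 2 ≤ 20 * (2 * Real.pi ^ 2 * lam * G) / lam ^ 2 := by gcongr
    have e4 : 20 * (2 * Real.pi ^ 2 * lam * G) / lam ^ 2 = 40 * Real.pi ^ 2 * G / lam := by field_simp; ring
    have e5 : 40 * Real.pi ^ 2 * G / lam ≤ 400 * G / lam := by
      gcongr; nlinarith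
    have e6 : 20 * G / lam + 400 * G / lam = 420 * G / lam := by ring
    linarith
  · intro x hx hnx
    simp only [mem_union, mem_setOf_eq, not_or, not_and, not_lt] at hnx
    have hx1 := hnx.1 hx
    have hx2 := hnx.2 hx
    refine ⟨fun j hj b => osc_block hg hlam h hx1 (hj.trans hJ) b, fun N hN hN0 => ?_⟩
    have hN' : (0:ℝ) < N := by exact_mod_cast hN
    have hkp := CZ_kp hv2 hv20 hl2 h' hx2 (w := 1 / N) (by positivity)
    have hgm := good_mean hH hlam hN (x := x) (by
      apply Finset.Icc_subset_Icc
      · simp only [neg_le_neg_iff]; exact_mod_cast hN0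
      · exact_mod_cast hN0) hkp
    have hbm := bad_mean hg hlam h hx1 N
    have hKc : Continuous (fun u => (KN N (x - u) : ℂ)) :=
      Complex.continuous_ofReal.comp ((KN_continuous N).comp (by fun_prop))
    have i1 : IntegrableOn (fun u => gam g Q u * (KN N (x - u) : ℂ)) T1 := by
      refine Integrable.mul_bdd (c := ∑ n ∈ Finset.range N, (n:ℝ)) hgi hKc.aestronglyMeasurable (Eventually.of_forall (fun u => ?_))
      rw [Complex.norm_real, Real.norm_eq_abs]; unfold KN
      exact (Finset.abs_sum_le_sum_abs _ _).trans (Finset.sum_le_sum (fun n _ => abs_Dt_le n _))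
    have i2 : IntegrableOn (fun u => g u * (KN N (x - u) : ℂ)) T1 := continuous_integrableOn_T1 (by fun_prop)
    have e : ∑ n ∈ Finset.range N, cj g n x = (∑ n ∈ Finset.range N, cj (gam g Q) n x) - ∫ u in T1, (gam g Q u - g u) * (KN N (x - u) : ℂ) := by
      rw [cj_sum_KN (continuous_integrableOn_T1 hg), cj_sum_KN hgi]
      simp only [sub_mul]
      rw [integral_sub i1 i2]; ring
    rw [e]
    refine (norm_sub_le _ _).trans ?_
    simp only [cj_cc hgi]
    linarith

lemma T2_meas : MeasurableSet T2 := T1_meas.prod T1_meas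

lemma T2_restrict : (volume : Measure (ℝ × ℝ)).restrict T2 = (volume.restrict T1).prod (volume.restrict T1) := by
  rw [T2, Measure.prod_restrict]; rfl

lemma T2_fin : volume T2 < ⊤ := by
  rw [T2, Measure.volume_eq_prod, Measure.prod_prod]
  exact ENNReal.mul_lt_top T1_vol_lt T1_vol_lt

lemma T1_volr : volume.real T1 = 2 * Real.pi := by
  unfold T1; rw [Real.volume_real_Ico_of_le (by linarith [Real.pi_pos])]; ring

lemma T2_volr : volume.real T2 = 4 * Real.pi ^ 2 := by
  rw [T2, Measure.volume_eq_prod, measureReal_def, Measure.prod_prod, ENNReal.toReal_mul, ← measureReal_def, T1_volr]; ring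

instance : IsFiniteMeasure (volume.restrict T1) := ⟨by rw [Measure.restrict_apply_univ]; exact T1_vol_lt⟩
instance : IsFiniteMeasure (volume.restrict T2) := ⟨by rw [Measure.restrict_apply_univ]; exact T2_fin⟩

lemma continuous_integrableOn_T2 {E : Type*} [NormedAddCommGroup E] {F : ℝ × ℝ → E} (hF : Continuous F) : IntegrableOn F T2 := by
  have : IntegrableOn F (Icc (-Real.pi) Real.pi ×ˢ Icc (-Real.pi) Real.pi) :=
    hF.continuousOn.integrableOn_compact (isCompact_Icc.prod isCompact_Icc)
  exact this.mono_set (prod_mono Ico_subset_Icc_self Ico_subset_Icc_self)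

lemma T2_int_eq {F : ℝ × ℝ → ℂ} (hF : IntegrableOn F T2) : ∫ p in T2, F p = ∫ x in T1, ∫ y in T1, F (x, y) := by
  have h2 : Integrable F ((volume.restrict T1).prod (volume.restrict T1)) := by rw [← T2_restrict]; exact hF
  rw [T2_restrict, integral_prod _ h2]

lemma T1_shift {F : ℝ → ℂ} (hF : ∀ x, F (x + 2 * Real.pi) = F x) (a : ℝ) : ∫ x in T1, F (x + a) = ∫ x in T1, F x := by
  rw [setT1_eq_C, setT1_eq_C, intervalIntegral.integral_comp_add_right]
  have := Function.Periodic.intervalIntegral_add_eq (f := F) (T := 2 * Real.pi) hF (-Real.pi + a) (-Real.pi)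
  rw [show -Real.pi + a + 2 * Real.pi = Real.pi + a by ring, show -Real.pi + 2 * Real.pi = Real.pi by ring] at this
  exact this

lemma T2_shift {F : ℝ × ℝ → ℂ} (hc : Continuous F) (h1 : ∀ x y, F (x + 2 * Real.pi, y) = F (x, y))
    (h2 : ∀ x y, F (x, y + 2 * Real.pi) = F (x, y)) (a b : ℝ) :
    ∫ p in T2, F (p.1 + a, p.2 + b) = ∫ p in T2, F p := by
  have hc2 : Continuous (fun p : ℝ × ℝ => F (p.1 + a, p.2 + b)) := by fun_prop
  rw [T2_int_eq (continuous_integrableOn_T2 hc2), T2_int_eq (continuous_integrableOn_T2 hc)]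
  simp only
  have : ∀ x, ∫ y in T1, F (x + a, y + b) = ∫ y in T1, F (x + a, y) := fun x =>
    T1_shift (F := fun y => F (x + a, y)) (fun y => h2 _ _) b
  simp only [this]
  exact T1_shift (F := fun x => ∫ y in T1, F (x, y)) (fun x => by simp only [h1]) a

/-- characters on the two-torus -/
def ch (p : ℤ × ℤ) (u : ℝ × ℝ) : ℂ := ee p.1 u.1 * ee p.2 u.2

lemma ch_continuous (p : ℤ × ℤ) : Continuous (ch p) := by
  unfold ch; exact ((ee_continuous _).comp continuous_fst).mul ((ee_continuous _).comp continuous_snd)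

lemma ch_norm (p : ℤ × ℤ) (u : ℝ × ℝ) : ‖ch p u‖ = 1 := by
  unfold ch; rw [norm_mul, ee_norm, ee_norm, one_mul]

lemma ch_conj (p : ℤ × ℤ) (u : ℝ × ℝ) : (starRingEnd ℂ) (ch p u) = ch (-p) u := by
  unfold ch; rw [map_mul, ee_conj, ee_conj]; rfl

lemma ch_shift (e : ℤ) (p : ℤ × ℤ) (u : ℝ × ℝ) (θ : ℝ) : ch p (u.1 + θ, u.2 + e * θ) = ch p u * ee (p.1 + e * p.2) θ := by
  unfold ch; simp only
  rw [ee_add, ee_add]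
  have : ee p.2 (e * θ) = ee (e * p.2) θ := by unfold ee; congr 1; push_cast; ring
  rw [this, ← ee_mul]; ring

lemma ee_pow {j : ℤ} (hj : 0 ≤ j) (θ : ℝ) : ee j θ = (circleMap 0 1 θ) ^ j.toNat := by
  unfold ee circleMap
  rw [Complex.ofReal_one, one_mul, zero_add, ← Complex.exp_nat_mul]
  congr 1
  have : ((j.toNat : ℕ) : ℂ) = (j : ℂ) := by
    have := Int.toNat_of_nonneg hj
    exact_mod_cast congrArg (fun z : ℤ => (z : ℂ)) this
  rw [this]; ring

lemma trig_sym {S : Finset (ℤ × ℤ)} (hS : ∀ p ∈ S, -p ∈ S) {a : ℤ × ℤ → ℂ} {η : ℝ}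
    (ha : ∀ p, (starRingEnd ℂ) (a p) = η * a (-p)) (u : ℝ × ℝ) :
    (starRingEnd ℂ) (∑ p ∈ S, a p * ch p u) = η * ∑ p ∈ S, a p * ch p u := by
  rw [map_sum, Finset.mul_sum]
  refine Finset.sum_nbij' (fun p => -p) (fun p => -p) hS hS (fun p _ => neg_neg p) (fun p _ => neg_neg p) (fun p _ => ?_)
  rw [map_mul, ha, ch_conj]; ring

lemma mean_val {P : ℂ → ℂ} (hP : Differentiable ℂ P) : ∫ θ in (0:ℝ)..(2 * Real.pi), P (circleMap 0 1 θ) = (2 * Real.pi : ℝ) * P 0 := by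
  have := DiffContOnCl.circleAverage (f := P) (c := 0) (R := 1) (hP.diffContOnCl)
  unfold Real.circleAverage at this
  rw [← this, Complex.real_smul]
  have hpi : ((2 * Real.pi : ℝ) : ℂ) ≠ 0 := by exact_mod_cast (by positivity : (2 * Real.pi : ℝ) ≠ 0)
  rw [← mul_assoc, ← Complex.ofReal_mul, mul_inv_cancel₀ (by positivity)]; simp

def sgc (e : ℤ) (p : ℤ × ℤ) : ℝ := ((p.1 + e * p.2).sign : ℝ)

lemma sgc_neg (e : ℤ) (p : ℤ × ℤ) : sgc e (-p) = - sgc e p := by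
  unfold sgc
  rw [Prod.fst_neg, Prod.snd_neg, show -p.1 + e * -p.2 = -(p.1 + e * p.2) by ring, Int.sign_neg]; push_cast; rfl

lemma exp_mean (e : ℤ) (S : Finset (ℤ × ℤ)) (a : ℤ × ℤ → ℂ) (κ : ℂ) :
    ∫ u in T2, Complex.exp (κ * ∑ p ∈ S, ((1 + sgc e p : ℝ) : ℂ) * a p * ch p u) =
    ∫ u in T2, Complex.exp (κ * ∑ p ∈ S, (if p.1 + e * p.2 = 0 then a p else 0) * ch p u) := by
  have hpi := Real.pi_pos
  set h : ℝ × ℝ → ℂ := fun u => Complex.exp (κ * ∑ p ∈ S, ((1 + sgc e p : ℝ) : ℂ) * a p * ch p u) with hh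
  have hc : Continuous h := by
    rw [hh]; apply Complex.continuous_exp.comp
    apply continuous_const.mul; apply continuous_finsetSum; intro p _; exact continuous_const.mul (ch_continuous p)
  have hs : ∀ θ : ℝ, ∫ u in T2, h (u.1 + θ, u.2 + e * θ) = ∫ u in T2, h u := fun θ =>
    T2_shift hc (fun x y => by simp only [hh, ch, ee_periodic]) (fun x y => by simp only [hh, ch, ee_periodic]) _ _
  have hp : ∀ u : ℝ × ℝ, ∫ θ in (0:ℝ)..(2 * Real.pi), h (u.1 + θ, u.2 + e * θ) =
      (2 * Real.pi : ℝ) * Complex.exp (κ * ∑ p ∈ S, (if p.1 + e * p.2 = 0 then a p else 0) * ch p u) := by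
    intro u
    set P : ℂ → ℂ := fun z => Complex.exp (κ * ∑ p ∈ S, ((1 + sgc e p : ℝ) : ℂ) * a p * ch p u * z ^ (p.1 + e * p.2).toNat) with hP
    have hPd : Differentiable ℂ P := by rw [hP]; fun_prop
    have e1 : ∀ θ : ℝ, h (u.1 + θ, u.2 + e * θ) = P (circleMap 0 1 θ) := by
      intro θ
      simp only [hh, hP]
      congr 2
      refine Finset.sum_congr rfl (fun p _ => ?_)
      rw [ch_shift]
      by_cases hj : 0 ≤ p.1 + e * p.2
      · rw [ee_pow hj]; ring
      · have : sgc e p = -1 := by unfold sgc; rw [Int.sign_eq_neg_one_of_neg (by omega)]; simp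
        rw [this]; simp
    simp only [e1]
    rw [mean_val hPd]
    simp only [hP]
    congr 3
    refine Finset.sum_congr rfl (fun p _ => ?_)
    rcases lt_trichotomy (p.1 + e * p.2) 0 with hj | hj | hj
    · have : sgc e p = -1 := by unfold sgc; rw [Int.sign_eq_neg_one_of_neg hj]; simp
      rw [this, if_neg hj.ne]; simp
    · have : sgc e p = 0 := by unfold sgc; rw [hj]; simp
      rw [this, if_pos hj, hj]; simp
    · have : (p.1 + e * p.2).toNat ≠ 0 := by omega
      rw [if_neg hj.ne', zero_pow this]; simp
  have hsw : ∫ u in T2, (∫ θ in (0:ℝ)..(2 * Real.pi), h (u.1 + θ, u.2 + e * θ)) =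
      ∫ θ in (0:ℝ)..(2 * Real.pi), ∫ u in T2, h (u.1 + θ, u.2 + e * θ) := by
    rw [intervalIntegral.integral_of_le (by positivity)]
    simp only [intervalIntegral.integral_of_le (by positivity : (0:ℝ) ≤ 2 * Real.pi)]
    apply integral_integral_swap
    rw [Measure.prod_restrict]
    have hcc : Continuous (fun z : (ℝ × ℝ) × ℝ => h (z.1.1 + z.2, z.1.2 + e * z.2)) := by fun_prop
    have : IntegrableOn (fun z : (ℝ × ℝ) × ℝ => h (z.1.1 + z.2, z.1.2 + e * z.2))
      ((Icc (-Real.pi) Real.pi ×ˢ Icc (-Real.pi) Real.pi) ×ˢ Icc 0 (2 * Real.pi)) (volume.prod volume) :=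
      hcc.continuousOn.integrableOn_compact ((isCompact_Icc.prod isCompact_Icc).prod isCompact_Icc)
    exact this.mono_set (prod_mono (prod_mono Ico_subset_Icc_self Ico_subset_Icc_self) Ioc_subset_Icc_self)
  simp only [hp, hs] at hsw
  rw [intervalIntegral.integral_const, integral_const_mul, sub_zero, Complex.real_smul] at hsw
  have hne : ((2 * Real.pi : ℝ) : ℂ) ≠ 0 := by exact_mod_cast (by positivity : (2 * Real.pi : ℝ) ≠ 0)
  exact (mul_left_cancel₀ hne hsw).symm

lemma exp_int (e : ℤ) {S : Finset (ℤ × ℤ)} (hS : ∀ p ∈ S, -p ∈ S) {a : ℤ × ℤ → ℂ}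
    (ha : ∀ p, (starRingEnd ℂ) (a p) = a (-p)) {c B : ℝ} (hc : 0 ≤ c) (hcB : c * B ≤ 1)
    (hB : ∀ u, ‖∑ p ∈ S, a p * ch p u‖ ≤ B) :
    ∫ u in T2, Real.exp (c * ‖∑ p ∈ S, (sgc e p : ℂ) * a p * ch p u‖) ≤ 16 * Real.pi ^ 2 := by
  set q : ℝ × ℝ → ℂ := fun u => ∑ p ∈ S, a p * ch p u with hq
  set W : ℝ × ℝ → ℂ := fun u => ∑ p ∈ S, (sgc e p : ℂ) * a p * ch p u with hW
  have hqc : Continuous q := continuous_finsetSum _ (fun p _ => continuous_const.mul (ch_continuous p))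
  have hWc : Continuous W := continuous_finsetSum _ (fun p _ => continuous_const.mul (ch_continuous p))
  have hqr : ∀ u, (q u).im = 0 := by
    intro u
    have := trig_sym hS (a := a) (η := 1) (by intro p; rw [ha]; simp) u
    rw [Complex.ofReal_one, one_mul] at this
    exact Complex.conj_eq_iff_im.mp this
  have hWi : ∀ u, (W u).re = 0 := by
    intro u
    have := trig_sym hS (a := fun p => (sgc e p : ℂ) * a p) (η := -1) (by
      intro p; rw [map_mul, ha, Complex.conj_ofReal, sgc_neg]; push_cast; ring) u
    have h2 := congrArg Complex.re this
    rw [Complex.conj_re, Complex.re_ofReal_mul] at h2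
    simp only [hW]; linarith
  have hF0 : ∀ u, (∑ p ∈ S, (if p.1 + e * p.2 = 0 then a p else 0) * ch p u).im = 0 := by
    intro u
    have := trig_sym hS (a := fun p => (if p.1 + e * p.2 = 0 then a p else 0)) (η := 1) (by
      intro p
      have : ((-p).1 + e * (-p).2 = 0) ↔ (p.1 + e * p.2 = 0) := by
        rw [Prod.fst_neg, Prod.snd_neg, show -p.1 + e * -p.2 = -(p.1 + e * p.2) by ring]; exact neg_eq_zero
      simp only [this]
      split_ifs
      · rw [ha]; simp
      · simp) u
    rw [Complex.ofReal_one, one_mul] at this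
    exact Complex.conj_eq_iff_im.mp this
  have key : ∀ η : ℝ, |η| = 1 → ∫ u in T2, Real.exp (η * (c * (W u).im)) ≤ 8 * Real.pi ^ 2 := by
    intro η hη
    set κ : ℂ := ((-η * c : ℝ) : ℂ) * Complex.I with hκ
    have h1 := exp_mean e S a κ
    have e1 : ∀ u, ∑ p ∈ S, ((1 + sgc e p : ℝ) : ℂ) * a p * ch p u = q u + W u := by
      intro u; simp only [hq, hW]; rw [← Finset.sum_add_distrib]
      refine Finset.sum_congr rfl (fun p _ => ?_); push_cast; ring
    simp only [e1] at h1
    have h2 : ‖∫ u in T2, Complex.exp (κ * (q u + W u))‖ ≤ 4 * Real.pi ^ 2 := by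
      rw [h1]
      refine (norm_integral_le_of_norm_le_const (C := 1) (Eventually.of_forall (fun u => ?_))).trans ?_
      · rw [Complex.norm_exp]
        have : (κ * ∑ p ∈ S, (if p.1 + e * p.2 = 0 then a p else 0) * ch p u).re = 0 := by
          rw [Complex.mul_re, hF0, hκ, Complex.re_ofReal_mul, Complex.I_re]; ring
        rw [this, Real.exp_zero]
      · rw [one_mul, measureReal_restrict_apply_univ, T2_volr]
    have e2 : ∀ u, (Complex.exp (κ * (q u + W u))).re = Real.exp (η * (c * (W u).im)) * Real.cos (-η * c * (q u).re) := by
      intro u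
      rw [Complex.exp_re]
      have : κ * (q u + W u) = ((-η * c * (q u + W u).re : ℝ) : ℂ) * Complex.I + ((η * c * (q u + W u).im : ℝ) : ℂ) := by
        rw [hκ]
        conv_lhs => rw [← Complex.re_add_im (q u + W u)]
        push_cast
        linear_combination (-(η:ℂ) * c * ((q u + W u).im : ℂ)) * Complex.I_sq
      rw [this]
      simp only [Complex.add_re, Complex.add_im, Complex.re_ofReal_mul, Complex.im_ofReal_mul, Complex.I_re, Complex.I_im,
        Complex.ofReal_re, Complex.ofReal_im, hqr, hWi]
      congr 2 <;> ring
    have hec : Continuous (fun u => Complex.exp (κ * (q u + W u))) := by fun_prop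
    have hei : Continuous (fun u => Real.exp (η * (c * (W u).im))) := by
      have := Complex.continuous_im.comp hWc
      simp only [Function.comp_def] at this
      fun_prop
    have h3 : (1/2) * ∫ u in T2, Real.exp (η * (c * (W u).im)) ≤ ∫ u in T2, (Complex.exp (κ * (q u + W u))).re := by
      rw [← integral_const_mul]
      apply integral_mono
      · exact (continuous_integrableOn_T2 hei).const_mul _
      · exact continuous_integrableOn_T2 (Complex.continuous_re.comp hec)
      intro u
      simp only [e2]
      have hb := hB u
      have hcos : 1/2 ≤ Real.cos (-η * c * (q u).re) := by
        have h5 : |-η * c * (q u).re| ≤ 1 := by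
          rw [abs_mul, abs_mul, abs_neg, hη, one_mul, abs_of_nonneg hc]
          have := Complex.abs_re_le_norm (q u)
          have : c * |(q u).re| ≤ c * B := mul_le_mul_of_nonneg_left (this.trans hb) hc
          linarith
        have := Real.one_sub_sq_div_two_le_cos (x := -η * c * (q u).re)
        have h6 : (-η * c * (q u).re) ^ 2 ≤ 1 := by rw [← sq_abs]; exact pow_le_one₀ (abs_nonneg _) h5
        linarith
      rw [mul_comm]
      exact mul_le_mul_of_nonneg_left hcos (Real.exp_pos _).le
    have h4 : ∫ u in T2, (Complex.exp (κ * (q u + W u))).re = (∫ u in T2, Complex.exp (κ * (q u + W u))).re :=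
      integral_re (continuous_integrableOn_T2 hec)
    rw [h4] at h3
    have := (Complex.re_le_norm _).trans h2
    linarith
  have hWim : Continuous (fun u => (W u).im) := Complex.continuous_im.comp hWc
  have hnW : ∀ u, ‖W u‖ = |(W u).im| := by
    intro u
    rw [Complex.norm_eq_sqrt_sq_add_sq, hWi, ← Real.sqrt_sq_eq_abs]; simp
  have k1 := key 1 (by simp)
  have k2 := key (-1) (by simp)
  have hle : ∫ u in T2, Real.exp (c * ‖W u‖) ≤ ∫ u in T2, (Real.exp (1 * (c * (W u).im)) + Real.exp (-1 * (c * (W u).im))) := by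
    apply integral_mono (continuous_integrableOn_T2 (by fun_prop)) (continuous_integrableOn_T2 (by fun_prop))
    intro u
    simp only [hnW]
    rcases abs_cases (W u).im with ⟨h, -⟩ | ⟨h, -⟩
    · rw [h, one_mul]; linarith [Real.exp_pos (-1 * (c * (W u).im))]
    · rw [h, show c * -(W u).im = -1 * (c * (W u).im) by ring]; linarith [Real.exp_pos (1 * (c * (W u).im))]
  rw [integral_add (continuous_integrableOn_T2 (by fun_prop)) (continuous_integrableOn_T2 (by fun_prop))] at hle
  linarith

lemma Dn_sq_int (n : ℕ) (c : ℝ) : ∫ z in T1, ‖Dn n (c - z)‖ ^ 2 = 2 * Real.pi * (2 * n + 1) := by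
  have e1 : ∀ z, Dn n (c - z) = ∑ m ∈ Finset.Icc (-(n:ℤ)) (n:ℤ), ee (-m) c * ee m z := by
    intro z; unfold Dn
    refine Finset.sum_nbij' (fun p => -p) (fun p => -p) ?_ ?_ (fun p _ => neg_neg p) (fun p _ => neg_neg p) (fun p _ => ?_)
    · intro p hp; rw [Finset.mem_Icc] at hp ⊢; omega
    · intro p hp; rw [Finset.mem_Icc] at hp ⊢; omega
    · rw [ee_sub, neg_neg]
  simp only [e1]
  rw [parseval]
  simp only [ee_norm]
  rw [Finset.sum_const, Int.card_Icc]
  have : ((n:ℤ) + 1 - -(n:ℤ)).toNat = 2 * n + 1 := by omega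
  rw [this]; simp

def om (M : ℕ) (m : ℤ) : ℝ :=
  (((Finset.Icc (-((2*M:ℕ):ℤ)) ((2*M:ℕ):ℤ) ×ˢ Finset.Icc (-(M:ℤ)) (M:ℤ)).filter (fun p : ℤ × ℤ => p.1 + p.2 = m)).card : ℝ) / (2 * M + 1)

lemma om_neg (M : ℕ) (m : ℤ) : om M (-m) = om M m := by
  unfold om
  congr 2
  refine Finset.card_nbij' (fun p => -p) (fun p => -p) ?_ ?_ (fun p _ => neg_neg p) (fun p _ => neg_neg p)
  · intro p hp
    simp only [Finset.coe_filter, Finset.mem_product, Finset.mem_Icc, mem_setOf_eq, Prod.fst_neg, Prod.snd_neg] at hp ⊢; omega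
  · intro p hp
    simp only [Finset.coe_filter, Finset.mem_product, Finset.mem_Icc, mem_setOf_eq, Prod.fst_neg, Prod.snd_neg] at hp ⊢; omega

lemma om_one (M : ℕ) {m : ℤ} (h1 : -(M:ℤ) ≤ m) (h2 : m ≤ M) : om M m = 1 := by
  unfold om
  have : ((Finset.Icc (-((2*M:ℕ):ℤ)) ((2*M:ℕ):ℤ) ×ˢ Finset.Icc (-(M:ℤ)) (M:ℤ)).filter (fun p : ℤ × ℤ => p.1 + p.2 = m)).card = 2 * M + 1 := by
    have h3 : (Finset.Icc (-(M:ℤ)) (M:ℤ)).card = 2 * M + 1 := by rw [Int.card_Icc]; omega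
    rw [← h3]
    refine Finset.card_nbij' (fun p => p.2) (fun b => (m - b, b)) ?_ ?_ ?_ ?_
    · intro p hp
      simp only [Finset.coe_filter, Finset.mem_product, Finset.mem_Icc, mem_setOf_eq, Finset.coe_Icc, mem_Icc] at hp ⊢; omega
    · intro p hp
      simp only [Finset.coe_filter, Finset.mem_product, Finset.mem_Icc, mem_setOf_eq, Finset.coe_Icc, mem_Icc] at hp ⊢; push_cast; omega
    · intro p hp
      simp only [Finset.coe_filter, Finset.mem_product, Finset.mem_Icc, mem_setOf_eq] at hp
      ext <;> simp <;> omega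
    · intro p hp; rfl
  rw [this]; push_cast; field_simp

def s3 (M : ℕ) : Finset ℤ := Finset.Icc (-((3*M:ℕ):ℤ)) ((3*M:ℕ):ℤ)

def VP (M : ℕ) (t : ℝ) : ℂ := ∑ m ∈ s3 M, (om M m : ℂ) * ee m t

lemma VP_continuous (M : ℕ) : Continuous (VP M) :=
  continuous_finsetSum _ (fun m _ => continuous_const.mul (ee_continuous m))

lemma VP_eq (M : ℕ) (t : ℝ) : VP M t = (1 / (2 * M + 1) : ℝ) * (Dn (2 * M) t * Dn M t) := by
  unfold VP Dn
  rw [Finset.sum_mul_sum, ← Finset.sum_product', Finset.mul_sum,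
    ← Finset.sum_fiberwise_of_maps_to (g := fun p : ℤ × ℤ => p.1 + p.2) (t := s3 M)]
  · refine Finset.sum_congr rfl (fun m _ => ?_)
    rw [Finset.sum_congr rfl (g := fun _ => ((1 / (2 * M + 1) : ℝ) : ℂ) * ee m t), Finset.sum_const]
    · unfold om; rw [nsmul_eq_mul]; push_cast; ring
    · intro p hp; rw [Finset.mem_filter] at hp; rw [ee_mul, hp.2]
  · intro p hp
    rw [Finset.mem_product, Finset.mem_Icc, Finset.mem_Icc] at hp
    unfold s3; rw [Finset.mem_Icc]; push_cast at *; omega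

lemma VP_int (M : ℕ) (c : ℝ) : ∫ z in T1, ‖VP M (c - z)‖ ≤ 3 * Real.pi := by
  have hpi := Real.pi_pos
  have hD : ∀ n, Continuous (fun z => Dn n (c - z)) := by
    intro n; unfold Dn
    apply continuous_finsetSum; intro m _; exact (ee_continuous m).comp (by fun_prop)
  have hV : Continuous (fun z => VP M (c - z)) := (VP_continuous M).comp (by fun_prop)
  have hM : (0:ℝ) < 2 * M + 1 := by positivity
  have d1 := hD (2 * M)
  have d2 := hD M
  have i1 : IntegrableOn (fun z => ‖Dn (2 * M) (c - z)‖ ^ 2) T1 := continuous_integrableOn_T1 (by fun_prop)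
  have i2 : IntegrableOn (fun z => ‖Dn M (c - z)‖ ^ 2) T1 := continuous_integrableOn_T1 (by fun_prop)
  have h1 : ∫ z in T1, ‖VP M (c - z)‖ ≤ ∫ z in T1, (1 / (2 * M + 1)) / 2 * (‖Dn (2 * M) (c - z)‖ ^ 2 + ‖Dn M (c - z)‖ ^ 2) := by
    apply integral_mono (continuous_integrableOn_T1 (by fun_prop)) (continuous_integrableOn_T1 (by fun_prop))
    intro z
    simp only [VP_eq]
    rw [norm_mul, norm_mul, Complex.norm_real, Real.norm_of_nonneg (by positivity)]
    have k1 : ‖Dn (2 * M) (c - z)‖ * ‖Dn M (c - z)‖ ≤ (‖Dn (2 * M) (c - z)‖ ^ 2 + ‖Dn M (c - z)‖ ^ 2) / 2 := by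
      nlinarith [sq_nonneg (‖Dn (2 * M) (c - z)‖ - ‖Dn M (c - z)‖)]
    have k2 := mul_le_mul_of_nonneg_left k1 (by positivity : (0:ℝ) ≤ 1 / (2 * (M:ℝ) + 1))
    linarith
  rw [integral_const_mul, integral_add i1 i2, Dn_sq_int, Dn_sq_int] at h1
  refine h1.trans ?_
  rw [div_div, div_mul_eq_mul_div, div_le_iff₀ (by positivity)]
  push_cast
  nlinarith

def sq3 (M : ℕ) : Finset (ℤ × ℤ) := s3 M ×ˢ s3 M

lemma sq3_neg (M : ℕ) : ∀ p ∈ sq3 M, -p ∈ sq3 M := by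
  intro p hp
  unfold sq3 s3 at *
  simp only [Finset.mem_product, Finset.mem_Icc, Prod.fst_neg, Prod.snd_neg] at hp ⊢; omega

/-- dual control by exponentially integrable functions -/
def Dbd (r : ℝ × ℝ → ℝ) (D : ℝ) : Prop :=
  ∀ W : ℝ × ℝ → ℝ, Continuous W → (∀ u, 0 ≤ W u) → ∫ u in T2, Real.exp (W u) ≤ 16 * Real.pi ^ 2 → ∫ u in T2, |r u| * W u ≤ D

lemma fc_eq (f : ℝ × ℝ → ℝ) (p : ℤ × ℤ) : fourierCoef2 f p.1 p.2 = (1 / (4 * (Real.pi : ℂ) ^ 2)) * ∫ u in T2, (f u : ℂ) * ch (-p) u := by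
  unfold fourierCoef2
  congr 2
  funext u
  congr 1
  unfold ch ee
  rw [← Complex.exp_add]; congr 1; rw [Prod.fst_neg, Prod.snd_neg]; push_cast; ring

lemma ch_mul_int {γ : ℝ × ℝ → ℂ} (hγ : IntegrableOn γ T2) (p : ℤ × ℤ) : IntegrableOn (fun u => γ u * ch p u) T2 :=
  Integrable.mul_bdd (c := 1) hγ (ch_continuous p).aestronglyMeasurable
        (Eventually.of_forall (fun u => (ch_norm p u).le))

def GG (M : ℕ) (e : ℤ) (r : ℝ × ℝ → ℝ) (z : ℝ × ℝ) : ℂ :=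
  ∑ p ∈ sq3 M, ((om M p.1 * om M p.2 * sgc e p : ℝ) : ℂ) * fourierCoef2 r p.1 p.2 * ch p z

lemma GG_continuous (M : ℕ) (e : ℤ) (r : ℝ × ℝ → ℝ) : Continuous (GG M e r) :=
  continuous_finsetSum _ (fun p _ => continuous_const.mul (ch_continuous p))

lemma GG_dual (M : ℕ) (e : ℤ) {r : ℝ × ℝ → ℝ} (hr : IntegrableOn r T2) {D : ℝ} (hD : Dbd r D)
    {ψ : ℝ × ℝ → ℝ} (hψ : Measurable ψ) (hψ1 : ∀ u, |ψ u| ≤ 1) :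
    ‖∫ z in T2, GG M e r z * (ψ z : ℂ)‖ ≤ 9 / 4 * D := by
  have hpi := Real.pi_pos
  have hψi : IntegrableOn (fun u => (ψ u : ℂ)) T2 := by
    refine Integrable.mono' (g := fun _ => 1) (integrable_const 1) (Complex.measurable_ofReal.comp hψ).aestronglyMeasurable (Eventually.of_forall (fun u => ?_))
    rw [Complex.norm_real]; exact hψ1 u
  have hrC : IntegrableOn (fun u => (r u : ℂ)) T2 := hr.ofReal
  set a : ℤ × ℤ → ℂ := fun p => ((om M p.1 * om M p.2 / (4 * Real.pi ^ 2) : ℝ) : ℂ) * ∫ z in T2, (ψ z : ℂ) * ch (-p) z with ha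
  have haconj : ∀ p, (starRingEnd ℂ) (a p) = a (-p) := by
    intro p
    simp only [ha]
    rw [map_mul, Complex.conj_ofReal, ← integral_conj, Prod.fst_neg, Prod.snd_neg, om_neg, om_neg]
    congr 2; funext u; rw [map_mul, Complex.conj_ofReal, ch_conj]
  have hB : ∀ u, ‖∑ p ∈ sq3 M, a p * ch p u‖ ≤ 9 / 4 := by
    intro u
    have hVc : ∀ c, Continuous (fun z => VP M (c - z)) := fun c => (VP_continuous M).comp (by fun_prop)
    have e1 : ∑ p ∈ sq3 M, a p * ch p u = ((1 / (4 * Real.pi ^ 2) : ℝ) : ℂ) * ∫ z in T2, (ψ z : ℂ) * (VP M (u.1 - z.1) * VP M (u.2 - z.2)) := by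
      have e2 : ∀ z : ℝ × ℝ, (ψ z : ℂ) * (VP M (u.1 - z.1) * VP M (u.2 - z.2)) = ∑ p ∈ sq3 M, ((om M p.1 * om M p.2 : ℝ) : ℂ) * ch p u * ((ψ z : ℂ) * ch (-p) z) := by
        intro z
        unfold VP
        rw [Finset.sum_mul_sum, ← Finset.sum_product', Finset.mul_sum]
        refine Finset.sum_congr rfl (fun p _ => ?_)
        unfold ch
        rw [ee_sub, ee_sub, Prod.fst_neg, Prod.snd_neg]; push_cast; ring
      simp only [e2]
      rw [integral_finsetSum _ (fun p _ => (ch_mul_int hψi _).const_mul _), Finset.mul_sum]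
      refine Finset.sum_congr rfl (fun p _ => ?_)
      rw [integral_const_mul]; simp only [ha]; push_cast; ring
    rw [e1, norm_mul, Complex.norm_real, Real.norm_of_nonneg (by positivity)]
    have h1 := hVc u.1
    have h2 := hVc u.2
    have h3 : ‖∫ z in T2, (ψ z : ℂ) * (VP M (u.1 - z.1) * VP M (u.2 - z.2))‖ ≤ ∫ z in T2, ‖VP M (u.1 - z.1)‖ * ‖VP M (u.2 - z.2)‖ := by
      have c1 : Continuous (fun z : ℝ × ℝ => VP M (u.1 - z.1)) := h1.comp continuous_fst
      have c2 : Continuous (fun z : ℝ × ℝ => VP M (u.2 - z.2)) := h2.comp continuous_snd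
      refine norm_integral_le_of_norm_le (continuous_integrableOn_T2 (c1.norm.mul c2.norm)) (Eventually.of_forall (fun z => ?_))
      rw [norm_mul, Complex.norm_real, norm_mul]
      exact mul_le_of_le_one_left (by positivity) (hψ1 z)
    rw [T2_restrict, integral_prod_mul (fun z => ‖VP M (u.1 - z)‖) (fun z => ‖VP M (u.2 - z)‖)] at h3
    have h4 : (∫ z in T1, ‖VP M (u.1 - z)‖) * (∫ z in T1, ‖VP M (u.2 - z)‖) ≤ (3 * Real.pi) * (3 * Real.pi) :=
      mul_le_mul (VP_int M _) (VP_int M _) (integral_nonneg (fun _ => norm_nonneg _)) (by positivity)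
    rw [div_mul_eq_mul_div, div_le_iff₀ (by positivity), T2_restrict]
    linarith
  have hexp := exp_int e (sq3_neg M) haconj (c := 4/9) (B := 9/4) (by norm_num) (by norm_num) hB
  set W : ℝ × ℝ → ℂ := fun u => ∑ p ∈ sq3 M, (sgc e p : ℂ) * a p * ch p u with hW
  have hWc : Continuous W := continuous_finsetSum _ (fun p _ => continuous_const.mul (ch_continuous p))
  have hd := hD (fun u => 4/9 * ‖W u‖) (by fun_prop) (fun u => by positivity) hexp
  have e3 : ∫ u in T2, |r u| * (4/9 * ‖W u‖) = 4/9 * ∫ u in T2, |r u| * ‖W u‖ := by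
    rw [← integral_const_mul]; congr 1; funext u; ring
  rw [e3] at hd
  have e4 : ∫ z in T2, GG M e r z * (ψ z : ℂ) = ∫ u in T2, (r u : ℂ) * -W u := by
    have e5 : ∀ z, GG M e r z * (ψ z : ℂ) = ∑ p ∈ sq3 M, ((om M p.1 * om M p.2 * sgc e p : ℝ) : ℂ) * fourierCoef2 r p.1 p.2 * ((ψ z : ℂ) * ch p z) := by
      intro z; unfold GG; rw [Finset.sum_mul]; refine Finset.sum_congr rfl (fun p _ => by ring)
    have e6 : ∀ u, -W u = ∑ p ∈ sq3 M, (sgc e p : ℂ) * a (-p) * ch (-p) u := by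
      intro u
      simp only [hW]
      rw [← Finset.sum_neg_distrib]
      refine Finset.sum_nbij' (fun p => -p) (fun p => -p) (sq3_neg M) (sq3_neg M) (fun p _ => neg_neg p) (fun p _ => neg_neg p) (fun p _ => ?_)
      rw [neg_neg, sgc_neg]; push_cast; ring
    have e7 : ∀ u, (r u : ℂ) * -W u = ∑ p ∈ sq3 M, (sgc e p : ℂ) * a (-p) * ((r u : ℂ) * ch (-p) u) := by
      intro u; rw [e6, Finset.mul_sum]; refine Finset.sum_congr rfl (fun p _ => by ring)
    simp only [e5, e7]
    rw [integral_finsetSum _ (fun p _ => (ch_mul_int hψi _).const_mul _), integral_finsetSum _ (fun p _ => (ch_mul_int hrC _).const_mul _)]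
    refine Finset.sum_congr rfl (fun p _ => ?_)
    rw [integral_const_mul, integral_const_mul, fc_eq]
    simp only [ha, neg_neg, Prod.fst_neg, Prod.snd_neg, om_neg]
    push_cast; ring
  rw [e4]
  refine (norm_integral_le_integral_norm _).trans ?_
  simp only [norm_mul, norm_neg, Complex.norm_real, Real.norm_eq_abs]
  linarith

lemma GG_L1 (M : ℕ) (e : ℤ) {r : ℝ × ℝ → ℝ} (hr : IntegrableOn r T2) {D : ℝ} (hD : Dbd r D) :
    ∫ z in T2, ‖GG M e r z‖ ≤ 9 / 2 * D := by
  set G := GG M e r with hG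
  have hGc : Continuous G := GG_continuous M e r
  have hre : Continuous (fun z => (G z).re) := Complex.continuous_re.comp hGc
  have him : Continuous (fun z => (G z).im) := Complex.continuous_im.comp hGc
  set ψ1 : ℝ × ℝ → ℝ := fun z => (G z).re / ‖G z‖ with h1
  set ψ2 : ℝ × ℝ → ℝ := fun z => -(G z).im / ‖G z‖ with h2
  have m1 : Measurable ψ1 := hre.measurable.div hGc.norm.measurable
  have m2 : Measurable ψ2 := him.neg.measurable.div hGc.norm.measurable
  have b1 : ∀ u, |ψ1 u| ≤ 1 := by
    intro u; simp only [h1]; rw [abs_div, abs_norm]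
    exact div_le_one_of_le₀ (Complex.abs_re_le_norm _) (norm_nonneg _)
  have b2 : ∀ u, |ψ2 u| ≤ 1 := by
    intro u; simp only [h2]; rw [abs_div, abs_norm, abs_neg]
    exact div_le_one_of_le₀ (Complex.abs_im_le_norm _) (norm_nonneg _)
  have d1 := GG_dual M e hr hD m1 b1
  have d2 := GG_dual M e hr hD m2 b2
  have hi := continuous_integrableOn_T2 hGc
  have i1 : IntegrableOn (fun z => G z * (ψ1 z : ℂ)) T2 := Integrable.mul_bdd (c := 1) hi
    (Complex.measurable_ofReal.comp m1).aestronglyMeasurable (Eventually.of_forall (fun u => by rw [Complex.norm_real]; exact b1 u))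
  have i2 : IntegrableOn (fun z => G z * (ψ2 z : ℂ)) T2 := Integrable.mul_bdd (c := 1) hi
    (Complex.measurable_ofReal.comp m2).aestronglyMeasurable (Eventually.of_forall (fun u => by rw [Complex.norm_real]; exact b2 u))
  have e1 : ∀ z, ((‖G z‖ : ℝ) : ℂ) = G z * (ψ1 z : ℂ) + (G z * (ψ2 z : ℂ)) * Complex.I := by
    intro z
    by_cases h0 : G z = 0
    · rw [h0]; simp
    have hn : ((‖G z‖ : ℝ) : ℂ) ≠ 0 := by exact_mod_cast norm_ne_zero_iff.mpr h0
    have h4 := Complex.mul_conj (G z)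
    rw [Complex.normSq_eq_norm_sq] at h4
    have h5 : (starRingEnd ℂ) (G z) = (G z).re - (G z).im * Complex.I := by
      apply Complex.ext <;> simp
    rw [h5] at h4
    simp only [h1, h2]
    push_cast at h4 ⊢
    field_simp
    rw [← h4]; ring
  have e2 : ((∫ z in T2, ‖G z‖ : ℝ) : ℂ) = (∫ z in T2, G z * (ψ1 z : ℂ)) + (∫ z in T2, G z * (ψ2 z : ℂ)) * Complex.I := by
    rw [← integral_complex_ofReal]
    simp only [e1]
    rw [integral_add i1 (i2.mul_const _), integral_mul_const]
  have h0 : 0 ≤ ∫ z in T2, ‖G z‖ := integral_nonneg (fun _ => norm_nonneg _)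
  rw [← Real.norm_of_nonneg h0, ← Complex.norm_real, e2]
  refine (norm_add_le _ _).trans ?_
  rw [norm_mul, Complex.norm_I, mul_one]
  linarith

lemma cj_cont {G : ℝ × ℝ → ℂ} (hG : Continuous G) (n : ℕ) : Continuous (fun p : ℝ × ℝ => cj (fun u => G (u, p.2)) n p.1) := by
  unfold cj T1
  have e : ∀ p : ℝ × ℝ, (∫ u in Ico (-Real.pi) Real.pi, G (u, p.2) * (Dt n (p.1 - u) : ℂ)) = ∫ u in Icc (-Real.pi) Real.pi, G (u, p.2) * (Dt n (p.1 - u) : ℂ) := by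
    intro p
    rw [integral_Icc_eq_integral_Ico]
  simp only [e]
  have h := Dt_continuous n
  exact continuous_parametric_integral_of_continuous (f := fun (p : ℝ × ℝ) (u : ℝ) => G (u, p.2) * (Dt n (p.1 - u) : ℂ)) (by
    unfold Function.uncurry
    fun_prop) isCompact_Icc

lemma pair_sum_le (c : ℕ → ℂ) (α : ℂ) (n : ℕ) :
    ∑ l ∈ Finset.range n, ∑ k ∈ Finset.range n, ‖c l - c k‖ ^ 2 ≤ n * (4 * ∑ l ∈ Finset.range n, ‖c l - α‖ ^ 2) := by
  calc ∑ l ∈ Finset.range n, ∑ k ∈ Finset.range n, ‖c l - c k‖ ^ 2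
      ≤ ∑ l ∈ Finset.range n, ∑ k ∈ Finset.range n, (2 * ‖c l - α‖ ^ 2 + 2 * ‖c k - α‖ ^ 2) := by
        refine Finset.sum_le_sum (fun l _ => Finset.sum_le_sum (fun k _ => ?_))
        have h1 : ‖c l - c k‖ ≤ ‖c l - α‖ + ‖c k - α‖ := by
          rw [show c l - c k = (c l - α) - (c k - α) by ring]; exact norm_sub_le _ _
        have h2 := pow_le_pow_left₀ (norm_nonneg _) h1 2
        nlinarith [sq_nonneg (‖c l - α‖ - ‖c k - α‖)]
    _ = n * (4 * ∑ l ∈ Finset.range n, ‖c l - α‖ ^ 2) := by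
        simp only [Finset.sum_add_distrib, Finset.sum_const, Finset.card_range, ← Finset.mul_sum, nsmul_eq_mul]
        ring

lemma pair_sum_ex (c : ℕ → ℂ) {n : ℕ} (hn : 0 < n) {K : ℝ}
    (h : ∑ l ∈ Finset.range n, ∑ k ∈ Finset.range n, ‖c l - c k‖ ^ 2 ≤ n * K) :
    ∃ α : ℂ, ∑ l ∈ Finset.range n, ‖c l - α‖ ^ 2 ≤ K := by
  rw [Finset.sum_comm] at h
  obtain ⟨k, _, hk⟩ := Finset.exists_le_of_sum_le (s := Finset.range n) (f := fun k => ∑ l ∈ Finset.range n, ‖c l - c k‖ ^ 2) (g := fun _ => K)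
    ⟨0, Finset.mem_range.mpr hn⟩ (by simpa using h)
  exact ⟨c k, hk⟩

lemma slice2 {G : ℝ × ℝ → ℂ} (hG : Continuous G) {lam : ℝ} (hlam : 0 < lam) (N0 : ℕ) :
    ∃ E : Set (ℝ × ℝ), MeasurableSet E ∧ volume E ≤ ENNReal.ofReal (420 * (∫ u in T2, ‖G u‖) / lam) ∧
      ∀ p ∈ T2, p ∉ E → (∀ j ≤ N0, ∀ b, ∃ α : ℂ, ∑ l ∈ Finset.range (2^j), ‖cj (fun u => G (u, p.2)) (b+l) p.1 - α‖^2 ≤ 2^j*(2400*lam)^2) ∧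
      (∀ N, 0<N → N ≤ 2^N0 → ‖∑ n ∈ Finset.range N, cj (fun u => G (u, p.2)) n p.1‖ ≤ 18*N*lam) := by
  set c : ℕ → ℝ × ℝ → ℂ := fun n p => cj (fun u => G (u, p.2)) n p.1 with hc
  have hcc : ∀ n, Continuous (c n) := fun n => cj_cont hG n
  set Q : Set (ℝ × ℝ) := {p | (∀ j ≤ N0, ∀ b, ∑ l ∈ Finset.range (2^j), ∑ k ∈ Finset.range (2^j), ‖c (b+l) p - c (b+k) p‖^2 ≤ ((2^j:ℕ):ℝ) * (4 * (2^j*(1200*lam)^2)))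
    ∧ (∀ N, 0<N → N ≤ 2^N0 → ‖∑ n ∈ Finset.range N, c n p‖ ≤ 18*N*lam)} with hQ
  have hQm : MeasurableSet Q := by
    apply IsClosed.measurableSet
    rw [hQ, setOf_and]
    refine IsClosed.inter ?_ ?_
    · simp only [setOf_forall]
      refine isClosed_iInter (fun j => isClosed_iInter (fun _ => isClosed_iInter (fun b => ?_)))
      refine isClosed_le (continuous_finsetSum _ (fun l _ => continuous_finsetSum _ (fun k _ => ?_))) continuous_const
      have := hcc (b+l); have := hcc (b+k); fun_prop
    · simp only [setOf_forall]
      refine isClosed_iInter (fun N => isClosed_iInter (fun _ => isClosed_iInter (fun _ => ?_)))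
      exact isClosed_le (continuous_finsetSum _ (fun l _ => hcc l)).norm continuous_const
  have hEm : MeasurableSet (T2 \ Q) := T2_meas.diff hQm
  refine ⟨T2 \ Q, hEm, ?_, ?_⟩
  · have hni : IntegrableOn (fun p => ‖G p‖) T2 := continuous_integrableOn_T2 hG.norm
    have h1 : volume (T2 \ Q) = ((volume.restrict T1).prod (volume.restrict T1)) (T2 \ Q) := by
      rw [← T2_restrict, Measure.restrict_apply hEm, inter_eq_left.mpr sdiff_subset]
    rw [h1, Measure.prod_apply_symm hEm]
    have hni' : Integrable (fun p => ‖G p‖) ((volume.restrict T1).prod (volume.restrict T1)) := by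
      rw [← T2_restrict]; exact hni
    calc ∫⁻ y in T1, (volume.restrict T1) ((fun x => (x, y)) ⁻¹' (T2 \ Q))
        ≤ ∫⁻ y in T1, ENNReal.ofReal (420 * (∫ u in T1, ‖G (u, y)‖) / lam) := by
          refine lintegral_mono (fun y => ?_)
          have hgy : Continuous (fun u => G (u, y)) := by fun_prop
          obtain ⟨X, hX, hX2⟩ := thm1D hgy hlam N0
          refine le_trans (Measure.restrict_apply_le _ _) (le_trans (measure_mono ?_) hX)
          intro x hx
          by_contra hxX
          have hx2 : (x, y) ∈ T2 \ Q := hx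
          obtain ⟨a1, a2⟩ := hX2 x hx2.1.1 hxX
          apply hx2.2
          refine ⟨fun j hj b => ?_, fun N h1 h2 => a2 N h1 h2⟩
          obtain ⟨α, hα⟩ := a1 j hj b
          refine (pair_sum_le (fun l => c (b+l) (x,y)) α (2^j)).trans ?_
          have : ∑ l ∈ Finset.range (2^j), ‖c (b+l) (x,y) - α‖ ^ 2 ≤ 2^j*(1200*lam)^2 := hα
          gcongr
      _ = ENNReal.ofReal (∫ y in T1, 420 * (∫ u in T1, ‖G (u, y)‖) / lam) := by
          rw [ofReal_integral_eq_lintegral_ofReal]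
          · exact (hni'.integral_prod_right.const_mul 420).div_const lam
          · exact Eventually.of_forall (fun y => by
              have : 0 ≤ ∫ u in T1, ‖G (u, y)‖ := integral_nonneg (fun _ => norm_nonneg _)
              positivity)
      _ ≤ _ := by
          apply ENNReal.ofReal_le_ofReal
          rw [integral_div, integral_const_mul, T2_restrict, integral_prod_symm _ hni']
  · intro p hp hpE
    have hpQ : p ∈ Q := by by_contra h; exact hpE ⟨hp, h⟩
    refine ⟨fun j hj b => ?_, hpQ.2⟩
    obtain ⟨α, hα⟩ := pair_sum_ex (fun l => c (b+l) p) (by positivity : 0 < 2^j) (hpQ.1 j hj b)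
    refine ⟨α, hα.trans ?_⟩
    apply le_of_eq; ring

lemma slice2' {G : ℝ × ℝ → ℂ} (hG : Continuous G) {lam : ℝ} (hlam : 0 < lam) (N0 : ℕ) :
    ∃ E : Set (ℝ × ℝ), MeasurableSet E ∧ volume E ≤ ENNReal.ofReal (420 * (∫ u in T2, ‖G u‖) / lam) ∧
      ∀ p ∈ T2, p ∉ E → (∀ j ≤ N0, ∀ b, ∃ α : ℂ, ∑ l ∈ Finset.range (2^j), ‖cj (fun u => G (p.1, u)) (b+l) p.2 - α‖^2 ≤ 2^j*(2400*lam)^2) ∧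
      (∀ N, 0<N → N ≤ 2^N0 → ‖∑ n ∈ Finset.range N, cj (fun u => G (p.1, u)) n p.2‖ ≤ 18*N*lam) := by
  obtain ⟨E, hE, h1, h2⟩ := slice2 (G := fun p => G p.swap) (hG.comp continuous_swap) hlam N0
  refine ⟨Prod.swap ⁻¹' E, measurable_swap hE, ?_, ?_⟩
  · have := (Measure.measurePreserving_swap (μ := (volume : Measure ℝ)) (ν := (volume : Measure ℝ))).measure_preimage hE.nullMeasurableSet
    rw [Measure.volume_eq_prod, this, ← Measure.volume_eq_prod]
    refine h1.trans (le_of_eq ?_)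
    congr 3
    rw [T2_restrict]
    exact integral_prod_swap (fun p => ‖G p‖)
  · intro p hp hpE
    exact h2 p.swap ⟨hp.2, hp.1⟩ hpE

lemma cj_ee (k : ℤ) (n : ℕ) (x : ℝ) : cj (ee k) n x = if -(n:ℤ) ≤ k ∧ k ≤ n then (Real.pi / Complex.I) * (k.sign : ℂ) * ee k x else 0 := by
  rw [cj_cc (continuous_integrableOn_T1 (ee_continuous k))]
  unfold cc
  have : ∀ m : ℤ, ((Int.sign m : ℂ) / (2 * Complex.I)) * (∫ u in T1, ee k u * ee (-m) u) * ee m x = if k = m then (Real.pi / Complex.I) * (k.sign : ℂ) * ee k x else 0 := by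
    intro m
    simp only [ee_mul, ee_int]
    by_cases h : k = m
    · subst h
      rw [if_pos (by ring), if_pos rfl]
      have := Complex.I_ne_zero
      push_cast
      field_simp
    · rw [if_neg (by omega), if_neg h]; ring
  simp only [this]
  rw [Finset.sum_ite_eq]
  simp only [Finset.mem_Icc]

lemma cj_sum {ι : Type*} (s : Finset ι) (A : ι → ℂ) (k : ι → ℤ) (n : ℕ) (x : ℝ) :
    cj (fun u => ∑ p ∈ s, A p * ee (k p) u) n x = ∑ p ∈ s, A p * cj (ee (k p)) n x := by
  unfold cj
  simp only [Finset.sum_mul]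
  have hD := Dt_continuous n
  rw [integral_finsetSum]
  · refine Finset.sum_congr rfl (fun p _ => ?_)
    rw [← integral_const_mul]; congr 1; funext u; ring
  · intro p _
    have := ee_continuous (k p)
    exact continuous_integrableOn_T1 (by fun_prop)

lemma mult_id (n : ℕ) (m k : ℤ) : (if -(n:ℤ) ≤ m ∧ m ≤ n then m.sign else 0) * ((m + 1 * k).sign + (m + (-1) * k).sign)
    + (if -(n:ℤ) ≤ k ∧ k ≤ n then k.sign else 0) * ((m + 1 * k).sign - (m + (-1) * k).sign)
    = if ((-(n:ℤ) ≤ m ∧ m ≤ n) ∧ (-(n:ℤ) ≤ k ∧ k ≤ n)) ∧ ¬ (m = 0 ∧ k = 0) then 2 else 0 := by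
  have sg : ∀ z : ℤ, (z < 0 ∧ z.sign = -1) ∨ (z = 0 ∧ z.sign = 0) ∨ (0 < z ∧ z.sign = 1) := by
    intro z
    rcases lt_trichotomy z 0 with h | h | h
    · exact Or.inl ⟨h, Int.sign_eq_neg_one_of_neg h⟩
    · exact Or.inr (Or.inl ⟨h, by rw [h]; rfl⟩)
    · exact Or.inr (Or.inr ⟨h, Int.sign_eq_one_of_pos h⟩)
  rcases sg m with ⟨a1, a2⟩ | ⟨a1, a2⟩ | ⟨a1, a2⟩ <;> rcases sg k with ⟨b1, b2⟩ | ⟨b1, b2⟩ | ⟨b1, b2⟩ <;>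
  rcases sg (m + 1 * k) with ⟨c1, c2⟩ | ⟨c1, c2⟩ | ⟨c1, c2⟩ <;> rcases sg (m + (-1) * k) with ⟨d1, d2⟩ | ⟨d1, d2⟩ | ⟨d1, d2⟩ <;>
  rw [a2, b2, c2, d2] <;> split_ifs <;> omega

def SC (r : ℝ × ℝ → ℝ) (n : ℕ) (z : ℝ × ℝ) : ℂ :=
  ∑ p ∈ Finset.Icc (-(n:ℤ)) (n:ℤ) ×ˢ Finset.Icc (-(n:ℤ)) (n:ℤ), fourierCoef2 r p.1 p.2 * ch p z

lemma Snn_SC (r : ℝ × ℝ → ℝ) (n : ℕ) (x y : ℝ) : Snn r n x y = (SC r n (x, y)).re := by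
  unfold Snn SC
  rw [Finset.sum_product]
  congr 1
  refine Finset.sum_congr rfl (fun m _ => Finset.sum_congr rfl (fun k _ => ?_))
  congr 1
  unfold ch ee
  rw [← Complex.exp_add]; congr 1; ring

lemma SC_id (r : ℝ × ℝ → ℝ) {n M : ℕ} (hn : n ≤ M) (z : ℝ × ℝ) :
    SC r n z = fourierCoef2 r 0 0 + (Complex.I / (2 * Real.pi)) *
      (cj (fun u => GG M 1 r (u, z.2)) n z.1 + cj (fun u => GG M (-1) r (u, z.2)) n z.1
        + cj (fun u => GG M 1 r (z.1, u)) n z.2 - cj (fun u => GG M (-1) r (z.1, u)) n z.2) := by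
  have hx : ∀ e, cj (fun u => GG M e r (u, z.2)) n z.1 = ∑ p ∈ sq3 M, (((om M p.1 * om M p.2 * sgc e p : ℝ) : ℂ) * fourierCoef2 r p.1 p.2 * ee p.2 z.2) * cj (ee p.1) n z.1 := by
    intro e
    rw [← cj_sum]
    congr 1; funext u; unfold GG ch
    refine Finset.sum_congr rfl (fun p _ => ?_); ring
  have hy : ∀ e, cj (fun u => GG M e r (z.1, u)) n z.2 = ∑ p ∈ sq3 M, (((om M p.1 * om M p.2 * sgc e p : ℝ) : ℂ) * fourierCoef2 r p.1 p.2 * ee p.1 z.1) * cj (ee p.2) n z.2 := by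
    intro e
    rw [← cj_sum]
    congr 1; funext u; unfold GG ch
    refine Finset.sum_congr rfl (fun p _ => ?_); ring
  rw [hx, hx, hy, hy, ← Finset.sum_add_distrib, ← Finset.sum_add_distrib, ← Finset.sum_sub_distrib, Finset.mul_sum]
  set s := Finset.Icc (-(n:ℤ)) (n:ℤ) ×ˢ Finset.Icc (-(n:ℤ)) (n:ℤ) with hs
  have hsub : s ⊆ sq3 M := by
    intro p hp
    rw [hs, Finset.mem_product, Finset.mem_Icc, Finset.mem_Icc] at hp
    unfold sq3 s3
    rw [Finset.mem_product, Finset.mem_Icc, Finset.mem_Icc]; push_cast; omega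
  have hterm : ∀ p ∈ sq3 M, (Complex.I / (2 * Real.pi)) * ((((om M p.1 * om M p.2 * sgc 1 p : ℝ) : ℂ) * fourierCoef2 r p.1 p.2 * ee p.2 z.2) * cj (ee p.1) n z.1
      + (((om M p.1 * om M p.2 * sgc (-1) p : ℝ) : ℂ) * fourierCoef2 r p.1 p.2 * ee p.2 z.2) * cj (ee p.1) n z.1
      + (((om M p.1 * om M p.2 * sgc 1 p : ℝ) : ℂ) * fourierCoef2 r p.1 p.2 * ee p.1 z.1) * cj (ee p.2) n z.2
      - (((om M p.1 * om M p.2 * sgc (-1) p : ℝ) : ℂ) * fourierCoef2 r p.1 p.2 * ee p.1 z.1) * cj (ee p.2) n z.2)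
      = if p ∈ s ∧ ¬ p = 0 then fourierCoef2 r p.1 p.2 * ch p z else 0 := by
    intro p _
    have hm := congrArg (fun j : ℤ => (j : ℂ)) (mult_id n p.1 p.2)
    have hI := Complex.I_ne_zero
    have hpi : (Real.pi : ℂ) ≠ 0 := by exact_mod_cast Real.pi_ne_zero
    have e1 : cj (ee p.1) n z.1 = (Real.pi / Complex.I) * ((if -(n:ℤ) ≤ p.1 ∧ p.1 ≤ n then p.1.sign else 0 : ℤ) : ℂ) * ee p.1 z.1 := by
      rw [cj_ee]; split_ifs <;> simp
    have e2 : cj (ee p.2) n z.2 = (Real.pi / Complex.I) * ((if -(n:ℤ) ≤ p.2 ∧ p.2 ≤ n then p.2.sign else 0 : ℤ) : ℂ) * ee p.2 z.2 := by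
      rw [cj_ee]; split_ifs <;> simp
    rw [e1, e2]
    have hcond : (p ∈ s ∧ ¬ p = 0) ↔ (((-(n:ℤ) ≤ p.1 ∧ p.1 ≤ n) ∧ (-(n:ℤ) ≤ p.2 ∧ p.2 ≤ n)) ∧ ¬ (p.1 = 0 ∧ p.2 = 0)) := by
      rw [hs, Finset.mem_product, Finset.mem_Icc, Finset.mem_Icc, Prod.ext_iff]; rfl
    set a : ℤ := (if -(n:ℤ) ≤ p.1 ∧ p.1 ≤ n then p.1.sign else 0) with ha
    set b : ℤ := (if -(n:ℤ) ≤ p.2 ∧ p.2 ≤ n then p.2.sign else 0) with hb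
    have e3 : ∀ s1 s2 : ℂ, ∀ A B C F : ℂ, (Complex.I / (2 * Real.pi)) * ((A * s1 * F * C) * ((Real.pi / Complex.I) * a * B) + (A * s2 * F * C) * ((Real.pi / Complex.I) * a * B)
       + (A * s1 * F * B) * ((Real.pi / Complex.I) * b * C) - (A * s2 * F * B) * ((Real.pi / Complex.I) * b * C)) = A * (F * (B * C)) * ((a * (s1 + s2) + b * (s1 - s2)) / 2) := by
      intro s1 s2 A B C F
      field_simp
      ring
    have e4 := e3 (sgc 1 p : ℂ) (sgc (-1) p : ℂ) ((om M p.1 * om M p.2 : ℝ) : ℂ) (ee p.1 z.1) (ee p.2 z.2) (fourierCoef2 r p.1 p.2)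
    rw [Complex.ofReal_mul _ (sgc 1 p), Complex.ofReal_mul _ (sgc (-1) p), e4]
    unfold sgc
    push_cast at hm ⊢
    rw [hm]
    by_cases hc : (((-(n:ℤ) ≤ p.1 ∧ p.1 ≤ n) ∧ (-(n:ℤ) ≤ p.2 ∧ p.2 ≤ n)) ∧ ¬ (p.1 = 0 ∧ p.2 = 0))
    · rw [if_pos hc, if_pos (hcond.mpr hc), om_one M (by omega) (by omega), om_one M (by omega) (by omega)]
      unfold ch; push_cast; ring
    · rw [if_neg hc, if_neg (fun h => hc (hcond.mp h))]; simp
  rw [Finset.sum_congr rfl hterm, ← Finset.sum_filter]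
  have hf : Finset.filter (fun p => p ∈ s ∧ ¬ p = 0) (sq3 M) = s.erase 0 := by
    ext p; rw [Finset.mem_filter, Finset.mem_erase]
    exact ⟨fun h => ⟨h.2.2, h.2.1⟩, fun h => ⟨hsub h.2, h.2, h.1⟩⟩
  rw [hf]
  have h0 : (0 : ℤ × ℤ) ∈ s := by rw [hs, Finset.mem_product, Finset.mem_Icc, Finset.mem_Icc]; simp
  have := Finset.add_sum_erase s (fun p => fourierCoef2 r p.1 p.2 * ch p z) h0
  unfold SC
  rw [← this]
  congr 1
  unfold ch; simp [ee_zero]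

lemma Dbd_L1 {r : ℝ × ℝ → ℝ} {D : ℝ} (hD : Dbd r D) : ∫ u in T2, |r u| ≤ D := by
  have := hD (fun _ => 1) continuous_const (fun _ => zero_le_one) (by
    rw [setIntegral_const, T2_volr, smul_eq_mul]
    have := Real.exp_one_lt_d9
    nlinarith [sq_nonneg Real.pi])
  simpa using this

lemma fc00 {r : ℝ × ℝ → ℝ} {D : ℝ} (hD : Dbd r D) : ‖fourierCoef2 r 0 0‖ ≤ D := by
  have h := fc_eq r (0, 0)
  simp only at h
  rw [h, norm_mul]
  have h1 : ‖∫ u in T2, (r u : ℂ) * ch (-(0, 0)) u‖ ≤ D := by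
    refine (norm_integral_le_integral_norm _).trans ?_
    refine le_trans (le_of_eq ?_) (Dbd_L1 hD)
    congr 1; funext u; rw [norm_mul, ch_norm, mul_one, Complex.norm_real]; rfl
  have h2 : ‖(1 / (4 * (Real.pi : ℂ) ^ 2))‖ ≤ 1 := by
    rw [show (1 / (4 * (Real.pi : ℂ) ^ 2)) = ((1 / (4 * Real.pi ^ 2) : ℝ) : ℂ) by push_cast; rfl, Complex.norm_real, Real.norm_of_nonneg (by positivity)]
    apply div_le_one_of_le₀ _ (by positivity)
    nlinarith [Real.pi_gt_three]
  calc _ ≤ 1 * D := mul_le_mul h2 h1 (norm_nonneg _) zero_le_one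
    _ = D := one_mul D

lemma sq4 (a b c d : ℂ) : ‖a + b + c - d‖ ^ 2 ≤ 4 * (‖a‖ ^ 2 + ‖b‖ ^ 2 + ‖c‖ ^ 2 + ‖d‖ ^ 2) := by
  have h : ‖a + b + c - d‖ ≤ ‖a‖ + ‖b‖ + ‖c‖ + ‖d‖ := by
    have h1 := norm_sub_le (a + b + c) d
    have h2 := norm_add_le (a + b) c
    have h3 := norm_add_le a b
    linarith
  have h2 := pow_le_pow_left₀ (norm_nonneg _) h 2
  nlinarith [sq_nonneg (‖a‖ - ‖b‖), sq_nonneg (‖a‖ - ‖c‖), sq_nonneg (‖a‖ - ‖d‖), sq_nonneg (‖b‖ - ‖c‖), sq_nonneg (‖b‖ - ‖d‖), sq_nonneg (‖c‖ - ‖d‖)]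

lemma kappa_norm : ‖Complex.I / (2 * (Real.pi : ℂ))‖ ≤ 1 / 6 := by
  rw [norm_div, norm_mul, Complex.norm_I, Complex.norm_real, Real.norm_of_nonneg Real.pi_pos.le]
  rw [Complex.norm_ofNat]
  apply one_div_le_one_div_of_le (by norm_num)
  linarith [Real.pi_gt_three]

lemma comb_JN {S c1 c2 c3 c4 : ℕ → ℂ} {r0 : ℂ} {lam : ℝ} (hlam : 0 < lam) (hr0 : ‖r0‖ ≤ lam) {N0 : ℕ}
    (hS : ∀ n ≤ 2^N0, S n = r0 + (Complex.I / (2 * Real.pi)) * (c1 n + c2 n + c3 n - c4 n))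
    (h1 : (∀ j ≤ N0, ∀ b, ∃ α : ℂ, ∑ l ∈ Finset.range (2^j), ‖c1 (b+l) - α‖^2 ≤ 2^j*(2400*lam)^2) ∧ (∀ N, 0<N → N ≤ 2^N0 → ‖∑ n ∈ Finset.range N, c1 n‖ ≤ 18*N*lam))
    (h2 : (∀ j ≤ N0, ∀ b, ∃ α : ℂ, ∑ l ∈ Finset.range (2^j), ‖c2 (b+l) - α‖^2 ≤ 2^j*(2400*lam)^2) ∧ (∀ N, 0<N → N ≤ 2^N0 → ‖∑ n ∈ Finset.range N, c2 n‖ ≤ 18*N*lam))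
    (h3 : (∀ j ≤ N0, ∀ b, ∃ α : ℂ, ∑ l ∈ Finset.range (2^j), ‖c3 (b+l) - α‖^2 ≤ 2^j*(2400*lam)^2) ∧ (∀ N, 0<N → N ≤ 2^N0 → ‖∑ n ∈ Finset.range N, c3 n‖ ≤ 18*N*lam))
    (h4 : (∀ j ≤ N0, ∀ b, ∃ α : ℂ, ∑ l ∈ Finset.range (2^j), ‖c4 (b+l) - α‖^2 ≤ 2^j*(2400*lam)^2) ∧ (∀ N, 0<N → N ≤ 2^N0 → ‖∑ n ∈ Finset.range N, c4 n‖ ≤ 18*N*lam))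
    {N : ℕ} (hN : N ≤ N0) : ∑ n ∈ Finset.range (2^N), Real.exp (|(S n).re| / (8000 * lam)) ≤ 12 * 2 ^ N := by
  set κ := Complex.I / (2 * (Real.pi : ℂ)) with hκ
  have hk : ‖κ‖ ≤ 1 / 6 := kappa_norm
  have hpow : 2 ^ N ≤ 2 ^ N0 := Nat.pow_le_pow_right (by norm_num) hN
  have osc : ∀ j ≤ N, ∀ a, (a+1)*2^j ≤ 2^N → ∃ α : ℂ, ∑ l ∈ Finset.range (2^j), ‖S (a*2^j+l) - α‖^2 ≤ 2^j*(1600*lam)^2 := by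
    intro j hj a ha
    obtain ⟨α1, hα1⟩ := h1.1 j (hj.trans hN) (a*2^j)
    obtain ⟨α2, hα2⟩ := h2.1 j (hj.trans hN) (a*2^j)
    obtain ⟨α3, hα3⟩ := h3.1 j (hj.trans hN) (a*2^j)
    obtain ⟨α4, hα4⟩ := h4.1 j (hj.trans hN) (a*2^j)
    refine ⟨r0 + κ * (α1 + α2 + α3 - α4), ?_⟩
    calc ∑ l ∈ Finset.range (2^j), ‖S (a*2^j+l) - (r0 + κ * (α1 + α2 + α3 - α4))‖^2
        ≤ ∑ l ∈ Finset.range (2^j), 1 / 9 * (‖c1 (a*2^j+l) - α1‖ ^ 2 + ‖c2 (a*2^j+l) - α2‖ ^ 2 + ‖c3 (a*2^j+l) - α3‖ ^ 2 + ‖c4 (a*2^j+l) - α4‖ ^ 2) := by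
          refine Finset.sum_le_sum (fun l hl => ?_)
          rw [Finset.mem_range] at hl
          have hle : a*2^j+l ≤ 2^N0 := by nlinarith
          rw [hS _ hle, show r0 + κ * (c1 (a*2^j+l) + c2 (a*2^j+l) + c3 (a*2^j+l) - c4 (a*2^j+l)) - (r0 + κ * (α1 + α2 + α3 - α4))
            = κ * ((c1 (a*2^j+l) - α1) + (c2 (a*2^j+l) - α2) + (c3 (a*2^j+l) - α3) - (c4 (a*2^j+l) - α4)) by ring, norm_mul, mul_pow]
          have q1 := sq4 (c1 (a*2^j+l) - α1) (c2 (a*2^j+l) - α2) (c3 (a*2^j+l) - α3) (c4 (a*2^j+l) - α4)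
          have q2 : ‖κ‖ ^ 2 ≤ (1/6) ^ 2 := pow_le_pow_left₀ (norm_nonneg _) hk 2
          have q3 := mul_le_mul q2 q1 (by positivity) (by positivity)
          refine q3.trans (le_of_eq ?_); ring
      _ ≤ 2^j*(1600*lam)^2 := by
          rw [← Finset.mul_sum, Finset.sum_add_distrib, Finset.sum_add_distrib, Finset.sum_add_distrib]
          linarith
  have mean : ‖∑ n ∈ Finset.range (2^N), S n‖ ≤ 13 * 2^N * lam := by
    have e : ∑ n ∈ Finset.range (2^N), S n = (2^N : ℕ) * r0 + κ * (∑ n ∈ Finset.range (2^N), c1 n + ∑ n ∈ Finset.range (2^N), c2 n + ∑ n ∈ Finset.range (2^N), c3 n - ∑ n ∈ Finset.range (2^N), c4 n) := by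
      rw [← Finset.sum_add_distrib, ← Finset.sum_add_distrib, ← Finset.sum_sub_distrib, Finset.mul_sum, ← nsmul_eq_mul]
      conv_rhs => rw [← Finset.card_range (2^N), ← Finset.sum_const]
      rw [Finset.card_range, ← Finset.sum_add_distrib]
      refine Finset.sum_congr rfl (fun n hn => hS n ?_)
      rw [Finset.mem_range] at hn; omega
    rw [e]
    have p0 : 0 < 2 ^ N := by positivity
    have a1 := h1.2 (2^N) p0 hpow
    have a2 := h2.2 (2^N) p0 hpow
    have a3 := h3.2 (2^N) p0 hpow
    have a4 := h4.2 (2^N) p0 hpow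
    set C1 := ∑ n ∈ Finset.range (2^N), c1 n
    set C2 := ∑ n ∈ Finset.range (2^N), c2 n
    set C3 := ∑ n ∈ Finset.range (2^N), c3 n
    set C4 := ∑ n ∈ Finset.range (2^N), c4 n
    push_cast at a1 a2 a3 a4 ⊢
    have b1 : ‖C1 + C2 + C3 - C4‖ ≤ 72 * 2^N * lam := by
      have k1 := norm_sub_le (C1 + C2 + C3) C4
      have k2 := norm_add_le (C1 + C2) C3
      have k3 := norm_add_le C1 C2
      linarith
    refine (norm_add_le _ _).trans ?_
    rw [norm_mul, norm_mul]
    have b2 := mul_le_mul hk b1 (norm_nonneg _) (by norm_num)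
    have b3 : ‖(2:ℂ)^N‖ * ‖r0‖ ≤ 2^N * lam := by
      rw [norm_pow, Complex.norm_ofNat]; exact mul_le_mul_of_nonneg_left hr0 (by positivity)
    linarith
  have key : ∀ ε : ℝ, |ε| = 1 → ∑ n ∈ Finset.range (2^N), Real.exp (ε * (S n).re / (8000 * lam)) ≤ 6 * 2^N := by
    intro ε hε
    have hε2 : ε ^ 2 = 1 := by rw [← sq_abs, hε]; norm_num
    have J := dyadic_JN (fun n => ε * (S n).re / (8000 * lam)) N (by
      intro j hj a ha
      obtain ⟨α, hα⟩ := osc j hj a ha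
      refine ⟨ε * α.re / (8000 * lam), ?_⟩
      calc ∑ l ∈ Finset.range (2^j), (ε * (S (a*2^j+l)).re / (8000 * lam) - ε * α.re / (8000 * lam)) ^ 2
          ≤ ∑ l ∈ Finset.range (2^j), ‖S (a*2^j+l) - α‖^2 / (8000 * lam) ^ 2 := by
            refine Finset.sum_le_sum (fun l _ => ?_)
            rw [← sub_div, div_pow, ← mul_sub, mul_pow, hε2, one_mul, ← Complex.sub_re]
            apply div_le_div_of_nonneg_right _ (by positivity)
            rw [← sq_abs]
            exact pow_le_pow_left₀ (abs_nonneg _) (Complex.abs_re_le_norm _) 2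
        _ ≤ 2^j*(1600*lam)^2 / (8000 * lam) ^ 2 := by rw [← Finset.sum_div]; gcongr
        _ ≤ 2^j*(1/16) := by
            rw [mul_div_assoc]; apply mul_le_mul_of_nonneg_left _ (by positivity)
            rw [div_le_iff₀ (by positivity)]; nlinarith [sq_nonneg lam])
    refine J.trans ?_
    have m1 : (∑ n ∈ Finset.range (2^N), ε * (S n).re / (8000 * lam)) / 2^N ≤ 1 := by
      rw [← Finset.sum_div, ← Finset.mul_sum, ← Complex.re_sum, div_div, div_le_one (by positivity)]
      refine (le_abs_self _).trans ?_
      rw [abs_mul, hε, one_mul]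
      refine (Complex.abs_re_le_norm _).trans (mean.trans ?_)
      have : (0:ℝ) < lam * 2^N := by positivity
      nlinarith
    have m2 := Real.exp_le_exp.mpr m1
    have m3 := Real.exp_one_lt_d9
    have m4 : (0:ℝ) < 2^N := by positivity
    nlinarith
  have k1 := key 1 (by norm_num)
  have k2 := key (-1) (by norm_num)
  calc ∑ n ∈ Finset.range (2^N), Real.exp (|(S n).re| / (8000 * lam))
      ≤ ∑ n ∈ Finset.range (2^N), (Real.exp (1 * (S n).re / (8000 * lam)) + Real.exp (-1 * (S n).re / (8000 * lam))) := by
        refine Finset.sum_le_sum (fun n _ => ?_)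
        rcases abs_cases (S n).re with ⟨h, _⟩ | ⟨h, _⟩ <;> rw [h]
        · rw [one_mul]; exact le_add_of_nonneg_right (Real.exp_pos _).le
        · rw [neg_one_mul]; exact le_add_of_nonneg_left (Real.exp_pos _).le
    _ ≤ 12 * 2^N := by rw [Finset.sum_add_distrib]; linarith

def CW : ℝ := 60480000

lemma Dbd_nonneg {r : ℝ × ℝ → ℝ} {D : ℝ} (hD : Dbd r D) : 0 ≤ D :=
  le_trans (integral_nonneg (fun _ => abs_nonneg _)) (Dbd_L1 hD)

lemma exp_weak_N {r : ℝ × ℝ → ℝ} (hr : IntegrableOn r T2) {D : ℝ} (hD : Dbd r D) {mu : ℝ} (hmu : 0 < mu) (N0 : ℕ) :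
    volume {p ∈ T2 | ¬ ∀ N ≤ N0, ∑ n ∈ Finset.range (2^N), Real.exp (|Snn r n p.1 p.2| / mu) ≤ 12 * 2 ^ N} ≤ ENNReal.ofReal (CW * D / mu) := by
  have hD0 := Dbd_nonneg hD
  set lam := mu / 8000 with hl
  have hlam : 0 < lam := by positivity
  have hml : mu = 8000 * lam := by rw [hl]; ring
  by_cases hDl : D ≤ lam
  · set M := 2 ^ N0
    obtain ⟨E1, m1, v1, p1⟩ := slice2 (GG_continuous M 1 r) hlam N0
    obtain ⟨E2, m2, v2, p2⟩ := slice2 (GG_continuous M (-1) r) hlam N0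
    obtain ⟨E3, m3, v3, p3⟩ := slice2' (GG_continuous M 1 r) hlam N0
    obtain ⟨E4, m4, v4, p4⟩ := slice2' (GG_continuous M (-1) r) hlam N0
    have hsub : {p ∈ T2 | ¬ ∀ N ≤ N0, ∑ n ∈ Finset.range (2^N), Real.exp (|Snn r n p.1 p.2| / mu) ≤ 12 * 2 ^ N} ⊆ ((E1 ∪ E2) ∪ E3) ∪ E4 := by
      rintro p ⟨hp, hbad⟩
      by_contra hE
      rw [mem_union, mem_union, mem_union] at hE
      push Not at hE
      obtain ⟨⟨⟨n1, n2⟩, n3⟩, n4⟩ := hE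
      apply hbad
      intro N hN
      have := comb_JN (S := fun n => SC r n p) hlam ((fc00 hD).trans hDl) (N0 := N0) (fun n hn => SC_id r hn p)
        (p1 p hp n1) (p2 p hp n2) (p3 p hp n3) (p4 p hp n4) hN
      rw [hml]
      simpa only [Snn_SC] using this
    refine (measure_mono hsub).trans ?_
    have g1 := GG_L1 M 1 hr hD
    have g2 := GG_L1 M (-1) hr hD
    have bd : ∀ {I : ℝ}, I ≤ 9 / 2 * D → ENNReal.ofReal (420 * I / lam) ≤ ENNReal.ofReal (1890 * D / lam) := by
      intro I hI
      apply ENNReal.ofReal_le_ofReal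
      apply div_le_div_of_nonneg_right _ hlam.le
      linarith
    have w1 := v1.trans (bd g1)
    have w2 := v2.trans (bd g2)
    have w3 := v3.trans (bd g1)
    have w4 := v4.trans (bd g2)
    have hx : 0 ≤ 1890 * D / lam := by positivity
    calc _ ≤ ((volume E1 + volume E2) + volume E3) + volume E4 := by
            refine (measure_union_le _ _).trans (add_le_add_left ?_ _)
            refine (measure_union_le _ _).trans (add_le_add_left ?_ _)
            exact measure_union_le _ _
      _ ≤ ((ENNReal.ofReal (1890 * D / lam) + ENNReal.ofReal (1890 * D / lam)) + ENNReal.ofReal (1890 * D / lam)) + ENNReal.ofReal (1890 * D / lam) := by gcongr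
      _ = ENNReal.ofReal (CW * D / mu) := by
          rw [← ENNReal.ofReal_add hx hx, ← ENNReal.ofReal_add (by positivity) hx, ← ENNReal.ofReal_add (by positivity) hx]
          congr 1; unfold CW; rw [hml]; field_simp; ring
  · push Not at hDl
    refine (measure_mono (fun p hp => hp.1 : _ ⊆ T2)).trans ?_
    rw [← ENNReal.ofReal_toReal T2_fin.ne]
    apply ENNReal.ofReal_le_ofReal
    change volume.real T2 ≤ _
    rw [T2_volr, le_div_iff₀ hmu, hml]
    unfold CW
    have : Real.pi ^ 2 ≤ 16 := by nlinarith [Real.pi_lt_four, Real.pi_pos]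
    nlinarith

lemma exp_weak {r : ℝ × ℝ → ℝ} (hr : IntegrableOn r T2) {D : ℝ} (hD : Dbd r D) {mu : ℝ} (hmu : 0 < mu) :
    volume {p ∈ T2 | ¬ ∀ N, ∑ n ∈ Finset.range (2^N), Real.exp (|Snn r n p.1 p.2| / mu) ≤ 12 * 2 ^ N} ≤ ENNReal.ofReal (CW * D / mu) := by
  set B : ℕ → Set (ℝ × ℝ) := fun N0 => {p ∈ T2 | ¬ ∀ N ≤ N0, ∑ n ∈ Finset.range (2^N), Real.exp (|Snn r n p.1 p.2| / mu) ≤ 12 * 2 ^ N} with hB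
  have hmono : Monotone B := by
    intro a b hab p hp
    exact ⟨hp.1, fun h => hp.2 (fun N hN => h N (hN.trans hab))⟩
  have hsub : {p ∈ T2 | ¬ ∀ N, ∑ n ∈ Finset.range (2^N), Real.exp (|Snn r n p.1 p.2| / mu) ≤ 12 * 2 ^ N} ⊆ ⋃ n, B n := by
    rintro p ⟨hp, hbad⟩
    rw [mem_iUnion]
    push Not at hbad
    obtain ⟨N, hN⟩ := hbad
    exact ⟨N, hp, fun h => absurd (h N le_rfl) (not_le.mpr hN)⟩
  refine (measure_mono hsub).trans ?_
  rw [hmono.measure_iUnion]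
  exact iSup_le (fun N0 => exp_weak_N hr hD hmu N0)

lemma ch_int (p : ℤ × ℤ) : ∫ u in T2, ch p u = if p = 0 then ((4 * Real.pi ^ 2 : ℝ) : ℂ) else 0 := by
  rw [T2_int_eq (continuous_integrableOn_T2 (ch_continuous p))]
  unfold ch
  simp only
  simp only [integral_const_mul, integral_mul_const, ee_int]
  obtain ⟨a, b⟩ := p
  by_cases ha : a = 0 <;> by_cases hb : b = 0 <;> simp [ha, hb, Prod.ext_iff]
  ring

lemma fc_add {f g : ℝ × ℝ → ℝ} (hf : IntegrableOn f T2) (hg : IntegrableOn g T2) (p : ℤ × ℤ) :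
    fourierCoef2 (fun z => f z + g z) p.1 p.2 = fourierCoef2 f p.1 p.2 + fourierCoef2 g p.1 p.2 := by
  have hf' : IntegrableOn (fun z => (f z : ℂ)) T2 := hf.ofReal
  have hg' : IntegrableOn (fun z => (g z : ℂ)) T2 := hg.ofReal
  rw [fc_eq, fc_eq, fc_eq, ← mul_add, ← integral_add (ch_mul_int hf' _) (ch_mul_int hg' _)]
  congr 2; funext u; push_cast; ring

lemma Snn_add {f g : ℝ × ℝ → ℝ} (hf : IntegrableOn f T2) (hg : IntegrableOn g T2) (n : ℕ) (x y : ℝ) :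
    Snn (fun z => f z + g z) n x y = Snn f n x y + Snn g n x y := by
  rw [Snn_SC, Snn_SC, Snn_SC, ← Complex.add_re]
  congr 1
  unfold SC
  rw [← Finset.sum_add_distrib]
  refine Finset.sum_congr rfl (fun p _ => ?_)
  rw [fc_add hf hg]; ring

def RP (P : ℝ × ℝ → ℝ) : Prop := Continuous P ∧ ∃ d : ℕ, ∀ n ≥ d, ∀ x y, Snn P n x y = P (x, y)

lemma RP_add {f g : ℝ × ℝ → ℝ} (hf : RP f) (hg : RP g) : RP (fun z => f z + g z) := by
  obtain ⟨c1, d1, h1⟩ := hf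
  obtain ⟨c2, d2, h2⟩ := hg
  refine ⟨c1.add c2, max d1 d2, fun n hn x y => ?_⟩
  rw [Snn_add (continuous_integrableOn_T2 c1) (continuous_integrableOn_T2 c2), h1 n (le_of_max_le_left hn), h2 n (le_of_max_le_right hn)]

lemma RP_zero : RP (fun _ => 0) := by
  refine ⟨continuous_const, 0, fun n _ x y => ?_⟩
  rw [Snn_SC]; unfold SC
  have : ∀ p : ℤ × ℤ, fourierCoef2 (fun _ => 0) p.1 p.2 = 0 := by
    intro p; rw [fc_eq]; simp
  simp [this]

lemma RP_ch (c : ℂ) (p : ℤ × ℤ) : RP (fun z => (c * ch p z).re) := by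
  refine ⟨Complex.continuous_re.comp (continuous_const.mul (ch_continuous p)), p.1.natAbs + p.2.natAbs, fun n hn x y => ?_⟩
  have e : ∀ z, (((c * ch p z).re : ℝ) : ℂ) = c / 2 * ch p z + (starRingEnd ℂ) c / 2 * ch (-p) z := by
    intro z
    rw [Complex.re_eq_add_conj, map_mul, ch_conj]; ring
  have chm : ∀ a b : ℤ × ℤ, ∀ u, ch a u * ch b u = ch (a + b) u := by
    intro a b u; unfold ch
    rw [Prod.fst_add, Prod.snd_add, ← ee_mul, ← ee_mul]; ring
  have hfc : ∀ q : ℤ × ℤ, fourierCoef2 (fun z => (c * ch p z).re) q.1 q.2 = (if p = q then c / 2 else 0) + (if -p = q then (starRingEnd ℂ) c / 2 else 0) := by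
    intro q
    rw [fc_eq]
    simp only [e, add_mul, mul_assoc, chm]
    rw [integral_add ((continuous_integrableOn_T2 (ch_continuous _)).const_mul _) ((continuous_integrableOn_T2 (ch_continuous _)).const_mul _),
      integral_const_mul, integral_const_mul, ch_int, ch_int]
    have hpi : (Real.pi : ℂ) ≠ 0 := by exact_mod_cast Real.pi_ne_zero
    have k1 : (p + -q = 0) ↔ p = q := by rw [← sub_eq_add_neg, sub_eq_zero]
    have k2 : (-p + -q = 0) ↔ -p = q := by rw [← sub_eq_add_neg, sub_eq_zero]
    simp only [k1, k2]
    split_ifs <;> push_cast <;> field_simp <;> ring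
  rw [Snn_SC]
  have hmem : ∀ q : ℤ × ℤ, (q = p ∨ q = -p) → q ∈ Finset.Icc (-(n:ℤ)) (n:ℤ) ×ˢ Finset.Icc (-(n:ℤ)) (n:ℤ) := by
    intro q hq
    rw [Finset.mem_product, Finset.mem_Icc, Finset.mem_Icc]
    rcases hq with rfl | rfl
    · omega
    · rw [Prod.fst_neg, Prod.snd_neg]; omega
  unfold SC
  simp only [hfc, add_mul, ite_mul, zero_mul]
  rw [Finset.sum_add_distrib, Finset.sum_ite_eq, Finset.sum_ite_eq, if_pos (hmem _ (Or.inl rfl)), if_pos (hmem _ (Or.inr rfl))]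
  rw [← e (x, y)]
  exact Complex.ofReal_re _

def tor (z : ℝ × ℝ) : UnitAddTorus (Fin 2) := ![((z.1 / (2 * Real.pi) : ℝ) : UnitAddCircle), ((z.2 / (2 * Real.pi) : ℝ) : UnitAddCircle)]

lemma tor_cont : Continuous tor := by
  have hq : Continuous (fun x : ℝ => ((x / (2 * Real.pi) : ℝ) : UnitAddCircle)) := (AddCircle.continuous_mk' 1).comp (by fun_prop)
  refine continuous_pi (fun i => ?_)
  fin_cases i
  · exact hq.comp continuous_fst
  · exact hq.comp continuous_snd

lemma tor_inj : InjOn tor T2 := by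
  have h1 : ∀ x y : ℝ, x ∈ T1 → y ∈ T1 → ((x / (2 * Real.pi) : ℝ) : UnitAddCircle) = ((y / (2 * Real.pi) : ℝ) : UnitAddCircle) → x = y := by
    intro x y hx hy h
    have hpi := Real.pi_pos
    have hm : ∀ x ∈ T1, x / (2 * Real.pi) ∈ Ico (-1/2 : ℝ) (-1/2 + 1) := by
      intro x hx
      unfold T1 at hx
      rw [mem_Ico] at hx
      constructor
      · rw [le_div_iff₀ (by positivity)]; linarith
      · rw [div_lt_iff₀ (by positivity)]; linarith
    have := (AddCircle.coe_eq_coe_iff_of_mem_Ico (hm x hx) (hm y hy)).mp h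
    field_simp at this
    exact this
  intro p hp q hq h
  have a := congrFun h 0
  have b := congrFun h 1
  exact Prod.ext (h1 _ _ hp.1 hq.1 a) (h1 _ _ hp.2 hq.2 b)

lemma tor_four (n : Fin 2 → ℤ) (z : ℝ × ℝ) : UnitAddTorus.mFourier n (tor z) = ch (n 0, n 1) z := by
  unfold UnitAddTorus.mFourier tor ch ee
  simp only [ContinuousMap.coe_mk, Fin.prod_univ_two, Matrix.cons_val_zero, Matrix.cons_val_one]
  rw [fourier_coe_apply, fourier_coe_apply]
  have hpi : (Real.pi : ℂ) ≠ 0 := by exact_mod_cast Real.pi_ne_zero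
  congr 2
  · push_cast; field_simp
  · push_cast; field_simp

lemma RP_span {F : C(UnitAddTorus (Fin 2), ℂ)} (hF : F ∈ Submodule.span ℂ (range (UnitAddTorus.mFourier (d := Fin 2)))) :
    ∀ c : ℂ, RP (fun z => (c * F (tor z)).re) := by
  induction hF using Submodule.span_induction with
  | mem x h =>
    obtain ⟨n, rfl⟩ := h
    intro c
    simp only [tor_four]
    exact RP_ch c _
  | zero => intro c; simpa using RP_zero
  | add x y _ _ hx hy =>
    intro c
    have := RP_add (hx c) (hy c)
    simpa [mul_add] using this
  | smul a x _ hx =>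
    intro c
    have := hx (c * a)
    simpa [mul_assoc] using this

lemma dens2 {g : ℝ × ℝ → ℝ} (hg : Measurable g) {B : ℝ} (hB : ∀ z, |g z| ≤ B) {ε : ℝ} (hε : 0 < ε) :
    ∃ P, RP P ∧ ∫ z in T2, (g z - P z) ^ 2 ≤ ε := by
  have hemb : MeasurableEmbedding (T2.domRestrict tor) := ContinuousOn.measurableEmbedding T2_meas tor_cont.continuousOn tor_inj
  obtain ⟨g', hg', hgg⟩ := hemb.exists_measurable_extend (g := fun z : T2 => g z) (hg.comp measurable_subtype_coe) (fun _ => ⟨0⟩)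
  have hg1 : ∀ z ∈ T2, g' (tor z) = g z := fun z hz => congrFun hgg ⟨z, hz⟩
  have htm : Measurable tor := tor_cont.measurable
  set μ : Measure (UnitAddTorus (Fin 2)) := Measure.map tor (volume.restrict T2) with hμ
  haveI : IsFiniteMeasure μ := by rw [hμ]; infer_instance
  have hmem : MemLp g' (ENNReal.ofReal 2) μ := by
    refine MemLp.of_bound hg'.aestronglyMeasurable B ?_
    rw [hμ, ae_map_iff htm.aemeasurable (measurableSet_le hg'.norm measurable_const)]
    filter_upwards [ae_restrict_mem T2_meas] with z hz
    rw [hg1 z hz]; exact hB z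
  set η : ℝ := ε / 4 with hη
  obtain ⟨h, h1, _⟩ := hmem.exists_boundedContinuous_integral_rpow_sub_le (by norm_num : (0:ℝ) < 2) (by positivity : 0 < η)
  set hC : C(UnitAddTorus (Fin 2), ℂ) := ⟨fun t => (h t : ℂ), by fun_prop⟩ with hhC
  set θ : ℝ := Real.sqrt (ε / (16 * Real.pi ^ 2)) with hθ
  have hθ0 : 0 < θ := Real.sqrt_pos.mpr (by positivity)
  have hcl : hC ∈ (Submodule.span ℂ (range (UnitAddTorus.mFourier (d := Fin 2)))).topologicalClosure := by
    rw [UnitAddTorus.span_mFourier_closure_eq_top]; trivial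
  obtain ⟨F, hF, hd⟩ := Metric.mem_closure_iff.mp hcl θ hθ0
  refine ⟨fun z => (F (tor z)).re, by simpa using RP_span hF 1, ?_⟩
  have hb : ∀ z, |h (tor z) - (F (tor z)).re| ≤ θ := by
    intro z
    have := (ContinuousMap.dist_apply_le_dist (f := hC) (g := F) (tor z)).trans hd.le
    rw [Complex.dist_eq] at this
    refine le_trans ?_ this
    have := Complex.abs_re_le_norm (hC (tor z) - F (tor z))
    simpa [hhC] using this
  have hhc : Continuous (fun z => h (tor z)) := h.continuous.comp tor_cont
  have hi : IntegrableOn (fun z => (g z - h (tor z)) ^ 2) T2 := by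
    refine Integrable.mono' (g := fun _ => (B + ‖h‖) ^ 2) (integrable_const _) ((hg.sub hhc.measurable).pow_const 2).aestronglyMeasurable (Eventually.of_forall (fun z => ?_))
    rw [Real.norm_of_nonneg (sq_nonneg _), ← sq_abs]
    apply pow_le_pow_left₀ (abs_nonneg _)
    refine (abs_sub _ _).trans (add_le_add (hB z) ?_)
    exact h.norm_coe_le_norm (tor z)
  have h2 : ∫ z in T2, (g z - h (tor z)) ^ 2 ≤ η := by
    rw [hμ, integral_map htm.aemeasurable] at h1
    · refine le_trans (le_of_eq ?_) h1
      refine setIntegral_congr_fun T2_meas (fun z hz => ?_)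
      rw [hg1 z hz, Real.rpow_ofNat, Real.norm_eq_abs, sq_abs]
    · exact ((hg'.sub h.continuous.measurable).norm.pow_const (2:ℝ)).aestronglyMeasurable
  have hFc : Continuous (fun z => (F (tor z)).re) := Complex.continuous_re.comp (F.continuous.comp tor_cont)
  calc ∫ z in T2, (g z - (F (tor z)).re) ^ 2 ≤ ∫ z in T2, (2 * (g z - h (tor z)) ^ 2 + 2 * θ ^ 2) := by
        refine integral_mono_of_nonneg (Eventually.of_forall (fun z => sq_nonneg _)) ((hi.const_mul 2).add (integrable_const _)) (Eventually.of_forall (fun z => ?_))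
        simp only
        have q1 := pow_le_pow_left₀ (abs_nonneg _) (hb z) 2
        rw [sq_abs] at q1
        nlinarith [sq_nonneg ((g z - h (tor z)) - (h (tor z) - (F (tor z)).re))]
    _ = 2 * (∫ z in T2, (g z - h (tor z)) ^ 2) + 4 * Real.pi ^ 2 * (2 * θ ^ 2) := by
        rw [integral_add (hi.const_mul 2) (integrable_const _), integral_const_mul, setIntegral_const, T2_volr, smul_eq_mul]
    _ ≤ ε := by
        rw [hθ, Real.sq_sqrt (by positivity)]
        have : 4 * Real.pi ^ 2 * (2 * (ε / (16 * Real.pi ^ 2))) = ε / 2 := by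
          have := Real.pi_ne_zero
          field_simp; ring
        rw [this]; linarith

lemma log_le_logPlus (a : ℝ) : Real.log a ≤ logPlus |a| := by
  unfold logPlus
  rw [← Real.log_abs a]
  split_ifs with h
  · exact le_rfl
  · exact Real.log_nonpos (abs_nonneg _) (not_lt.mp h)

lemma young_exp {a δ b : ℝ} (ha : 0 ≤ a) (hδ : 0 < δ) : a * b ≤ a * logPlus a + Real.log (1 / δ) * a + δ * Real.exp b := by
  rcases ha.eq_or_lt with rfl | ha
  · simp; positivity
  have h1 : b - Real.log (a / δ) ≤ Real.exp (b - Real.log (a / δ)) := by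
    linarith [Real.add_one_le_exp (b - Real.log (a / δ))]
  rw [Real.exp_sub, Real.exp_log (by positivity), Real.log_div ha.ne' hδ.ne'] at h1
  have h2 := mul_le_mul_of_nonneg_left h1 ha.le
  have h3 : a * (Real.exp b / (a / δ)) = δ * Real.exp b := by field_simp
  have h4 := log_le_logPlus a
  rw [abs_of_pos ha] at h4
  rw [h3] at h2
  have h5 : Real.log (1 / δ) = - Real.log δ := by rw [one_div, Real.log_inv]
  rw [h5]
  nlinarith

lemma dens_Dbd {f : ℝ × ℝ → ℝ} (hmeas : Measurable f) (hint : IntegrableOn f T2)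
    (hlog : IntegrableOn (fun p => |f p| * logPlus |f p|) T2) {D : ℝ} (hD : 0 < D) :
    ∃ P, RP P ∧ Dbd (fun z => f z - P z) D := by
  have hpi := Real.pi_pos
  set δ : ℝ := min 1 (D / (96 * Real.pi ^ 2)) with hδ
  have hδ0 : 0 < δ := lt_min one_pos (by positivity)
  have hδ1 : δ ≤ 1 := min_le_left _ _
  have hδ2 : δ * (96 * Real.pi ^ 2) ≤ D := by
    have : δ ≤ D / (96 * Real.pi ^ 2) := min_le_right _ _
    rwa [le_div_iff₀ (by positivity)] at this
  have hL : 0 ≤ Real.log (1 / δ) := Real.log_nonneg (by rw [le_div_iff₀ hδ0]; linarith)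
  set h : ℝ × ℝ → ℝ := fun p => |f p| * logPlus |f p| + Real.log (1 / δ) * |f p| with hh
  have hhi : IntegrableOn h T2 := hlog.add (hint.abs.const_mul _)
  have hh0 : ∀ p, 0 ≤ h p := by
    intro p
    have : 0 ≤ logPlus |f p| := by
      unfold logPlus; split_ifs with h1
      · exact Real.log_nonneg h1.le
      · exact le_rfl
    simp only [hh]; positivity
  set S : ℕ → Set (ℝ × ℝ) := fun n => {p | (n:ℝ) < |f p|} with hS
  have hSm : ∀ n, MeasurableSet (S n) := fun n => measurableSet_lt measurable_const hmeas.abs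
  have hSa : Antitone S := by
    intro a b hab p hp
    have : (a:ℝ) ≤ b := by exact_mod_cast hab
    exact lt_of_le_of_lt this hp
  have hSe : ⋂ n, S n = ∅ := by
    rw [eq_empty_iff_forall_notMem]
    intro p hp
    rw [mem_iInter] at hp
    obtain ⟨n, hn⟩ := exists_nat_gt |f p|
    exact absurd (hp n) (not_lt.mpr hn.le)
  have ht := tendsto_setIntegral_of_antitone (μ := volume.restrict T2) (f := h) hSm hSa ⟨0, hhi.integrableOn⟩
  rw [hSe, setIntegral_empty] at ht
  obtain ⟨M, hM⟩ := (ht.eventually (gt_mem_nhds (by positivity : (0:ℝ) < D / 3))).exists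
  set g : ℝ × ℝ → ℝ := fun p => max (-(M:ℝ)) (min M (f p)) with hg
  have hM0 : (0:ℝ) ≤ M := Nat.cast_nonneg M
  have hgm : Measurable g := measurable_const.max (measurable_const.min hmeas)
  have hgb : ∀ z, |g z| ≤ M := by
    intro z; rw [abs_le]; simp only [hg]
    exact ⟨le_max_left _ _, max_le (by linarith) (min_le_left _ _)⟩
  obtain ⟨P, hP, hPε⟩ := dens2 hgm hgb (by positivity : 0 < 2 * δ * (D / 3))
  refine ⟨P, hP, fun W hW hW0 hWe => ?_⟩
  have hPc := hP.1
  have i2 : IntegrableOn (fun u => Real.exp (W u)) T2 := continuous_integrableOn_T2 (by fun_prop)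
  have i3 : IntegrableOn (fun u => (g u - P u) ^ 2) T2 := by
    have hgi : IntegrableOn (fun u => (g u) ^ 2) T2 := by
      refine Integrable.mono' (g := fun _ => (M:ℝ) ^ 2) (integrable_const _) (hgm.pow_const 2).aestronglyMeasurable (Eventually.of_forall (fun z => ?_))
      rw [Real.norm_of_nonneg (sq_nonneg _), ← sq_abs]
      exact pow_le_pow_left₀ (abs_nonneg _) (hgb z) 2
    have hPi : IntegrableOn (fun u => (P u) ^ 2) T2 := continuous_integrableOn_T2 (by fun_prop)
    refine Integrable.mono' ((hgi.const_mul 2).add (hPi.const_mul 2)) ((hgm.sub hPc.measurable).pow_const 2).aestronglyMeasurable (Eventually.of_forall (fun z => ?_))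
    rw [Real.norm_of_nonneg (sq_nonneg _)]
    simp only [Pi.add_apply]
    nlinarith [sq_nonneg (g z + P z)]
  have i1 : IntegrableOn ((S M).indicator h) T2 := hhi.indicator (hSm M)
  have i4 : IntegrableOn (fun u => 2 * δ * Real.exp (W u) + 1 / (2 * δ) * (g u - P u) ^ 2) T2 := (i2.const_mul _).add (i3.const_mul _)
  calc ∫ u in T2, |f u - P u| * W u ≤ ∫ u in T2, ((S M).indicator h u + (2 * δ * Real.exp (W u) + 1 / (2 * δ) * (g u - P u) ^ 2)) := by
        refine integral_mono_of_nonneg (Eventually.of_forall (fun z => mul_nonneg (abs_nonneg _) (hW0 z)))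
          (i1.add ((i2.const_mul _).add (i3.const_mul _))) (Eventually.of_forall (fun z => ?_))
        simp only
        have hw := hW0 z
        have q1 : |f z - g z| * W z ≤ (S M).indicator h z + δ * Real.exp (W z) := by
          by_cases hz : z ∈ S M
          · rw [indicator_of_mem hz]
            have k1 : |f z - g z| ≤ |f z| := by
              simp only [hg]
              rcases le_total (f z) 0 with k | k
              · rw [min_eq_right (by linarith), abs_of_nonpos k, abs_of_nonpos]
                · have : max (-(M:ℝ)) (f z) ≤ 0 := max_le (by linarith) k
                  linarith
                · linarith [le_max_right (-(M:ℝ)) (f z)]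
              · have k2 : 0 ≤ min (M:ℝ) (f z) := le_min hM0 k
                rw [max_eq_right (by linarith), abs_of_nonneg k, abs_of_nonneg]
                · linarith
                · linarith [min_le_right (M:ℝ) (f z)]
            have k3 := young_exp (b := W z) (abs_nonneg (f z)) hδ0
            have k4 := mul_le_mul_of_nonneg_right k1 hw
            simp only [hh]; linarith
          · rw [indicator_of_notMem hz]
            have hz' : |f z| ≤ M := not_lt.mp hz
            rw [abs_le] at hz'
            have : g z = f z := by
              simp only [hg]; rw [min_eq_right hz'.2, max_eq_right hz'.1]
            rw [this, sub_self, abs_zero, zero_mul, zero_add]; positivity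
        have q2 : |g z - P z| * W z ≤ δ * Real.exp (W z) + 1 / (2 * δ) * (g z - P z) ^ 2 := by
          have k1 := Real.quadratic_le_exp_of_nonneg hw
          have k2 : |g z - P z| * W z ≤ δ / 2 * W z ^ 2 + 1 / (2 * δ) * |g z - P z| ^ 2 := by
            have : 0 ≤ (δ * W z - |g z - P z|) ^ 2 / (2 * δ) := by positivity
            have e : (δ * W z - |g z - P z|) ^ 2 / (2 * δ) = δ / 2 * W z ^ 2 + 1 / (2 * δ) * |g z - P z| ^ 2 - |g z - P z| * W z := by
              field_simp; ring
            linarith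
          rw [sq_abs] at k2
          nlinarith
        have q3 : |f z - P z| ≤ |f z - g z| + |g z - P z| := by
          have := abs_add_le (f z - g z) (g z - P z)
          rwa [sub_add_sub_cancel] at this
        have q4 := mul_le_mul_of_nonneg_right q3 hw
        linarith
    _ = (∫ u in S M, h u ∂(volume.restrict T2)) + (2 * δ * (∫ u in T2, Real.exp (W u)) + 1 / (2 * δ) * ∫ u in T2, (g u - P u) ^ 2) := by
        rw [integral_add i1 i4, integral_add (i2.const_mul _) (i3.const_mul _), integral_const_mul, integral_const_mul,
          integral_indicator (hSm M)]
    _ ≤ D := by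
        have a1 : 1 / (2 * δ) * ∫ u in T2, (g u - P u) ^ 2 ≤ D / 3 := by
          rw [one_div, inv_mul_le_iff₀ (by positivity)]; exact hPε
        have a2 : 2 * δ * (∫ u in T2, Real.exp (W u)) ≤ 2 * δ * (16 * Real.pi ^ 2) := by gcongr
        linarith

lemma fin_pt {ξ u : ℕ → ℝ} {A : ℝ} {d : ℕ} (hu : ∀ k ≥ d, A * |ξ k| ≤ (u k + 1) / 144)
    (hsum : ∀ N, ∑ k ∈ Finset.range (2^N), Real.exp (u k) ≤ 12 * 2^N) :
    ∀ᶠ n : ℕ in atTop, ∑ k ∈ Finset.range (n+1), (Real.exp (A * |ξ k|) - 1) ≤ n + 1 := by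
  set C := ∑ k ∈ Finset.range d, Real.exp (A * |ξ k|) with hC
  obtain ⟨m, hm⟩ := exists_nat_ge (2 * C)
  filter_upwards [eventually_ge_atTop (max m d)] with n hn
  have hnm : m ≤ n := le_of_max_le_left hn
  have hnd : d ≤ n := le_of_max_le_right hn
  have hC2 : C ≤ (n + 1) / 2 := by
    have : (m:ℝ) ≤ n := by exact_mod_cast hnm
    linarith
  have hpt : ∀ k, Real.exp (A * |ξ k|) - 1 ≤ (if k < d then Real.exp (A * |ξ k|) else 0) + 3 / 144 * Real.exp (u k) := by
    intro k
    by_cases hk : k < d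
    · rw [if_pos hk]
      have := Real.exp_pos (u k)
      linarith
    · rw [if_neg hk]
      have h1 := Real.exp_le_exp.mpr (hu k (not_lt.mp hk))
      have h2 := convexOn_exp.2 (mem_univ (0:ℝ)) (mem_univ (u k + 1)) (by norm_num : (0:ℝ) ≤ 143 / 144) (by norm_num : (0:ℝ) ≤ 1 / 144) (by norm_num)
      simp only [smul_eq_mul, mul_zero, zero_add, Real.exp_zero] at h2
      rw [show 1 / 144 * (u k + 1) = (u k + 1) / 144 by ring, Real.exp_add] at h2
      have h3 := Real.exp_one_lt_d9
      have h4 := Real.exp_pos (u k)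
      nlinarith
  obtain ⟨N, hN1, hN2⟩ : ∃ N : ℕ, n + 1 ≤ 2 ^ N ∧ 2 ^ N ≤ 2 * (n + 1) := by
    refine ⟨Nat.log 2 (n+1) + 1, (Nat.lt_pow_succ_log_self (by norm_num) _).le, ?_⟩
    have := Nat.pow_log_le_self 2 (x := n+1) (by omega)
    rw [pow_succ]; omega
  calc ∑ k ∈ Finset.range (n+1), (Real.exp (A * |ξ k|) - 1)
      ≤ ∑ k ∈ Finset.range (n+1), ((if k < d then Real.exp (A * |ξ k|) else 0) + 3 / 144 * Real.exp (u k)) := Finset.sum_le_sum (fun k _ => hpt k)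
    _ = C + 3 / 144 * ∑ k ∈ Finset.range (n+1), Real.exp (u k) := by
        rw [Finset.sum_add_distrib, ← Finset.mul_sum, ← Finset.sum_filter]
        congr 2
        ext k; rw [Finset.mem_filter, Finset.mem_range, Finset.mem_range]; omega
    _ ≤ C + 3 / 144 * (12 * 2^N) := by
        gcongr
        refine le_trans (Finset.sum_le_sum_of_subset_of_nonneg ?_ (fun k _ _ => (Real.exp_pos _).le)) (hsum N)
        exact Finset.range_subset_range.mpr hN1
    _ ≤ n + 1 := by
        have : ((2:ℝ)^N) ≤ 2 * (n + 1) := by exact_mod_cast hN2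
        linarith

lemma step_val (ξ : ℕ → ℝ) (n : ℕ) {t : ℝ} (ht : 0 ≤ t) (hg : ∀ j : ℕ, t ≠ (j:ℝ) / ((n:ℝ) + 1)) :
    ∀ k : ℕ, t ∈ Icc ((k : ℝ) / ((n : ℝ) + 1)) (((k : ℝ) + 1) / ((n : ℝ) + 1)) ↔ ⌊t * (n + 1)⌋₊ = k := by
  intro k
  have hn : (0:ℝ) < (n:ℝ) + 1 := by positivity
  rw [Nat.floor_eq_iff (by positivity), mem_Icc, div_le_iff₀ hn, le_div_iff₀ hn]
  constructor
  · rintro ⟨h1, h2⟩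
    refine ⟨h1, lt_of_le_of_ne h2 (fun h => hg (k+1) ?_)⟩
    rw [eq_div_iff hn.ne', h]; push_cast; rfl
  · rintro ⟨h1, h2⟩; exact ⟨h1, h2.le⟩

lemma lux_le {ξ : ℕ → ℝ} {n : ℕ} {A : ℝ} (hA : 0 < A) (h : ∑ k ∈ Finset.range (n+1), (Real.exp (A * |ξ k|) - 1) ≤ n + 1) :
    luxNorm (volume.restrict (Set.Icc (0:ℝ) 1)) PsiY (stepFun ξ n) ≤ 1 / A := by
  unfold luxNorm
  apply csInf_le ⟨0, fun x hx => hx.1.le⟩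
  refine ⟨by positivity, ?_⟩
  have hn : (0:ℝ) < (n:ℝ) + 1 := by positivity
  have hψ : ∀ k, 0 ≤ Real.exp (A * |ξ k|) - 1 := by
    intro k; have := Real.one_le_exp (by positivity : 0 ≤ A * |ξ k|); linarith
  set I : ℕ → Set ℝ := fun k => Icc ((k : ℝ) / ((n : ℝ) + 1)) (((k : ℝ) + 1) / ((n : ℝ) + 1)) with hI
  calc ∫⁻ t in Icc (0:ℝ) 1, ENNReal.ofReal (PsiY (|stepFun ξ n t| / (1 / A)))
      ≤ ∫⁻ t in Icc (0:ℝ) 1, ∑ k ∈ Finset.range (n+1), (I k).indicator (fun _ => ENNReal.ofReal (Real.exp (A * |ξ k|) - 1)) t := by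
        refine lintegral_mono_ae ?_
        have hc : (range (fun j : ℕ => (j:ℝ) / ((n:ℝ) + 1))).Countable := countable_range _
        filter_upwards [ae_restrict_mem measurableSet_Icc, ae_restrict_of_ae (hc.ae_notMem volume)] with t ht hg
        have hv := step_val ξ n ht.1 (fun j hj => hg ⟨j, hj.symm⟩)
        set k0 := ⌊t * (n + 1)⌋₊
        have hs : stepFun ξ n t = if k0 ∈ Finset.range (n+1) then ξ k0 else 0 := by
          unfold stepFun
          rw [← Finset.sum_ite_eq]
          refine Finset.sum_congr rfl (fun k _ => ?_)
          rw [indicator_apply]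
          simp only [hv k]
        have hs2 : ∑ k ∈ Finset.range (n+1), (I k).indicator (fun _ => ENNReal.ofReal (Real.exp (A * |ξ k|) - 1)) t
            = if k0 ∈ Finset.range (n+1) then ENNReal.ofReal (Real.exp (A * |ξ k0|) - 1) else 0 := by
          rw [← Finset.sum_ite_eq (Finset.range (n+1)) k0 (fun k => ENNReal.ofReal (Real.exp (A * |ξ k|) - 1))]
          refine Finset.sum_congr rfl (fun k _ => ?_)
          rw [indicator_apply]
          simp only [hI, hv k]
        rw [hs, hs2]
        unfold PsiY
        split_ifs
        · rw [div_div_eq_mul_div, div_one, mul_comm]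
        · simp
    _ = ∑ k ∈ Finset.range (n+1), ∫⁻ t in Icc (0:ℝ) 1, (I k).indicator (fun _ => ENNReal.ofReal (Real.exp (A * |ξ k|) - 1)) t := by
        rw [lintegral_finsetSum]
        intro k _
        exact measurable_const.indicator measurableSet_Icc
    _ ≤ ∑ k ∈ Finset.range (n+1), ENNReal.ofReal ((Real.exp (A * |ξ k|) - 1) * (1 / (n + 1))) := by
        refine Finset.sum_le_sum (fun k _ => ?_)
        rw [lintegral_indicator_const measurableSet_Icc, ENNReal.ofReal_mul (hψ k)]
        gcongr
        refine (Measure.restrict_apply_le _ _).trans ?_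
        rw [Real.volume_Icc]
        apply le_of_eq; congr 1; rw [← sub_div]; ring
    _ = ENNReal.ofReal (∑ k ∈ Finset.range (n+1), (Real.exp (A * |ξ k|) - 1) * (1 / (n + 1))) := by
        rw [ENNReal.ofReal_sum_of_nonneg]
        intro k _; exact mul_nonneg (hψ k) (by positivity)
    _ ≤ 1 := by
        rw [← Finset.sum_mul, ENNReal.ofReal_le_one, mul_one_div, div_le_one hn]
        exact h

lemma bad_null {f : ℝ × ℝ → ℝ} (hmeas : Measurable f) (hint : IntegrableOn f T2)
    (hlog : IntegrableOn (fun p => |f p| * logPlus |f p|) T2) {A : ℝ} (hA : 0 < A) :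
    volume {p ∈ T2 | ¬ ∀ᶠ n : ℕ in atTop, ∑ k ∈ Finset.range (n+1), (Real.exp (A * |Snn f k p.1 p.2 - f p|) - 1) ≤ n + 1} = 0 := by
  rw [← nonpos_iff_eq_zero]
  apply ENNReal.le_of_forall_pos_le_add
  intro ε hε _
  rw [zero_add]
  have hε' : (0:ℝ) < ε := hε
  set mu : ℝ := 1 / (144 * A) with hmu
  have hmu0 : 0 < mu := by positivity
  have hCW : 0 < CW := by unfold CW; norm_num
  set D : ℝ := ε * mu / (CW + 1) with hDd
  have hD : 0 < D := by positivity
  obtain ⟨P, hP, hDb⟩ := dens_Dbd hmeas hint hlog hD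
  obtain ⟨hPc, d, hPd⟩ := hP
  have hPi := continuous_integrableOn_T2 hPc
  set r : ℝ × ℝ → ℝ := fun z => f z - P z with hr
  have hri : IntegrableOn r T2 := hint.sub hPi
  have hfr : f = fun z => r z + P z := by funext z; simp [hr]
  have w := exp_weak hri hDb hmu0
  have hsub : {p ∈ T2 | ¬ ∀ᶠ n : ℕ in atTop, ∑ k ∈ Finset.range (n+1), (Real.exp (A * |Snn f k p.1 p.2 - f p|) - 1) ≤ n + 1}
      ⊆ {p ∈ T2 | ¬ ∀ N, ∑ n ∈ Finset.range (2^N), Real.exp (|Snn r n p.1 p.2| / mu) ≤ 12 * 2 ^ N} ∪ ({p | mu ≤ |r p|} ∩ T2) := by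
    rintro p ⟨hp, hbad⟩
    by_contra hE
    rw [mem_union, not_or] at hE
    obtain ⟨n1, n2⟩ := hE
    have g1 : ∀ N, ∑ n ∈ Finset.range (2^N), Real.exp (|Snn r n p.1 p.2| / mu) ≤ 12 * 2 ^ N := by
      by_contra h; exact n1 ⟨hp, h⟩
    have g2 : |r p| < mu := by
      by_contra h; exact n2 ⟨not_lt.mp h, hp⟩
    apply hbad
    refine fin_pt (d := d) (u := fun n => |Snn r n p.1 p.2| / mu) (fun k hk => ?_) g1
    have e1 : Snn f k p.1 p.2 - f p = Snn r k p.1 p.2 - r p := by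
      have : Snn f k p.1 p.2 = Snn r k p.1 p.2 + Snn P k p.1 p.2 := by
        conv_lhs => rw [hfr]
        exact Snn_add hri hPi k p.1 p.2
      rw [this, hPd k hk]
      simp only [hr, Prod.mk.eta]; ring
    rw [e1]
    have e2 := abs_sub (Snn r k p.1 p.2) (r p)
    have e3 : (|Snn r k p.1 p.2| / mu + 1) / 144 = A * (|Snn r k p.1 p.2| + mu) := by
      rw [hmu]; field_simp
    rw [e3]
    apply mul_le_mul_of_nonneg_left _ hA.le
    linarith
  have mk : volume ({p | mu ≤ |r p|} ∩ T2) ≤ ENNReal.ofReal (D / mu) := by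
    have hm : MeasurableSet {p | mu ≤ |r p|} := measurableSet_le measurable_const (hmeas.sub hPc.measurable).abs
    rw [← Measure.restrict_apply hm]
    have h1 := mul_meas_ge_le_integral_of_nonneg (μ := volume.restrict T2) (f := fun p => |r p|) (Eventually.of_forall (fun _ => abs_nonneg _)) hri.abs mu
    have h2 := h1.trans (Dbd_L1 hDb)
    rw [← ENNReal.ofReal_toReal (measure_ne_top (volume.restrict T2) {p | mu ≤ |r p|})]
    apply ENNReal.ofReal_le_ofReal
    rw [le_div_iff₀ hmu0, mul_comm]
    exact h2
  calc _ ≤ ENNReal.ofReal (CW * D / mu) + ENNReal.ofReal (D / mu) := (measure_mono hsub).trans ((measure_union_le _ _).trans (add_le_add w mk))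
    _ = ENNReal.ofReal ε := by
        rw [← ENNReal.ofReal_add (by positivity) (by positivity)]
        congr 1
        rw [hDd]; field_simp
    _ = ε := ENNReal.ofReal_coe_nnreal

/-- for `f ∈ L log L(𝕋²)`, for a.e. `(x,y) ∈ 𝕋²`,
`‖Σ_{k=0}^n (S_{kk}(x,y,f) - f(x,y)) 𝟙_{δ_k^n}‖_(Ψ) → 0` as `n → ∞`, where
`Ψ(t) = eᵗ - 1` and the Luxemburg norm is taken on `[0,1]`. -/
theorem ae_psi_norm_tendsto_zero (f : ℝ × ℝ → ℝ)
    (hmeas : Measurable f) (hper : Biperiodic f)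
    (hint : IntegrableOn f T2)
    (hlog : IntegrableOn (fun p => |f p| * logPlus |f p|) T2) :
    ∀ᵐ p ∂(volume.restrict T2),
      Filter.Tendsto
        (fun n : ℕ =>
          luxNorm (volume.restrict (Set.Icc (0 : ℝ) 1)) PsiY
            (stepFun (fun k => Snn f k p.1 p.2 - f p) n))
        Filter.atTop (nhds 0) := by
  have h1 : ∀ a : ℕ, ∀ᵐ p ∂(volume.restrict T2), ∀ᶠ n : ℕ in atTop, ∑ k ∈ Finset.range (n+1), (Real.exp (((a:ℝ) + 1) * |Snn f k p.1 p.2 - f p|) - 1) ≤ n + 1 := by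
    intro a
    rw [ae_restrict_iff' T2_meas, ae_iff]
    have := bad_null hmeas hint hlog (by positivity : (0:ℝ) < (a:ℝ) + 1)
    convert this using 2
    ext p; simp
  rw [← ae_all_iff] at h1
  filter_upwards [h1] with p hp
  rw [Metric.tendsto_atTop]
  intro ε hε
  obtain ⟨a, ha⟩ := exists_nat_one_div_lt hε
  obtain ⟨n0, hn0⟩ := eventually_atTop.mp (hp a)
  refine ⟨n0, fun n hn => ?_⟩
  have h2 := lux_le (ξ := fun k => Snn f k p.1 p.2 - f p) (by positivity : (0:ℝ) < (a:ℝ) + 1) (hn0 n hn)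
  have h3 : 0 ≤ luxNorm (volume.restrict (Set.Icc (0:ℝ) 1)) PsiY (stepFun (fun k => Snn f k p.1 p.2 - f p) n) := by
    unfold luxNorm
    exact Real.sInf_nonneg (fun x hx => hx.1.le)
  rw [Real.dist_eq, sub_zero, abs_of_nonneg h3]
  exact lt_of_le_of_lt h2 ha
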